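/- arXiv:2507.12926 — 2 statements merged into one kernel-verified Lean document; each statement's English description precedes it below -/
import Mathlib

section
/- For every real constant C > 1 there exist ε0 > 0 and an integer D0 such that for every integer D ≥ D0 there exists ℓ0 such that for every integer ℓ ≥ ℓ0, setting k = D²ℓ², there exists p ∈ (p_C, 1/2) for which the monochromatic clique probabilities of the random sphere graph satisfy: P_red,ℓ ≤ (p_C − ε0·ℓ/√k)^{binom(ℓ,2)} and P̄_blue,⌈Cℓ⌉ ≤ (1 − p_C − ε0·ℓ/√k)^{binom(⌈Cℓ⌉,2)}. -/
open MeasureTheory Real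
open scoped ENNReal RealInnerProductSpace BigOperators

noncomputable section

/-- The ambient Euclidean space `ℝ^{k+1}`. -/
abbrev Amb (k : ℕ) := EuclideanSpace ℝ (Fin (k + 1))

/-- The surface measure on the unit sphere `S^k ⊆ ℝ^{k+1}`, as a measure on the
ambient space. -/
def sphereSurface (k : ℕ) : Measure (Amb k) :=
  ((volume : Measure (Amb k)).toSphere).map Subtype.val

/-- The uniform probability measure `ℙ` on the unit sphere `S^k ⊆ ℝ^{k+1}`
(normalized surface measure), as a measure on the ambient space. -/
def sphereUniform (k : ℕ) : Measure (Amb k) :=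
  (sphereSurface k Set.univ)⁻¹ • sphereSurface k

/-- `c` is the constant `c_{k,p}`: `c ≥ 0` and for a (fixed, arbitrary) unit vector `e`,
`ℙ(⟨x, e⟩ ≤ -c/√k) = p`. -/
def IsCkp (k : ℕ) (p c : ℝ) : Prop :=
  0 ≤ c ∧ ∀ e : Amb k, ‖e‖ = 1 →
    sphereUniform k {x | ⟪x, e⟫ ≤ -c / Real.sqrt k} = ENNReal.ofReal p

/-- `p` is the constant `p_C`: the unique `p ∈ (0,1/2)` with `C = log p / log (1-p)`. -/
def IsPC (C p : ℝ) : Prop :=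
  p ∈ Set.Ioo (0 : ℝ) (1 / 2) ∧ C = Real.log p / Real.log (1 - p)

open ProbabilityTheory

/-- The standard Gaussian measure on `ℝ`. -/
abbrev stdG : Measure ℝ := gaussianReal 0 1

/-- The standard Gaussian measure on `ℝ^m`, as a product measure. -/
abbrev stdGPi (m : ℕ) : Measure (Fin m → ℝ) := Measure.pi fun _ => stdG

lemma lintegral_pi_succ {α : Type*} [MeasurableSpace α] (μ : Measure α) [SigmaFinite μ] {m : ℕ}
    {f : (Fin (m + 1) → α) → ℝ≥0∞} (hf : Measurable f) :
    ∫⁻ x, f x ∂(Measure.pi fun _ => μ)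
      = ∫⁻ x, ∫⁻ a, f (Fin.cons a x) ∂μ ∂(Measure.pi fun _ : Fin m => μ) := by
  have h := measurePreserving_piFinSuccAbove (fun _ : Fin (m + 1) => μ) 0
  have h2 := (h.symm _).lintegral_comp hf
  rw [← h2]
  have hm : Measurable fun z : α × (Fin m → α) =>
      f ((MeasurableEquiv.piFinSuccAbove (fun _ : Fin (m + 1) => α) 0).symm z) :=
    hf.comp (MeasurableEquiv.measurable _)
  rw [lintegral_prod_symm' _ hm]
  refine lintegral_congr fun x => lintegral_congr fun a => ?_
  simp [Fin.insertNthEquiv_zero, Fin.consEquiv]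

lemma lintegral_pi_prod {α : Type*} [MeasurableSpace α] (μ : Measure α) [SigmaFinite μ] {m : ℕ}
    {f : Fin m → α → ℝ≥0∞} (hf : ∀ i, Measurable (f i)) :
    ∫⁻ x, ∏ i, f i (x i) ∂(Measure.pi fun _ => μ) = ∏ i, ∫⁻ a, f i a ∂μ := by
  induction m with
  | zero => simp
  | succ m ih =>
    rw [lintegral_pi_succ μ (by fun_prop), Fin.prod_univ_succ, ← ih (fun i => hf i.succ)]
    simp_rw [Fin.prod_univ_succ, Fin.cons_zero, Fin.cons_succ]
    rw [← lintegral_const_mul _ (by fun_prop)]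
    congr 1; ext x
    rw [lintegral_mul_const _ (hf 0)]

lemma stdGPi_eq_withDensity (m : ℕ) :
    stdGPi m = volume.withDensity fun x => ∏ i, gaussianPDF 0 1 (x i) := by
  refine Measure.pi_eq fun s hs => ?_
  have h1 : ∀ x : Fin m → ℝ, (Set.univ.pi s).indicator (fun x => ∏ i, gaussianPDF 0 1 (x i)) x
      = ∏ i, (s i).indicator (gaussianPDF 0 1) (x i) := by
    intro x
    by_cases hx : x ∈ Set.univ.pi s
    · rw [Set.indicator_of_mem hx]
      exact Finset.prod_congr rfl fun i _ => (Set.indicator_of_mem (hx i trivial) _).symm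
    · rw [Set.indicator_of_notMem hx]
      obtain ⟨i, hi⟩ : ∃ i, x i ∉ s i := by simpa [Set.mem_pi] using hx
      exact (Finset.prod_eq_zero (Finset.mem_univ i) (Set.indicator_of_notMem hi _)).symm
  rw [withDensity_apply _ (MeasurableSet.univ_pi hs), ← lintegral_indicator
    (MeasurableSet.univ_pi hs)]
  simp_rw [h1]
  rw [volume_pi, lintegral_pi_prod volume
    (fun i => (measurable_gaussianPDF 0 1).indicator (hs i))]
  refine Finset.prod_congr rfl fun i _ => ?_
  rw [lintegral_indicator (hs i), gaussianReal_apply _ one_ne_zero]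

lemma prod_gaussianPDF (m : ℕ) (x : Fin m → ℝ) :
    ∏ i, gaussianPDF 0 1 (x i)
      = ENNReal.ofReal ((√(2 * π))⁻¹ ^ m * exp (-(∑ i, x i ^ 2) / 2)) := by
  simp only [gaussianPDF_def, gaussianPDFReal_def]
  rw [← ENNReal.ofReal_prod_of_nonneg (fun i _ => by positivity), Finset.prod_mul_distrib,
    ← exp_sum]
  simp [← Finset.sum_div]

lemma charFun_map_inner_stdGaussian {E : Type*} [NormedAddCommGroup E] [InnerProductSpace ℝ E]
    [FiniteDimensional ℝ E] [MeasurableSpace E] [BorelSpace E] {m : ℕ} (v : Fin m → E)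
    (t : EuclideanSpace ℝ (Fin m)) :
    charFun ((stdGaussian E).map fun h => WithLp.toLp 2 fun i => ⟪h, v i⟫) t
      = Complex.exp (-(∑ i, ∑ j, t i * t j * ⟪v i, v j⟫ : ℝ) / 2) := by
  have h1 : charFun ((stdGaussian E).map fun h => WithLp.toLp 2 fun i => ⟪h, v i⟫) t
      = charFun (stdGaussian E) (∑ i, t i • v i) := by
    rw [charFun_apply, charFun_apply, integral_map (by fun_prop) (by fun_prop)]
    congr 1; ext h
    congr 3
    simp [PiLp.inner_apply, inner_sum, inner_smul_right]
  rw [h1, charFun_stdGaussian, ← Complex.ofReal_pow, ← real_inner_self_eq_norm_sq]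
  congr 4
  simp only [inner_sum, sum_inner, inner_smul_left, inner_smul_right]
  refine Finset.sum_congr rfl fun i _ => ?_
  rw [Finset.mul_sum]
  refine Finset.sum_congr rfl fun j _ => ?_
  rw [real_inner_comm, conj_trivial, mul_assoc]

lemma map_inner_stdGaussian_congr {E F : Type*} [NormedAddCommGroup E] [InnerProductSpace ℝ E]
    [FiniteDimensional ℝ E] [MeasurableSpace E] [BorelSpace E] [NormedAddCommGroup F]
    [InnerProductSpace ℝ F] [FiniteDimensional ℝ F] [MeasurableSpace F] [BorelSpace F] {m : ℕ}
    (v : Fin m → E) (u : Fin m → F) (h : ∀ i j, ⟪v i, v j⟫ = ⟪u i, u j⟫) :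
    (stdGaussian E).map (fun h i => ⟪h, v i⟫) = (stdGaussian F).map (fun h i => ⟪h, u i⟫) := by
  have key : (stdGaussian E).map (fun h => WithLp.toLp 2 fun i => ⟪h, v i⟫)
      = (stdGaussian F).map (fun h => WithLp.toLp 2 fun i => ⟪h, u i⟫) := by
    apply Measure.ext_of_charFun (E := EuclideanSpace ℝ (Fin m))
    ext t
    rw [charFun_map_inner_stdGaussian, charFun_map_inner_stdGaussian]
    simp_rw [h]
  have := congrArg (Measure.map (WithLp.ofLp (p := 2) (V := Fin m → ℝ))) key
  rw [Measure.map_map (by fun_prop) (by fun_prop), Measure.map_map (by fun_prop) (by fun_prop)]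
    at this
  exact this

/-- The law of `(⟪h, v i⟫)_i` under a standard Gaussian vector is the law of `Bᵀ w` when
`Bᵀ B` is the Gram matrix of `v`. -/
lemma map_inner_stdGaussian {E : Type*} [NormedAddCommGroup E] [InnerProductSpace ℝ E]
    [FiniteDimensional ℝ E] [MeasurableSpace E] [BorelSpace E] {m : ℕ} (v : Fin m → E)
    (B : Matrix (Fin m) (Fin m) ℝ) (hB : Matrix.gram ℝ v = B.transpose * B) :
    (stdGaussian E).map (fun h i => ⟪h, v i⟫) = (stdGPi m).map (fun w => B.transpose.mulVec w) := by
  rw [map_inner_stdGaussian_congr v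
    (fun i => (WithLp.toLp 2 fun j => B j i : EuclideanSpace ℝ (Fin m))), ← map_pi_eq_stdGaussian,
    Measure.map_map (by fun_prop) (by fun_prop)]
  · congr 1
  · intro i j
    have := congrFun (congrFun hB i) j
    rw [Matrix.gram_apply] at this
    rw [this]
    simp [PiLp.inner_apply, Matrix.mul_apply, mul_comm]

/-- The off-diagonal part of the Gram matrix of `v`. -/
def offGram {E : Type*} [NormedAddCommGroup E] [InnerProductSpace ℝ E] {m : ℕ} (v : Fin m → E) :
    Matrix (Fin m) (Fin m) ℝ := fun i j => if i = j then 0 else ⟪v i, v j⟫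

/-- The squared Frobenius norm of a matrix. -/
def frobSq {m : ℕ} (A : Matrix (Fin m) (Fin m) ℝ) : ℝ := ∑ i, ∑ j, A i j ^ 2

/-- The quadratic form of a matrix. -/
def quadForm {m : ℕ} (A : Matrix (Fin m) (Fin m) ℝ) (y : Fin m → ℝ) : ℝ :=
  ∑ i, ∑ j, y i * y j * A i j

lemma frobSq_nonneg {m : ℕ} (A : Matrix (Fin m) (Fin m) ℝ) : 0 ≤ frobSq A :=
  Finset.sum_nonneg fun _ _ => Finset.sum_nonneg fun _ _ => sq_nonneg _

lemma trace_mul_self_eq_sum_eigenvalues {m : ℕ} {M : Matrix (Fin m) (Fin m) ℝ}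
    (hM : M.IsHermitian) : (M * M).trace = ∑ i, hM.eigenvalues i ^ 2 := by
  have h := hM.spectral_theorem
  have h2 : M * M = Unitary.conjStarAlgAut ℝ _ hM.eigenvectorUnitary
      (Matrix.diagonal (RCLike.ofReal ∘ hM.eigenvalues) *
        Matrix.diagonal (RCLike.ofReal ∘ hM.eigenvalues)) := by
    rw [map_mul, ← h]
  rw [h2, Unitary.conjStarAlgAut_apply, Matrix.trace_mul_comm, ← mul_assoc]
  simp [Matrix.trace, pow_two]

lemma exp_neg_two_frobSq_le_det {m : ℕ} {A : Matrix (Fin m) (Fin m) ℝ} (hA : A.IsHermitian)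
    (hd : ∀ i, A i i = 0) (hF : frobSq A ≤ 1 / 4) : exp (-(2 * frobSq A)) ≤ (1 + A).det := by
  have hM : (1 + A).IsHermitian := Matrix.isHermitian_one.add hA
  set e := hM.eigenvalues with he
  have hAt : A.trace = 0 := by simp [Matrix.trace, hd]
  have hAA : (A * A).trace = frobSq A := by
    simp only [Matrix.trace, Matrix.diag, Matrix.mul_apply, frobSq]
    refine Finset.sum_congr rfl fun i _ => Finset.sum_congr rfl fun j _ => ?_
    have := hA.apply i j
    simp only [star_trivial] at this
    rw [this, pow_two]
  have h1 : ∑ i, e i = m := by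
    have := hM.trace_eq_sum_eigenvalues
    rw [Matrix.trace_add, hAt, Matrix.trace_one] at this
    simpa using this.symm
  have h2 : ∑ i, e i ^ 2 = m + frobSq A := by
    rw [he, ← trace_mul_self_eq_sum_eigenvalues hM]
    have : (1 + A) * (1 + A) = 1 + (A + A) + A * A := by noncomm_ring
    rw [this, Matrix.trace_add, Matrix.trace_add, Matrix.trace_add, hAt, hAA, Matrix.trace_one]
    simp
  have h3 : ∑ i, (e i - 1) ^ 2 = frobSq A := by
    have : ∀ i, (e i - 1) ^ 2 = e i ^ 2 - 2 * e i + 1 := fun i => by ring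
    simp_rw [this, Finset.sum_add_distrib, Finset.sum_sub_distrib, ← Finset.mul_sum, h1, h2]
    simp; ring
  have h4 : ∀ i, |e i - 1| ≤ 1 / 2 := by
    intro i
    have : (e i - 1) ^ 2 ≤ 1 / 4 := by
      refine le_trans ?_ hF
      rw [← h3]
      exact Finset.single_le_sum (f := fun i => (e i - 1) ^ 2) (fun i _ => sq_nonneg _)
        (Finset.mem_univ i)
    exact abs_le_of_sq_le_sq (by linarith) (by norm_num)
  have h5 : ∀ x : ℝ, |x - 1| ≤ 1 / 2 → exp ((x - 1) - 2 * (x - 1) ^ 2) ≤ x := by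
    intro x hx
    obtain ⟨hx1, hx2⟩ := abs_le.mp hx
    have hx0 : 0 < x := by linarith
    have : 0 < 1 - ((x - 1) - 2 * (x - 1) ^ 2) := by nlinarith
    have h := Real.one_sub_le_exp_neg ((x - 1) - 2 * (x - 1) ^ 2)
    rw [exp_neg] at h
    rw [le_inv_comm₀ this (exp_pos _)] at h
    refine h.trans ?_
    rw [inv_le_comm₀ this hx0, inv_le_iff_one_le_mul₀ hx0]
    nlinarith [mul_nonneg (by linarith : 0 ≤ 2 * x - 1) (sq_nonneg (x - 1))]
  rw [hM.det_eq_prod_eigenvalues]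
  calc exp (-(2 * frobSq A)) = ∏ i, exp ((e i - 1) - 2 * (e i - 1) ^ 2) := by
        rw [← exp_sum, Finset.sum_sub_distrib, ← Finset.mul_sum, h3, Finset.sum_sub_distrib, h1]; simp
    _ ≤ ∏ i, e i := Finset.prod_le_prod (fun i _ => (exp_pos _).le) fun i _ => h5 _ (h4 i)
    _ = _ := by simp [he]

lemma one_add_offGram {E : Type*} [NormedAddCommGroup E] [InnerProductSpace ℝ E] {m : ℕ}
    {v : Fin m → E} (hv : ∀ i, ‖v i‖ = 1) : Matrix.gram ℝ v = 1 + offGram v := by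
  ext i j
  rw [Matrix.gram_apply, Matrix.add_apply, offGram, Matrix.one_apply]
  split_ifs with h
  · subst h; simp [hv]
  · simp

lemma offGram_isHermitian {E : Type*} [NormedAddCommGroup E] [InnerProductSpace ℝ E] {m : ℕ}
    (v : Fin m → E) : (offGram v).IsHermitian := by
  ext i j
  simp [offGram, eq_comm, real_inner_comm]

open scoped MatrixOrder in
lemma exists_gram_eq_transpose_mul {E : Type*} [NormedAddCommGroup E] [InnerProductSpace ℝ E]
    {m : ℕ} (v : Fin m → E) :
    ∃ B : Matrix (Fin m) (Fin m) ℝ, Matrix.gram ℝ v = B.transpose * B := by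
  obtain ⟨B, hB⟩ := CStarAlgebra.nonneg_iff_eq_star_mul_self.mp
    (Matrix.nonneg_iff_posSemidef.mpr (Matrix.posSemidef_gram ℝ v))
  exact ⟨B, by simpa [Matrix.star_eq_conjTranspose] using hB⟩

lemma quadForm_eq {m : ℕ} (A : Matrix (Fin m) (Fin m) ℝ) (y : Fin m → ℝ) :
    quadForm A y = y ⬝ᵥ A.mulVec y := by
  simp only [quadForm, dotProduct, Matrix.mulVec, Finset.mul_sum]
  exact Finset.sum_congr rfl fun i _ => Finset.sum_congr rfl fun j _ => by ring

/-- `M⁻¹ ≥ 2 - M` in the form needed for a change of variables. -/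
lemma sum_sq_sub_quadForm_le {m : ℕ} {A B : Matrix (Fin m) (Fin m) ℝ}
    (hB : 1 + A = B.transpose * B) (w : Fin m → ℝ) :
    ∑ i, (B.transpose.mulVec w) i ^ 2 - quadForm A (B.transpose.mulVec w) ≤ ∑ i, w i ^ 2 := by
  have hA : A = B.transpose * B - 1 := by rw [← hB]; simp
  set y := B.transpose.mulVec w with hy
  have e1 : quadForm A y = B.mulVec y ⬝ᵥ B.mulVec y - y ⬝ᵥ y := by
    rw [quadForm_eq, hA, Matrix.sub_mulVec, dotProduct_sub, Matrix.one_mulVec,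
      ← Matrix.mulVec_mulVec, Matrix.dotProduct_mulVec, Matrix.vecMul_transpose]
  have e2 : y ⬝ᵥ y = w ⬝ᵥ B.mulVec y := by
    conv_lhs => rw [hy, Matrix.mulVec_transpose, ← Matrix.dotProduct_mulVec]
    rw [hy, Matrix.mulVec_transpose]
  have e3 : 0 ≤ (w - B.mulVec y) ⬝ᵥ (w - B.mulVec y) := by
    simp only [dotProduct]; exact Finset.sum_nonneg fun i _ => mul_self_nonneg _
  have e4 : ∀ z : Fin m → ℝ, ∑ i, z i ^ 2 = z ⬝ᵥ z := fun z => by simp [dotProduct, pow_two]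
  rw [e4, e4, e1]
  rw [sub_dotProduct, dotProduct_sub, dotProduct_sub, dotProduct_comm (B.mulVec y) w] at e3
  linarith

/-- Comparison of the joint law of inner products of a Gaussian vector with almost orthonormal
vectors with a tilted product of standard Gaussians. -/
lemma lintegral_inner_stdGaussian_le {E : Type*} [NormedAddCommGroup E] [InnerProductSpace ℝ E]
    [FiniteDimensional ℝ E] [MeasurableSpace E] [BorelSpace E] {m : ℕ} {v : Fin m → E}
    (hv : ∀ i, ‖v i‖ = 1) (hF : frobSq (offGram v) ≤ 1 / 4) {f : (Fin m → ℝ) → ℝ≥0∞}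
    (hf : Measurable f) :
    ∫⁻ h, f (fun i => ⟪h, v i⟫) ∂(stdGaussian E)
      ≤ 2 * ∫⁻ y, ENNReal.ofReal (exp (quadForm (offGram v) y / 2)) * f y ∂(stdGPi m) := by
  obtain ⟨B, hB⟩ := exists_gram_eq_transpose_mul v
  have hB' := hB
  rw [one_add_offGram hv] at hB'
  set A := offGram v with hA
  have hdet : exp (-(1 / 2)) ≤ B.transpose.det ^ 2 := by
    have := exp_neg_two_frobSq_le_det (offGram_isHermitian v) (fun i => by simp [offGram]) hF
    rw [← hA, hB', Matrix.det_mul, Matrix.det_transpose, ← pow_two, ← Matrix.det_transpose] at this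
    exact (exp_le_exp.mpr (by linarith)).trans this
  have hdet0 : B.transpose.det ≠ 0 := fun h => by
    rw [h] at hdet; have := exp_pos (-(1 / 2 : ℝ)); simp at hdet; linarith
  have hdet1 : |B.transpose.det⁻¹| ≤ 2 := by
    rw [abs_inv, inv_le_comm₀ (abs_pos.mpr hdet0) (by norm_num)]
    have h1 := Real.add_one_le_exp (-(1 / 2 : ℝ))
    refine le_of_sq_le_sq ?_ (abs_nonneg _)
    rw [sq_abs]; linarith
  have hq : Measurable (quadForm A) := by unfold quadForm; fun_prop
  have h1 : ∫⁻ h, f (fun i => ⟪h, v i⟫) ∂(stdGaussian E)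
      = ∫⁻ w, f (B.transpose.mulVec w) ∂(stdGPi m) := by
    have e := map_inner_stdGaussian v B hB
    rw [← lintegral_map (f := f) (g := fun h i => ⟪h, v i⟫) hf (by fun_prop), e,
      lintegral_map hf (by fun_prop)]
  set F : (Fin m → ℝ) → ℝ≥0∞ := fun y =>
    ENNReal.ofReal ((√(2 * π))⁻¹ ^ m * exp (-(∑ i, y i ^ 2 - quadForm A y) / 2)) * f y with hFdef
  have hFm : Measurable F := by fun_prop
  rw [h1, stdGPi_eq_withDensity, lintegral_withDensity_eq_lintegral_mul _ (by fun_prop)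
    (by fun_prop), lintegral_withDensity_eq_lintegral_mul _ (by fun_prop) (by fun_prop)]
  calc _ ≤ ∫⁻ w, F (Matrix.toLin' B.transpose w) := by
        refine lintegral_mono fun w => ?_
        simp only [Pi.mul_apply, prod_gaussianPDF, hFdef, Matrix.toLin'_apply]
        gcongr
        exact sum_sq_sub_quadForm_le hB' w
    _ = ENNReal.ofReal |B.transpose.det⁻¹| * ∫⁻ y, F y := by
        rw [← lintegral_map hFm (LinearMap.continuous_of_finiteDimensional _).measurable,
          Real.map_matrix_volume_pi_eq_smul_volume_pi hdet0, lintegral_smul_measure, smul_eq_mul]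
    _ ≤ 2 * ∫⁻ y, F y := by
        gcongr
        exact (ENNReal.ofReal_le_ofReal hdet1).trans (by simp)
    _ = _ := by
        congr 2; ext y
        simp only [Pi.mul_apply, prod_gaussianPDF, hFdef]
        rw [← mul_assoc, ← ENNReal.ofReal_mul (by positivity), mul_assoc, ← exp_add]
        congr 4; ring

lemma lintegral_polar (k : ℕ) {f : Amb k → ℝ≥0∞} (hf : Measurable f) {g : ℝ → ℝ≥0∞}
    (hg : Measurable g) :
    ∫⁻ h : Amb k, g ‖h‖ * f (‖h‖⁻¹ • h)
      = (∫⁻ x, f x ∂(sphereSurface k)) *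
        ∫⁻ r : Set.Ioi (0 : ℝ), g r ∂(Measure.volumeIoiPow (Module.finrank ℝ (Amb k) - 1)) := by
  have h0 : MeasurableSet ({0}ᶜ : Set (Amb k)) := (measurableSet_singleton _).compl
  have e1 : ∫⁻ h : Amb k, g ‖h‖ * f (‖h‖⁻¹ • h)
      = ∫⁻ h : ({0}ᶜ : Set (Amb k)), g ‖(h : Amb k)‖ * f (‖(h : Amb k)‖⁻¹ • (h : Amb k))
        ∂(Measure.comap Subtype.val volume) := by
    rw [lintegral_subtype_comap h0 (fun h : Amb k => g ‖h‖ * f (‖h‖⁻¹ • h)),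
      restrict_compl_singleton]
  have hmp := (volume : Measure (Amb k)).measurePreserving_homeomorphUnitSphereProd
  rw [e1, sphereSurface, lintegral_map hf measurable_subtype_coe,
    ← lintegral_prod_mul (by fun_prop) (by fun_prop), ← hmp.lintegral_comp (by fun_prop)]
  refine lintegral_congr fun h => ?_
  simp [mul_comm]

lemma stdGaussian_eq_withDensity (k : ℕ) :
    stdGaussian (Amb k) = (volume : Measure (Amb k)).withDensity
      fun h => ENNReal.ofReal ((√(2 * π))⁻¹ ^ (k + 1) * exp (-‖h‖ ^ 2 / 2)) := by
  have hmp := EuclideanSpace.volume_preserving_symm_measurableEquiv_toLp (Fin (k + 1))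
  have hmp' := hmp.symm
  ext s hs
  rw [← map_pi_eq_stdGaussian, Measure.map_apply (by fun_prop) hs, withDensity_apply _ hs]
  have := stdGPi_eq_withDensity (k + 1)
  rw [stdGPi] at this
  rw [this, withDensity_apply _ (hs.preimage (by fun_prop)),
    ← hmp'.setLIntegral_comp_preimage hs (by fun_prop)]
  refine lintegral_congr fun x => ?_
  rw [prod_gaussianPDF, EuclideanSpace.real_norm_sq_eq]
  simp

lemma sphereSurface_univ_ne_zero (k : ℕ) : sphereSurface k Set.univ ≠ 0 := by
  rw [sphereSurface, Measure.map_apply measurable_subtype_coe MeasurableSet.univ, Set.preimage_univ,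
    Measure.measure_univ_ne_zero]
  exact Measure.toSphere_ne_zero _

lemma sphereSurface_univ_ne_top (k : ℕ) : sphereSurface k Set.univ ≠ ∞ := by
  rw [sphereSurface, Measure.map_apply measurable_subtype_coe MeasurableSet.univ]
  exact measure_ne_top _ _

instance isProbabilityMeasure_sphereUniform (k : ℕ) : IsProbabilityMeasure (sphereUniform k) := by
  constructor
  rw [sphereUniform, Measure.smul_apply, smul_eq_mul]
  exact ENNReal.inv_mul_cancel (sphereSurface_univ_ne_zero k) (sphereSurface_univ_ne_top k)

lemma ae_norm_sphereUniform (k : ℕ) : ∀ᵐ x ∂(sphereUniform k), ‖x‖ = 1 := by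
  refine Measure.ae_smul_measure ?_ _
  rw [sphereSurface, ae_map_iff measurable_subtype_coe.aemeasurable
    (measurableSet_eq_fun (by fun_prop) (by fun_prop))]
  exact Filter.Eventually.of_forall fun x => by simp

/-- The direction of a standard Gaussian vector is uniform on the sphere and independent of
its norm. -/
lemma lintegral_sphereUniform_mul (k : ℕ) {f : Amb k → ℝ≥0∞} (hf : Measurable f) {W : Set ℝ}
    (hW : MeasurableSet W) :
    (∫⁻ x, f x ∂(sphereUniform k)) * stdGaussian (Amb k) {h | ‖h‖ ∈ W}
      = ∫⁻ h in {h | ‖h‖ ∈ W}, f (‖h‖⁻¹ • h) ∂(stdGaussian (Amb k)) := by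
  have hWm : MeasurableSet {h : Amb k | ‖h‖ ∈ W} := hW.preimage measurable_norm
  set g : ℝ → ℝ≥0∞ :=
    W.indicator fun r => ENNReal.ofReal ((√(2 * π))⁻¹ ^ (k + 1) * exp (-r ^ 2 / 2)) with hg
  have hgm : Measurable g := Measurable.indicator (by fun_prop) hW
  have key : ∀ f : Amb k → ℝ≥0∞, Measurable f →
      ∫⁻ h in {h | ‖h‖ ∈ W}, f (‖h‖⁻¹ • h) ∂(stdGaussian (Amb k))
        = ∫⁻ h : Amb k, g ‖h‖ * f (‖h‖⁻¹ • h) := by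
    intro f hf
    rw [stdGaussian_eq_withDensity, restrict_withDensity hWm,
      lintegral_withDensity_eq_lintegral_mul _ (by fun_prop) (by fun_prop),
      ← lintegral_indicator hWm]
    refine lintegral_congr fun h => ?_
    by_cases hh : ‖h‖ ∈ W
    · rw [Set.indicator_of_mem (by exact hh), hg, Set.indicator_of_mem hh]; rfl
    · rw [Set.indicator_of_notMem (by exact hh), hg, Set.indicator_of_notMem hh, zero_mul]
  have e1 : stdGaussian (Amb k) {h | ‖h‖ ∈ W}
      = ∫⁻ h in {h | ‖h‖ ∈ W}, (1 : ℝ≥0∞) ∂(stdGaussian (Amb k)) := by simp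
  rw [e1, key _ measurable_const, key _ hf, lintegral_polar k hf hgm,
    lintegral_polar k measurable_const hgm, sphereUniform, lintegral_smul_measure, smul_eq_mul,
    lintegral_one]
  rw [mul_mul_mul_comm, mul_comm _ (sphereSurface k Set.univ), ← mul_assoc]
  rw [ENNReal.mul_inv_cancel (sphereSurface_univ_ne_zero k) (sphereSurface_univ_ne_top k), one_mul]

/-- The sign of a Boolean. -/
def boolSign (b : Bool) : ℝ := if b then 1 else -1

lemma sum_boolSign_mul {m : ℕ} (i : Fin m) (g : (Fin m → Bool) → ℝ)
    (hg : ∀ e b, g (Function.update e i b) = g e) :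
    ∑ e : Fin m → Bool, boolSign (e i) * g e = 0 := by
  have hinv : Function.Involutive fun e : Fin m → Bool => Function.update e i (!e i) := by
    intro e; simp
  set σ : Equiv.Perm (Fin m → Bool) := hinv.toPerm with hσ
  have h := Equiv.sum_comp σ fun e : Fin m → Bool => boolSign (e i) * g e
  have h2 : ∀ e : Fin m → Bool, boolSign (σ e i) * g (σ e)
      = -(boolSign (e i) * g e) := by
    intro e
    simp only [hσ, Function.Involutive.coe_toPerm, hg, Function.update_self]
    cases e i <;> simp [boolSign]
  simp_rw [h2, Finset.sum_neg_distrib] at h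
  linarith

lemma sum_boolSign_decoupling {m : ℕ} {i j : Fin m} (hij : i ≠ j) :
    ∑ e : Fin m → Bool, (1 + boolSign (e i)) * (1 - boolSign (e j)) = 2 ^ m := by
  have h1 := sum_boolSign_mul i (fun _ => 1) (fun _ _ => rfl)
  have h2 := sum_boolSign_mul j (fun _ => 1) (fun _ _ => rfl)
  have h3 := sum_boolSign_mul i (fun e => boolSign (e j)) (fun e b => by
    simp [Function.update_of_ne hij.symm])
  have : ∀ e : Fin m → Bool, (1 + boolSign (e i)) * (1 - boolSign (e j))
      = 1 + boolSign (e i) * 1 - boolSign (e j) * 1 - boolSign (e i) * boolSign (e j) := by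
    intro e; ring
  simp_rw [this, Finset.sum_sub_distrib, Finset.sum_add_distrib, h1, h2, h3]
  simp

/-- The part of a quadratic form coupling the coordinates with `e i` to those without. -/
def decoupledForm {m : ℕ} (A : Matrix (Fin m) (Fin m) ℝ) (e : Fin m → Bool) (x y : Fin m → ℝ) : ℝ :=
  ∑ j, ((1 - boolSign (e j)) * ∑ i, (1 + boolSign (e i)) * x i * A i j) * y j

lemma quadForm_eq_average {m : ℕ} (A : Matrix (Fin m) (Fin m) ℝ) (hA : ∀ i, A i i = 0)
    (z : Fin m → ℝ) :
    quadForm A z = ∑ e : Fin m → Bool, (1 / 2 ^ m : ℝ) * decoupledForm A e z z := by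
  rw [← Finset.mul_sum]
  have : ∑ e : Fin m → Bool, decoupledForm A e z z
      = ∑ i, ∑ j, (z i * z j * A i j)
        * ∑ e : Fin m → Bool, (1 + boolSign (e i)) * (1 - boolSign (e j)) := by
    simp_rw [decoupledForm, Finset.mul_sum, Finset.sum_mul]
    rw [Finset.sum_comm]
    simp_rw [fun j => Finset.sum_comm (s := (Finset.univ : Finset (Fin m → Bool)))
      (t := (Finset.univ : Finset (Fin m)))
      (f := fun e i => (1 - boolSign (e j)) * ((1 + boolSign (e i)) * z i * A i j) * z j)]
    rw [Finset.sum_comm]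
    refine Finset.sum_congr rfl fun i _ => Finset.sum_congr rfl fun j _ =>
      Finset.sum_congr rfl fun e _ => by ring
  rw [this, quadForm, Finset.mul_sum]
  refine Finset.sum_congr rfl fun i _ => ?_
  rw [Finset.mul_sum]
  refine Finset.sum_congr rfl fun j _ => ?_
  by_cases hij : i = j
  · subst hij; simp [hA]
  · rw [sum_boolSign_decoupling hij]; field_simp

lemma exp_quadForm_le_average {m : ℕ} (A : Matrix (Fin m) (Fin m) ℝ) (hA : ∀ i, A i i = 0)
    (z : Fin m → ℝ) :
    exp (quadForm A z) ≤ ∑ e : Fin m → Bool, (1 / 2 ^ m : ℝ) * exp (decoupledForm A e z z) := by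
  rw [quadForm_eq_average A hA]
  have := convexOn_exp.map_sum_le (t := Finset.univ) (w := fun _ : Fin m → Bool => (1 / 2 ^ m : ℝ))
    (p := fun e => decoupledForm A e z z) (fun _ _ => by positivity) (by simp)
    (fun _ _ => Set.mem_univ _)
  simpa only [smul_eq_mul] using this

/-- Replacing some coordinates by those of an independent copy preserves a product measure. -/
lemma measurePreserving_ite_pi {α : Type*} [MeasurableSpace α] (ρ : Measure α)
    [IsProbabilityMeasure ρ] {m : ℕ} (e : Fin m → Bool) :
    MeasurePreserving (fun w : (Fin m → α) × (Fin m → α) => fun i => if e i then w.1 i else w.2 i)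
      ((Measure.pi fun _ => ρ).prod (Measure.pi fun _ => ρ)) (Measure.pi fun _ => ρ) := by
  have hm : Measurable (fun w : (Fin m → α) × (Fin m → α) =>
      fun i => if e i then w.1 i else w.2 i) := by
    refine measurable_pi_lambda _ fun i => ?_
    by_cases h : e i <;> simp [h] <;> fun_prop
  refine ⟨hm, (Measure.pi_eq fun s hs => ?_).symm⟩
  rw [Measure.map_apply hm (MeasurableSet.univ_pi hs)]
  have : (fun w : (Fin m → α) × (Fin m → α) => fun i => if e i then w.1 i else w.2 i) ⁻¹'
      (Set.univ.pi s) = (Set.univ.pi fun i => if e i then s i else Set.univ) ×ˢ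
        (Set.univ.pi fun i => if e i then Set.univ else s i) := by
    ext w
    simp only [Set.mem_preimage, Set.mem_pi, Set.mem_univ, forall_const, Set.mem_prod,
      ← forall_and]
    refine forall_congr' fun i => ?_
    by_cases h : e i <;> simp [h]
  rw [this, Measure.prod_prod, Measure.pi_pi, Measure.pi_pi, ← Finset.prod_mul_distrib]
  refine Finset.prod_congr rfl fun i _ => ?_
  by_cases h : e i <;> simp [h]

lemma decoupledForm_ite {m : ℕ} (A : Matrix (Fin m) (Fin m) ℝ) (e : Fin m → Bool)
    (x y : Fin m → ℝ) :
    decoupledForm A e (fun i => if e i then x i else y i) (fun i => if e i then x i else y i)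
      = decoupledForm A e x y := by
  unfold decoupledForm
  refine Finset.sum_congr rfl fun j _ => ?_
  have : ∑ i, (1 + boolSign (e i)) * (if e i then x i else y i) * A i j
      = ∑ i, (1 + boolSign (e i)) * x i * A i j := by
    refine Finset.sum_congr rfl fun i _ => ?_
    by_cases h : e i <;> simp [h, boolSign]
  rw [this]
  by_cases h : e j <;> simp [h, boolSign]

lemma sum_sq_decoupled_le {m : ℕ} (A : Matrix (Fin m) (Fin m) ℝ) (e : Fin m → Bool)
    (x : Fin m → ℝ) :
    ∑ j, ((1 - boolSign (e j)) * ∑ i, (1 + boolSign (e i)) * x i * A i j) ^ 2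
      ≤ 16 * frobSq A * ∑ i, x i ^ 2 := by
  have h1 : ∀ b, (1 - boolSign b) ^ 2 ≤ 4 := by intro b; cases b <;> norm_num [boolSign]
  have h2 : ∀ b, (1 + boolSign b) ^ 2 ≤ 4 := by intro b; cases b <;> norm_num [boolSign]
  have key : ∀ j, ((1 - boolSign (e j)) * ∑ i, (1 + boolSign (e i)) * x i * A i j) ^ 2
      ≤ 16 * (∑ i, x i ^ 2) * ∑ i, A i j ^ 2 := by
    intro j
    rw [mul_pow]
    have h3 := Finset.sum_mul_sq_le_sq_mul_sq Finset.univ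
      (fun i => (1 + boolSign (e i)) * x i) (fun i => A i j)
    have h4 : ∑ i, ((1 + boolSign (e i)) * x i) ^ 2 ≤ 4 * ∑ i, x i ^ 2 := by
      rw [Finset.mul_sum]
      refine Finset.sum_le_sum fun i _ => ?_
      rw [mul_pow]
      exact mul_le_mul_of_nonneg_right (h2 _) (sq_nonneg _)
    have h5 : 0 ≤ ∑ i, A i j ^ 2 := Finset.sum_nonneg fun _ _ => sq_nonneg _
    calc _ ≤ 4 * (∑ i, (1 + boolSign (e i)) * x i * A i j) ^ 2 :=
          mul_le_mul_of_nonneg_right (h1 _) (sq_nonneg _)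
      _ ≤ 4 * ((4 * ∑ i, x i ^ 2) * ∑ i, A i j ^ 2) := by
          have := mul_le_mul_of_nonneg_right h4 h5
          linarith
      _ = _ := by ring
  refine (Finset.sum_le_sum fun j _ => key j).trans (le_of_eq ?_)
  rw [← Finset.mul_sum, Finset.sum_comm, frobSq]
  ring

/-- A probability measure on `ℝ` whose shift by `μ` is subgaussian with constant `K`. -/
structure IsSubG (ρ : Measure ℝ) (μ K s₀ : ℝ) : Prop where
  nonneg : 0 ≤ K
  lin : ∀ t : ℝ, ∫⁻ y, ENNReal.ofReal (exp (t * (y - μ))) ∂ρ ≤ ENNReal.ofReal (exp (K * t ^ 2))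
  sq : ∀ s : ℝ, 0 ≤ s → s ≤ s₀ →
    ∫⁻ y, ENNReal.ofReal (exp (s * (y - μ) ^ 2)) ∂ρ ≤ ENNReal.ofReal (exp (K * s))

lemma lintegral_exp_sum_mul_le {ρ : Measure ℝ} [IsProbabilityMeasure ρ] {μ K s₀ : ℝ}
    (h : IsSubG ρ μ K s₀) {m : ℕ} (w : Fin m → ℝ) :
    ∫⁻ y, ENNReal.ofReal (exp (∑ i, w i * (y i - μ))) ∂(Measure.pi fun _ => ρ)
      ≤ ENNReal.ofReal (exp (K * ∑ i, w i ^ 2)) := by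
  simp_rw [exp_sum]
  simp_rw [ENNReal.ofReal_prod_of_nonneg fun i (_ : i ∈ Finset.univ) => (exp_pos _).le]
  rw [lintegral_pi_prod ρ (f := fun i y => ENNReal.ofReal (exp (w i * (y - μ))))
    (fun i => by fun_prop)]
  rw [Finset.mul_sum, exp_sum, ENNReal.ofReal_prod_of_nonneg fun i _ => (exp_pos _).le]
  exact Finset.prod_le_prod' fun i _ => h.lin _

lemma lintegral_exp_sum_sq_le {ρ : Measure ℝ} [IsProbabilityMeasure ρ] {μ K s₀ : ℝ}
    (h : IsSubG ρ μ K s₀) {m : ℕ} {s : ℝ} (hs : 0 ≤ s) (hs₀ : s ≤ s₀) :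
    ∫⁻ y, ENNReal.ofReal (exp (s * ∑ i : Fin m, (y i - μ) ^ 2)) ∂(Measure.pi fun _ => ρ)
      ≤ ENNReal.ofReal (exp (K * s * m)) := by
  simp_rw [Finset.mul_sum, exp_sum]
  simp_rw [ENNReal.ofReal_prod_of_nonneg fun i (_ : i ∈ Finset.univ) => (exp_pos _).le]
  rw [lintegral_pi_prod ρ (f := fun i y => ENNReal.ofReal (exp (s * (y - μ) ^ 2)))
    (fun i => by fun_prop)]
  refine (Finset.prod_le_prod' fun i _ => h.sq s hs hs₀).trans (le_of_eq ?_)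
  rw [Finset.prod_const, ← ENNReal.ofReal_pow (exp_pos _).le, ← exp_nat_mul]
  simp [mul_comm]

lemma lintegral_exp_quadForm_le {ρ : Measure ℝ} [IsProbabilityMeasure ρ] {μ K s₀ : ℝ}
    (h : IsSubG ρ μ K s₀) {m : ℕ} (A : Matrix (Fin m) (Fin m) ℝ) (hA : ∀ i, A i i = 0)
    (hF : 16 * K * frobSq A ≤ s₀) :
    ∫⁻ y, ENNReal.ofReal (exp (quadForm A fun i => y i - μ)) ∂(Measure.pi fun _ => ρ)
      ≤ ENNReal.ofReal (exp (16 * K ^ 2 * frobSq A * m)) := by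
  have hdm : ∀ e : Fin m → Bool, Measurable fun w : (Fin m → ℝ) × (Fin m → ℝ) =>
      ENNReal.ofReal (exp (decoupledForm A e (fun i => w.1 i - μ) fun i => w.2 i - μ)) := by
    intro e; unfold decoupledForm; fun_prop
  have hdm2 : ∀ e : Fin m → Bool, Measurable fun y : Fin m → ℝ =>
      ENNReal.ofReal (exp (decoupledForm A e (fun i => y i - μ) fun i => y i - μ)) := by
    intro e; unfold decoupledForm; fun_prop
  have hK := h.nonneg
  have key : ∀ e : Fin m → Bool,
      ∫⁻ y, ENNReal.ofReal (exp (decoupledForm A e (fun i => y i - μ) fun i => y i - μ))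
        ∂(Measure.pi fun _ => ρ) ≤ ENNReal.ofReal (exp (16 * K ^ 2 * frobSq A * m)) := by
    intro e
    rw [← (measurePreserving_ite_pi ρ e).lintegral_comp (hdm2 e)]
    have e1 : ∀ w : (Fin m → ℝ) × (Fin m → ℝ),
        decoupledForm A e (fun i => (if e i then w.1 i else w.2 i) - μ)
          (fun i => (if e i then w.1 i else w.2 i) - μ)
        = decoupledForm A e (fun i => w.1 i - μ) fun i => w.2 i - μ := by
      intro w
      have e2 : (fun i => (if e i then w.1 i else w.2 i) - μ)
          = fun i => if e i then w.1 i - μ else w.2 i - μ := by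
        ext i; split_ifs <;> rfl
      rw [e2, decoupledForm_ite A e (fun i => w.1 i - μ) fun i => w.2 i - μ]
    simp_rw [e1]
    rw [lintegral_prod _ (hdm e).aemeasurable]
    calc _ ≤ ∫⁻ x, ENNReal.ofReal (exp (16 * K * frobSq A * ∑ i : Fin m, (x i - μ) ^ 2))
          ∂(Measure.pi fun _ => ρ) := by
          refine lintegral_mono fun x => ?_
          refine (lintegral_exp_sum_mul_le h fun j => (1 - boolSign (e j)) *
            ∑ i, (1 + boolSign (e i)) * (x i - μ) * A i j).trans (ENNReal.ofReal_le_ofReal ?_)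
          rw [exp_le_exp]
          have := mul_le_mul_of_nonneg_left (sum_sq_decoupled_le A e fun i => x i - μ) hK
          linarith
      _ ≤ _ := by
          refine (lintegral_exp_sum_sq_le h
            (by have := frobSq_nonneg A; positivity) hF).trans (le_of_eq ?_)
          congr 2; ring
  calc _ ≤ ∫⁻ y, ∑ e : Fin m → Bool, ENNReal.ofReal (1 / 2 ^ m : ℝ) *
        ENNReal.ofReal (exp (decoupledForm A e (fun i => y i - μ) fun i => y i - μ))
        ∂(Measure.pi fun _ => ρ) := by
        refine lintegral_mono fun y => ?_
        refine (ENNReal.ofReal_le_ofReal (exp_quadForm_le_average A hA _)).trans (le_of_eq ?_)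
        rw [ENNReal.ofReal_sum_of_nonneg fun _ _ => by positivity]
        exact Finset.sum_congr rfl fun e _ => ENNReal.ofReal_mul (by positivity)
    _ = ∑ e : Fin m → Bool, ENNReal.ofReal (1 / 2 ^ m : ℝ) *
        ∫⁻ y, ENNReal.ofReal (exp (decoupledForm A e (fun i => y i - μ) fun i => y i - μ))
        ∂(Measure.pi fun _ => ρ) := by
        rw [lintegral_finsetSum _ fun e _ => (hdm2 e).const_mul _]
        exact Finset.sum_congr rfl fun e _ => lintegral_const_mul _ (hdm2 e)
    _ ≤ ∑ _e : Fin m → Bool, ENNReal.ofReal (1 / 2 ^ m : ℝ) *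
        ENNReal.ofReal (exp (16 * K ^ 2 * frobSq A * m)) :=
        Finset.sum_le_sum fun e _ => mul_le_mul_right (key e) _
    _ = _ := by
        rw [Finset.sum_const, ← ENNReal.ofReal_mul (by positivity), nsmul_eq_mul,
          ← ENNReal.ofReal_natCast, ← ENNReal.ofReal_mul (by positivity)]
        congr 1
        simp

lemma exp_le_add_exp_sq (x : ℝ) : exp x ≤ x + exp (x ^ 2) := by
  have h1 := add_one_le_exp (x ^ 2)
  rcases le_total |x| 1 with h | h
  · have := (abs_le.mp (abs_exp_sub_one_sub_id_le h)).2
    linarith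
  · rcases le_abs.mp h with hx | hx
    · have : exp x ≤ exp (x ^ 2) := exp_le_exp.mpr (by nlinarith)
      linarith
    · have : exp x ≤ 1 := exp_le_one_iff.mpr (by linarith)
      nlinarith

lemma isSubG_of_lintegral_exp_sq_le {ν : Measure ℝ} [IsProbabilityMeasure ν] {B : ℝ} (hB : 1 ≤ B)
    (h : ∫⁻ y, ENNReal.ofReal (exp (y ^ 2 / 4)) ∂ν ≤ ENNReal.ofReal B) :
    |∫ y, y ∂ν| ≤ B ∧
      IsSubG ν (∫ y, y ∂ν) (2 + 8 * (B * exp (B ^ 2 / 4) - 1)) (1 / 8) := by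
  have hint : Integrable (fun y : ℝ => exp (y ^ 2 / 4)) ν := by
    refine ⟨by fun_prop, ?_⟩
    rw [hasFiniteIntegral_iff_ofReal (Filter.Eventually.of_forall fun _ => (exp_pos _).le)]
    exact h.trans_lt ENNReal.ofReal_lt_top
  have hintB : ∫ y, exp (y ^ 2 / 4) ∂ν ≤ B := by
    rw [integral_eq_lintegral_of_nonneg_ae (Filter.Eventually.of_forall fun _ => (exp_pos _).le)
      (by fun_prop)]
    exact ENNReal.toReal_le_of_le_ofReal (by linarith) h
  have habs : ∀ y : ℝ, |y| ≤ exp (y ^ 2 / 4) := by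
    intro y
    have h1 := add_one_le_exp (y ^ 2 / 4)
    have h2 := sq_nonneg (|y| / 2 - 1)
    have h3 := sq_abs y
    nlinarith
  have hid : Integrable (fun y : ℝ => y) ν :=
    hint.mono' (by fun_prop) (Filter.Eventually.of_forall habs)
  have hmean : |∫ y, y ∂ν| ≤ B :=
    (norm_integral_le_of_norm_le (f := fun y : ℝ => y) hint (Filter.Eventually.of_forall habs)).trans hintB
  refine ⟨hmean, ?_⟩
  set μ := ∫ y, y ∂ν with hμ
  set B' := B * exp (B ^ 2 / 4) with hB'
  have hB'1 : 1 ≤ B' := by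
    have : 1 ≤ exp (B ^ 2 / 4) := one_le_exp (by positivity)
    nlinarith
  have hμ2 : μ ^ 2 ≤ B ^ 2 := sq_le_sq' (abs_le.mp hmean).1 (abs_le.mp hmean).2
  have hz : ∀ y : ℝ, exp ((y - μ) ^ 2 / 8) ≤ exp (B ^ 2 / 4) * exp (y ^ 2 / 4) := by
    intro y
    rw [← exp_add, exp_le_exp]
    nlinarith [sq_nonneg (y + μ)]
  have hzint : Integrable (fun y : ℝ => exp ((y - μ) ^ 2 / 8)) ν :=
    (hint.const_mul _).mono' (by fun_prop) (Filter.Eventually.of_forall fun y => by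
      rw [norm_of_nonneg (exp_pos _).le]; exact hz y)
  have hzB : ∫ y, exp ((y - μ) ^ 2 / 8) ∂ν ≤ B' := by
    calc _ ≤ ∫ y, exp (B ^ 2 / 4) * exp (y ^ 2 / 4) ∂ν :=
          integral_mono hzint (hint.const_mul _) hz
      _ ≤ B' := by
          rw [integral_const_mul, hB', mul_comm]
          exact mul_le_mul_of_nonneg_right hintB (exp_pos _).le
  have hsqpt : ∀ s : ℝ, 0 ≤ s → s ≤ 1 / 8 → ∀ y : ℝ,
      exp (s * (y - μ) ^ 2) ≤ (1 - 8 * s) + 8 * s * exp ((y - μ) ^ 2 / 8) := by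
    intro s hs hs' y
    have := convexOn_exp.2 (Set.mem_univ (0 : ℝ)) (Set.mem_univ ((y - μ) ^ 2 / 8))
      (by linarith : 0 ≤ 1 - 8 * s) (by linarith : 0 ≤ 8 * s) (by ring)
    simp only [smul_eq_mul, mul_zero, zero_add, exp_zero, mul_one] at this
    refine le_trans (le_of_eq ?_) this
    congr 1; ring
  have hsqint : ∀ s : ℝ, 0 ≤ s → s ≤ 1 / 8 → Integrable (fun y => exp (s * (y - μ) ^ 2)) ν := by
    intro s hs hs'
    refine hzint.mono' (by fun_prop) (Filter.Eventually.of_forall fun y => ?_)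
    rw [norm_of_nonneg (exp_pos _).le, exp_le_exp]
    nlinarith [sq_nonneg (y - μ)]
  have hsq : ∀ s : ℝ, 0 ≤ s → s ≤ 1 / 8 →
      ∫ y, exp (s * (y - μ) ^ 2) ∂ν ≤ exp (8 * (B' - 1) * s) := by
    intro s hs hs'
    calc _ ≤ ∫ y, ((1 - 8 * s) + 8 * s * exp ((y - μ) ^ 2 / 8)) ∂ν :=
          integral_mono (hsqint s hs hs') ((integrable_const _).add (hzint.const_mul _))
            (hsqpt s hs hs')
      _ ≤ 8 * (B' - 1) * s + 1 := by
          rw [integral_add (integrable_const _) (hzint.const_mul _), integral_const_mul]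
          simp only [integral_const, probReal_univ, one_smul]
          nlinarith
      _ ≤ _ := add_one_le_exp _
  refine ⟨by linarith, fun t => ?_, fun s hs hs' => ?_⟩
  · rcases le_total (t ^ 2) (1 / 8) with ht | ht
    · have hi2 := hsqint _ (sq_nonneg t) ht
      have hi1 : Integrable (fun y => t * (y - μ)) ν :=
        (hid.sub (integrable_const μ)).const_mul t
      have hpt : ∀ y, exp (t * (y - μ)) ≤ t * (y - μ) + exp (t ^ 2 * (y - μ) ^ 2) := by
        intro y
        have := exp_le_add_exp_sq (t * (y - μ))
        rwa [mul_pow] at this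
      calc _ ≤ ∫⁻ y, ENNReal.ofReal (t * (y - μ) + exp (t ^ 2 * (y - μ) ^ 2)) ∂ν :=
            lintegral_mono fun y => ENNReal.ofReal_le_ofReal (hpt y)
        _ = ENNReal.ofReal (∫ y, t * (y - μ) + exp (t ^ 2 * (y - μ) ^ 2) ∂ν) :=
            (ofReal_integral_eq_lintegral_ofReal (hi1.add hi2)
              (Filter.Eventually.of_forall fun y => (exp_pos _).le.trans (hpt y))).symm
        _ ≤ _ := by
            refine ENNReal.ofReal_le_ofReal ?_
            rw [integral_add hi1 hi2, integral_const_mul, integral_sub hid (integrable_const _)]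
            simp only [integral_const, probReal_univ, one_smul, ← hμ, sub_self, mul_zero, zero_add]
            refine (hsq _ (sq_nonneg t) ht).trans (exp_le_exp.mpr ?_)
            nlinarith [sq_nonneg t]
    · calc _ ≤ ∫⁻ y, ENNReal.ofReal (exp (2 * t ^ 2) * exp ((y - μ) ^ 2 / 8)) ∂ν := by
            refine lintegral_mono fun y => ENNReal.ofReal_le_ofReal ?_
            rw [← exp_add, exp_le_exp]
            nlinarith [sq_nonneg (4 * t - (y - μ))]
        _ = ENNReal.ofReal (∫ y, exp (2 * t ^ 2) * exp ((y - μ) ^ 2 / 8) ∂ν) :=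
            (ofReal_integral_eq_lintegral_ofReal (hzint.const_mul _)
              (Filter.Eventually.of_forall fun y => by positivity)).symm
        _ ≤ _ := by
            refine ENNReal.ofReal_le_ofReal ?_
            rw [integral_const_mul]
            calc _ ≤ exp (2 * t ^ 2) * exp (8 * (B' - 1) * t ^ 2) := by
                  refine mul_le_mul_of_nonneg_left (hzB.trans ?_) (exp_pos _).le
                  have := add_one_le_exp (8 * (B' - 1) * t ^ 2)
                  nlinarith
              _ = _ := by rw [← exp_add]; congr 1; ring
  · rw [← ofReal_integral_eq_lintegral_ofReal (hsqint s hs hs')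
      (Filter.Eventually.of_forall fun y => (exp_pos _).le)]
    refine ENNReal.ofReal_le_ofReal ((hsq s hs hs').trans (exp_le_exp.mpr ?_))
    nlinarith

lemma lintegral_exp_mul_sq_stdG {s : ℝ} (hs : s < 1 / 2) :
    ∫⁻ y, ENNReal.ofReal (exp (s * y ^ 2)) ∂stdG = ENNReal.ofReal (√(1 / (1 - 2 * s))) := by
  rw [stdG, gaussianReal_of_var_ne_zero _ one_ne_zero,
    lintegral_withDensity_eq_lintegral_mul _ (measurable_gaussianPDF 0 1) (by fun_prop)]
  have h0 : ∀ y : ℝ, (gaussianPDF 0 1 * fun y => ENNReal.ofReal (exp (s * y ^ 2))) y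
      = ENNReal.ofReal ((√(2 * π))⁻¹ * exp (-(1 / 2 - s) * y ^ 2)) := by
    intro y
    rw [Pi.mul_apply, gaussianPDF_def, gaussianPDFReal_def,
      ← ENNReal.ofReal_mul (by positivity)]
    simp only [NNReal.coe_one, mul_one, sub_zero]
    rw [mul_assoc, ← exp_add]
    congr 3; ring
  simp_rw [h0]
  rw [← ofReal_integral_eq_lintegral_ofReal
    ((integrable_exp_neg_mul_sq (by linarith)).const_mul _)
    (Filter.Eventually.of_forall fun y => by positivity), integral_const_mul, integral_gaussian]
  congr 1
  have h1 : (0 : ℝ) < 1 - 2 * s := by linarith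
  rw [← sqrt_inv, ← sqrt_mul (by positivity)]
  congr 1
  field_simp

/-- The standard Gaussian measure conditioned on `J`. -/
abbrev truncG (J : Set ℝ) : Measure ℝ := ProbabilityTheory.cond stdG J

lemma exists_isSubG_truncG {q₀ : ℝ} (hq₀ : 0 < q₀) :
    ∃ K M : ℝ, 1 ≤ K ∧ 1 ≤ M ∧ ∀ J : Set ℝ, MeasurableSet J → q₀ ≤ stdG.real J →
      |∫ y, y ∂(truncG J)| ≤ M ∧ IsSubG (truncG J) (∫ y, y ∂(truncG J)) K (1 / 8) := by
  set B := max 1 (√2 / q₀) with hB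
  have hB1 : 1 ≤ B := le_max_left _ _
  refine ⟨2 + 8 * (B * exp (B ^ 2 / 4) - 1), B, ?_, hB1, fun J hJ hq => ?_⟩
  · have : 1 ≤ exp (B ^ 2 / 4) := one_le_exp (by positivity)
    nlinarith
  · have hJ0 : stdG J ≠ 0 := by
      intro h
      simp [measureReal_def, h] at hq
      linarith
    have := cond_isProbabilityMeasure hJ0
    refine isSubG_of_lintegral_exp_sq_le hB1 ?_
    rw [show truncG J = (stdG J)⁻¹ • stdG.restrict J from rfl, lintegral_smul_measure, smul_eq_mul]
    calc _ ≤ (stdG J)⁻¹ * ∫⁻ y, ENNReal.ofReal (exp (1 / 4 * y ^ 2)) ∂stdG := by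
          refine mul_le_mul_right ((setLIntegral_le_lintegral _ _).trans (le_of_eq ?_)) _
          congr 1; ext y; congr 2; ring
      _ ≤ ENNReal.ofReal (q₀⁻¹) * ENNReal.ofReal (√2) := by
          rw [lintegral_exp_mul_sq_stdG (by norm_num)]
          refine mul_le_mul' ?_ (le_of_eq (by norm_num))
          rw [ENNReal.ofReal_inv_of_pos hq₀, ENNReal.inv_le_inv]
          exact (ENNReal.ofReal_le_ofReal hq).trans (by simp [measureReal_def])
      _ ≤ _ := by
          rw [← ENNReal.ofReal_mul (by positivity)]
          refine ENNReal.ofReal_le_ofReal (le_trans (le_of_eq ?_) (le_max_right _ _))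
          ring

lemma stdGPi_restrict_pi {J : Set ℝ} (hJ0 : stdG J ≠ 0) (m : ℕ) :
    (stdGPi m).restrict {y | ∀ i, y i ∈ J}
      = (stdG J) ^ m • Measure.pi fun _ : Fin m => truncG J := by
  have := cond_isProbabilityMeasure hJ0
  have e1 : {y : Fin m → ℝ | ∀ i, y i ∈ J} = Set.univ.pi fun _ => J := by ext; simp
  have e2 : stdG J • truncG J = stdG.restrict J := by
    rw [show truncG J = (stdG J)⁻¹ • stdG.restrict J from rfl, smul_smul,
      ENNReal.mul_inv_cancel hJ0 (measure_ne_top _ _), one_smul]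
  rw [e1, stdGPi, Measure.restrict_pi_pi, ← e2]
  rw [e2]
  refine Measure.pi_eq fun s hs => ?_
  simp_rw [← e2]
  rw [Measure.smul_apply, Measure.pi_pi, smul_eq_mul]
  simp_rw [Measure.smul_apply, smul_eq_mul]
  rw [Finset.prod_mul_distrib]
  simp

lemma quadForm_shift {m : ℕ} {A : Matrix (Fin m) (Fin m) ℝ} (hA : A.IsHermitian) (y : Fin m → ℝ)
    (μ : ℝ) :
    quadForm A y = μ ^ 2 * (∑ i, ∑ j, A i j) + 2 * (∑ i, μ * (∑ j, A i j) * (y i - μ))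
      + quadForm A fun i => y i - μ := by
  have h1 : ∑ i, ∑ j, A i j * (y j - μ) = ∑ i, ∑ j, A i j * (y i - μ) := by
    rw [Finset.sum_comm]
    refine Finset.sum_congr rfl fun i _ => Finset.sum_congr rfl fun j _ => ?_
    have := hA.apply i j
    simp only [star_trivial] at this
    rw [this]
  have h2 : ∑ i, μ * (∑ j, A i j) * (y i - μ) = μ * ∑ i, ∑ j, A i j * (y i - μ) := by
    simp_rw [Finset.mul_sum, Finset.sum_mul]
    exact Finset.sum_congr rfl fun i _ => Finset.sum_congr rfl fun j _ => by ring
  have h3 : ∀ i j, y i * y j * A i j = μ ^ 2 * A i j + μ * (A i j * (y i - μ))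
      + μ * (A i j * (y j - μ)) + (y i - μ) * (y j - μ) * A i j := by
    intro i j; ring
  rw [h2, quadForm, quadForm]
  simp_rw [h3, Finset.sum_add_distrib, ← Finset.mul_sum, h1]
  ring

lemma sum_sq_row_sum_le {m : ℕ} (A : Matrix (Fin m) (Fin m) ℝ) :
    ∑ i, (∑ j, A i j) ^ 2 ≤ m * frobSq A := by
  rw [frobSq, Finset.mul_sum]
  refine Finset.sum_le_sum fun i _ => ?_
  simpa using sq_sum_le_card_mul_sum_sq (s := (Finset.univ : Finset (Fin m))) (f := fun j => A i j)

lemma exp_half_add_le (a b : ℝ) : exp (a / 2 + b) ≤ (exp a + exp (2 * b)) / 2 := by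
  have := convexOn_exp.2 (Set.mem_univ a) (Set.mem_univ (2 * b))
    (by norm_num : (0 : ℝ) ≤ 1 / 2) (by norm_num : (0 : ℝ) ≤ 1 / 2) (by norm_num)
  simp only [smul_eq_mul] at this
  calc _ = exp (1 / 2 * a + 1 / 2 * (2 * b)) := by congr 1; ring
    _ ≤ _ := this.trans (le_of_eq (by ring))

lemma lintegral_exp_quadForm_add_le {ρ : Measure ℝ} [IsProbabilityMeasure ρ] {μ K M : ℝ}
    (hK : 1 ≤ K) (hM : 1 ≤ M) (hμ : |μ| ≤ M) (h : IsSubG ρ μ K (1 / 8)) {m : ℕ}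
    {A : Matrix (Fin m) (Fin m) ℝ} (hAh : A.IsHermitian) (hA : ∀ i, A i i = 0)
    (hF : 16 * K * frobSq A ≤ 1 / 8) (l : ℝ) :
    ∫⁻ y, ENNReal.ofReal (exp (quadForm A y / 2 + l * ∑ i, y i)) ∂(Measure.pi fun _ => ρ)
      ≤ ENNReal.ofReal (exp (μ ^ 2 * (∑ i, ∑ j, A i j) / 2 + l * μ * m
          + 16 * K ^ 2 * M ^ 2 * m * (frobSq A + l ^ 2))) := by
  have hF0 := frobSq_nonneg A
  have hμ2 : μ ^ 2 ≤ M ^ 2 := sq_le_sq' (abs_le.mp hμ).1 (abs_le.mp hμ).2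
  set w : Fin m → ℝ := fun i => 2 * (μ * (∑ j, A i j) + l) with hw
  set a := μ ^ 2 * (∑ i, ∑ j, A i j) / 2 + l * μ * m with ha
  set b := 16 * K ^ 2 * M ^ 2 * m * (frobSq A + l ^ 2) with hb
  have hwsq : ∑ i, w i ^ 2 ≤ 8 * M ^ 2 * m * (frobSq A + l ^ 2) := by
    have h1 : ∀ i, w i ^ 2 ≤ 8 * (M ^ 2 * (∑ j, A i j) ^ 2) + 8 * l ^ 2 := by
      intro i
      have : μ ^ 2 * (∑ j, A i j) ^ 2 ≤ M ^ 2 * (∑ j, A i j) ^ 2 :=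
        mul_le_mul_of_nonneg_right hμ2 (sq_nonneg _)
      simp only [hw]
      nlinarith [sq_nonneg (μ * (∑ j, A i j) - l)]
    refine (Finset.sum_le_sum fun i _ => h1 i).trans ?_
    rw [Finset.sum_add_distrib, ← Finset.mul_sum, ← Finset.mul_sum]
    simp only [Finset.sum_const, Finset.card_univ, Fintype.card_fin, nsmul_eq_mul]
    have h2 := mul_le_mul_of_nonneg_left (sum_sq_row_sum_le A) (sq_nonneg M)
    have h3 : (m : ℝ) * l ^ 2 ≤ M ^ 2 * (m * l ^ 2) := by
      have h4 : 0 ≤ (m : ℝ) * l ^ 2 := by positivity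
      have h5 : 1 ≤ M ^ 2 := one_le_pow₀ hM
      exact le_mul_of_one_le_left h4 h5
    nlinarith
  have hpt : ∀ y : Fin m → ℝ, ENNReal.ofReal (exp (quadForm A y / 2 + l * ∑ i, y i))
      ≤ ENNReal.ofReal (exp a / 2) * (ENNReal.ofReal (exp (quadForm A fun i => y i - μ))
        + ENNReal.ofReal (exp (∑ i, w i * (y i - μ)))) := by
    intro y
    rw [← ENNReal.ofReal_add (exp_pos _).le (exp_pos _).le, ← ENNReal.ofReal_mul (by positivity)]
    refine ENNReal.ofReal_le_ofReal ?_
    have h1 : ∑ i, w i * (y i - μ) = 2 * (∑ i, μ * (∑ j, A i j) * (y i - μ) + l * ∑ i, (y i - μ)) := by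
      rw [Finset.mul_sum _ _ l, ← Finset.sum_add_distrib, Finset.mul_sum]
      exact Finset.sum_congr rfl fun i _ => by simp only [hw]; ring
    have h2 : ∑ i : Fin m, (y i - μ) = ∑ i, y i - m * μ := by simp
    have h3 : quadForm A y / 2 + l * ∑ i, y i
        = a + ((quadForm A fun i => y i - μ) / 2
          + (∑ i, μ * (∑ j, A i j) * (y i - μ) + l * ∑ i, (y i - μ))) := by
      rw [quadForm_shift hAh y μ, h2, ha]; ring
    rw [h3, exp_add, h1]
    have := mul_le_mul_of_nonneg_left (exp_half_add_le (quadForm A fun i => y i - μ)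
      (∑ i, μ * (∑ j, A i j) * (y i - μ) + l * ∑ i, (y i - μ))) (exp_pos a).le
    linarith
  have hq := lintegral_exp_quadForm_le h A hA hF
  have hl := lintegral_exp_sum_mul_le h w
  have hqb : 16 * K ^ 2 * frobSq A * m ≤ b := by
    have h1 : 0 ≤ 16 * K ^ 2 * m * frobSq A := by positivity
    have h2 : 0 ≤ 16 * K ^ 2 * m * l ^ 2 := by positivity
    have h3 : (1 : ℝ) ≤ M ^ 2 := by nlinarith
    rw [hb]
    nlinarith
  have hlb : K * ∑ i, w i ^ 2 ≤ b := by
    have h0 : 0 ≤ M ^ 2 * m * (frobSq A + l ^ 2) := by positivity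
    calc _ ≤ K * (8 * M ^ 2 * m * (frobSq A + l ^ 2)) :=
          mul_le_mul_of_nonneg_left hwsq (by linarith)
      _ = (8 * K) * (M ^ 2 * m * (frobSq A + l ^ 2)) := by ring
      _ ≤ (16 * K ^ 2) * (M ^ 2 * m * (frobSq A + l ^ 2)) :=
          mul_le_mul_of_nonneg_right (by nlinarith) h0
      _ = b := by rw [hb]; ring
  have hqm : Measurable fun y : Fin m → ℝ =>
      ENNReal.ofReal (exp (quadForm A fun i => y i - μ)) := by
    unfold quadForm; fun_prop
  calc _ ≤ ∫⁻ y, ENNReal.ofReal (exp a / 2) * (ENNReal.ofReal (exp (quadForm A fun i => y i - μ))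
        + ENNReal.ofReal (exp (∑ i, w i * (y i - μ)))) ∂(Measure.pi fun _ => ρ) :=
        lintegral_mono hpt
    _ = ENNReal.ofReal (exp a / 2) * (∫⁻ y, ENNReal.ofReal (exp (quadForm A fun i => y i - μ))
          ∂(Measure.pi fun _ => ρ)
        + ∫⁻ y, ENNReal.ofReal (exp (∑ i, w i * (y i - μ))) ∂(Measure.pi fun _ => ρ)) := by
        rw [lintegral_const_mul _ (by fun_prop), lintegral_add_left hqm]
    _ ≤ ENNReal.ofReal (exp a / 2) * (ENNReal.ofReal (exp b) + ENNReal.ofReal (exp b)) := by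
        refine mul_le_mul_right (add_le_add (hq.trans ?_) (hl.trans ?_)) _ <;>
        · refine ENNReal.ofReal_le_ofReal (exp_le_exp.mpr ?_)
          assumption
    _ = _ := by
        rw [← ENNReal.ofReal_add (exp_pos _).le (exp_pos _).le,
          ← ENNReal.ofReal_mul (by positivity), exp_add a b]
        congr 1; ring

lemma lintegral_trunc_exp_quadForm_le {J : Set ℝ} (hJ0 : stdG J ≠ 0) {μ K M : ℝ}
    (hK : 1 ≤ K) (hM : 1 ≤ M) (hμ : |μ| ≤ M) (h : IsSubG (truncG J) μ K (1 / 8)) {m : ℕ}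
    {A : Matrix (Fin m) (Fin m) ℝ} (hAh : A.IsHermitian) (hA : ∀ i, A i i = 0)
    (hF : 16 * K * frobSq A ≤ 1 / 8) (l : ℝ) :
    ∫⁻ y in {y | ∀ i, y i ∈ J}, ENNReal.ofReal (exp (quadForm A y / 2 + l * ∑ i, y i))
        ∂(stdGPi m)
      ≤ ENNReal.ofReal (stdG.real J ^ m * exp (μ ^ 2 * (∑ i, ∑ j, A i j) / 2 + l * μ * m
          + 16 * K ^ 2 * M ^ 2 * m * (frobSq A + l ^ 2))) := by
  have := cond_isProbabilityMeasure hJ0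
  rw [stdGPi_restrict_pi hJ0, lintegral_smul_measure, smul_eq_mul,
    ENNReal.ofReal_mul (by positivity), ENNReal.ofReal_pow (by positivity), ofReal_measureReal]
  exact mul_le_mul_right (lintegral_exp_quadForm_add_le hK hM hμ h hAh hA hF l) _

/-- Radii `r` with `√k / r` within `η` of `1`. -/
def radialWindow (k : ℕ) (η : ℝ) : Set ℝ := {r | 0 < r ∧ |√k / r - 1| ≤ η}

lemma measurableSet_radialWindow (k : ℕ) (η : ℝ) : MeasurableSet (radialWindow k η) := by
  have h : Measurable fun r : ℝ => |√k / r - 1| := by fun_prop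
  exact (measurableSet_lt measurable_const measurable_id).inter
    (measurableSet_le h measurable_const)

lemma mem_radialWindow {k : ℕ} (hk : 0 < k) {η r : ℝ} (hη : 0 < η) (hη1 : η < 1) (hr : 0 ≤ r)
    (h : |r ^ 2 - k| ≤ k * (η / 2)) : r ∈ radialWindow k η := by
  have hk' : (0 : ℝ) < k := by exact_mod_cast hk
  obtain ⟨h1, h2⟩ := abs_le.mp h
  have hr0 : 0 < r := by
    rcases hr.eq_or_lt with h0 | h0
    · rw [← h0] at h1; nlinarith
    · exact h0
  refine ⟨hr0, abs_le.mpr ⟨?_, ?_⟩⟩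
  · have : (1 - η) * r ≤ √k := by
      refine le_sqrt_of_sq_le ?_
      calc ((1 - η) * r) ^ 2 = (1 - η) ^ 2 * r ^ 2 := by ring
        _ ≤ (1 - η) ^ 2 * (k * (1 + η / 2)) :=
            mul_le_mul_of_nonneg_left (by linarith) (sq_nonneg _)
        _ = k * (1 - η * (3 - η ^ 2) / 2) := by ring
        _ ≤ k * 1 := mul_le_mul_of_nonneg_left (by nlinarith) hk'.le
        _ = k := mul_one _
    have := (le_div_iff₀ hr0).mpr this
    linarith
  · have : √k ≤ (1 + η) * r := by
      refine sqrt_le_iff.mpr ⟨by positivity, ?_⟩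
      calc (k : ℝ) = k * 1 := (mul_one _).symm
        _ ≤ k * (1 + η * (3 - η ^ 2) / 2) := mul_le_mul_of_nonneg_left (by nlinarith) hk'.le
        _ = (1 + η) ^ 2 * (k * (1 - η / 2)) := by ring
        _ ≤ (1 + η) ^ 2 * r ^ 2 :=
            mul_le_mul_of_nonneg_left (by linarith) (sq_nonneg _)
        _ = _ := by ring
    have := (div_le_iff₀ hr0).mpr this
    linarith

lemma memLp_sq_stdG : MemLp (fun y : ℝ => y ^ 2) 2 stdG := by
  rw [memLp_two_iff_integrable_sq (by fun_prop)]
  have := (memLp_id_gaussianReal' (μ := 0) (v := 1) 4 (by simp)).integrable_norm_pow (by norm_num)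
  refine this.congr (Filter.Eventually.of_forall fun y => ?_)
  simp only [id_eq, norm_eq_abs]
  rw [← pow_mul, (by decide : Even 4).pow_abs]

lemma integral_sq_stdG : ∫ y, y ^ 2 ∂stdG = 1 := by
  have h := variance_of_integral_eq_zero (X := id) (μ := stdG) (by fun_prop)
    (by simp [integral_id_gaussianReal])
  rw [variance_id_gaussianReal] at h
  simpa using h.symm

lemma exists_radialWindow_measure_ge {η β : ℝ} (hη : 0 < η) (hη1 : η < 1) (hβ : 0 < β) :
    ∃ k₀ : ℕ, ∀ k : ℕ, k₀ ≤ k →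
      1 - β ≤ (stdGaussian (Amb k)).real {h | ‖h‖ ∈ radialWindow k η} := by
  set V := Var[fun y : ℝ => y ^ 2; stdG] with hV
  have hV0 : 0 ≤ V := variance_nonneg _ _
  obtain ⟨n1, hn1⟩ := exists_nat_gt (32 * V / (η ^ 2 * β))
  obtain ⟨n2, hn2⟩ := exists_nat_gt (4 / η)
  refine ⟨n1 + n2 + 1, fun k hk => ?_⟩
  have hk1 : (1 : ℝ) ≤ k := by exact_mod_cast (by omega : 1 ≤ k)
  have hkn1 : 32 * V / (η ^ 2 * β) < k := hn1.trans_le (by exact_mod_cast (by omega : n1 ≤ k))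
  have hkn2 : 4 / η < k := hn2.trans_le (by exact_mod_cast (by omega : n2 ≤ k))
  rw [div_lt_iff₀ (by positivity)] at hkn1 hkn2
  set S : (Fin (k + 1) → ℝ) → ℝ := ∑ i, fun y : Fin (k + 1) → ℝ => y i ^ 2 with hS
  have hSy : ∀ y, S y = ∑ i, y i ^ 2 := fun y => by simp [hS]
  have hmem : ∀ i, MemLp (fun y : Fin (k + 1) → ℝ => y i ^ 2) 2 (stdGPi (k + 1)) := fun i =>
    memLp_sq_stdG.comp_measurePreserving (measurePreserving_eval (fun _ => stdG) i)
  have hSm : MemLp S 2 (stdGPi (k + 1)) := memLp_finsetSum' _ fun i _ => hmem i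
  have hSint : ∫ y, S y ∂(stdGPi (k + 1)) = k + 1 := by
    simp_rw [hSy]
    rw [integral_finsetSum _ fun i _ => (hmem i).integrable (by norm_num)]
    have : ∀ i : Fin (k + 1), ∫ y, y i ^ 2 ∂(stdGPi (k + 1)) = 1 := by
      intro i
      have hmp := measurePreserving_eval (fun _ : Fin (k + 1) => stdG) i
      rw [← integral_sq_stdG, ← hmp.map_eq, integral_map hmp.measurable.aemeasurable (by fun_prop)]
    simp [this]
  have hSvar : Var[S; stdGPi (k + 1)] = (k + 1) * V := by
    rw [hS, stdGPi, variance_sum_pi (X := fun _ y => y ^ 2) fun i => memLp_sq_stdG]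
    simp [hV]
  have hc : 0 < k * (η / 4) := by positivity
  have hch := meas_ge_le_variance_div_sq hSm hc
  rw [hSint, hSvar] at hch
  have hbad : (k + 1) * V / (k * (η / 4)) ^ 2 ≤ β := by
    rw [div_le_iff₀ (by positivity)]
    nlinarith [mul_nonneg (by linarith : (0 : ℝ) ≤ k - 1) hV0]
  have hms : MeasurableSet {h : Amb k | ‖h‖ ∈ radialWindow k η} :=
    (measurableSet_radialWindow k η).preimage measurable_norm
  have hle : (stdGaussian (Amb k)) {h | ‖h‖ ∈ radialWindow k η}ᶜ ≤ ENNReal.ofReal β := by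
    rw [← map_pi_eq_stdGaussian, Measure.map_apply (by fun_prop) hms.compl]
    refine le_trans (measure_mono fun y hy => ?_) (hch.trans (ENNReal.ofReal_le_ofReal hbad))
    simp only [Set.mem_preimage, Set.mem_compl_iff, Set.mem_ofPred_eq] at hy ⊢
    by_contra hlt
    push Not at hlt
    refine hy (mem_radialWindow (by omega) hη hη1 (norm_nonneg _) ?_)
    rw [EuclideanSpace.real_norm_sq_eq]
    rw [hSy] at hlt
    have h2 := abs_lt.mp hlt
    simp only
    rw [abs_le]
    constructor <;> nlinarith
  have h3 : (stdGaussian (Amb k)).real {h | ‖h‖ ∈ radialWindow k η}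
      + (stdGaussian (Amb k)).real {h | ‖h‖ ∈ radialWindow k η}ᶜ = 1 := probReal_add_probReal_compl hms
  have h4 : (stdGaussian (Amb k)).real {h | ‖h‖ ∈ radialWindow k η}ᶜ ≤ β :=
    ENNReal.toReal_le_of_le_ofReal hβ.le hle
  linarith

lemma offGram_diag {E : Type*} [NormedAddCommGroup E] [InnerProductSpace ℝ E] {m : ℕ}
    (v : Fin m → E) (i : Fin m) : offGram v i i = 0 := by simp [offGram]

/-- Integrating out one more point of the sphere, with an exponential tilt. -/
lemma lintegral_sphereUniform_step {I J : Set ℝ} (hI : MeasurableSet I) (hJ : MeasurableSet J)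
    (hJ0 : stdG J ≠ 0) {η μ K M : ℝ} (hη : 0 ≤ η) (hη1 : η ≤ 1)
    (hIJ : ∀ θ y : ℝ, |θ - 1| ≤ η → θ * y ∈ I → y ∈ J)
    (hK : 1 ≤ K) (hM : 1 ≤ M) (hμ : |μ| ≤ M) (hsub : IsSubG (truncG J) μ K (1 / 8)) {k m : ℕ}
    (hN : 1 / 2 ≤ (stdGaussian (Amb k)).real {h | ‖h‖ ∈ radialWindow k η})
    {v : Fin m → Amb k} (hv : ∀ i, ‖v i‖ = 1)
    (hF : 128 * K * frobSq (offGram v) ≤ 1) (l : ℝ) :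
    ∫⁻ x in {x | ∀ i, √k * ⟪x, v i⟫ ∈ I}, ENNReal.ofReal (exp (l * ∑ i, √k * ⟪x, v i⟫))
        ∂(sphereUniform k)
      ≤ ENNReal.ofReal (8 * (stdG.real J ^ m *
          exp (μ ^ 2 * (∑ i, ∑ j, offGram v i j) / 2 + l * μ * m + |l| * η * M * m
          + 64 * K ^ 2 * M ^ 2 * m * (frobSq (offGram v) + l ^ 2)))) := by
  have hF0 := frobSq_nonneg (offGram v)
  have hF4 : frobSq (offGram v) ≤ 1 / 4 := by nlinarith
  set S : Set (Amb k) := {x | ∀ i, √k * ⟪x, v i⟫ ∈ I} with hS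
  have hSm : MeasurableSet S := by
    rw [hS, Set.ofPred_forall]
    exact MeasurableSet.iInter fun i => hI.preimage (by fun_prop)
  have hTm : MeasurableSet {y : Fin m → ℝ | ∀ i, y i ∈ J} := by
    rw [Set.ofPred_forall]
    exact MeasurableSet.iInter fun i => hJ.preimage (by fun_prop)
  set b := μ ^ 2 * (∑ i, ∑ j, offGram v i j) / 2 + l * μ * m + |l| * η * M * m
          + 64 * K ^ 2 * M ^ 2 * m * (frobSq (offGram v) + l ^ 2) with hb
  set Q : (Fin m → ℝ) → ℝ → ℝ≥0∞ := fun y t => {y : Fin m → ℝ | ∀ i, y i ∈ J}.indicator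
    (fun y => ENNReal.ofReal (exp (t * ∑ i, y i))) y with hQ
  have hQm : ∀ t, Measurable fun y => Q y t := fun t => Measurable.indicator (by fun_prop) hTm
  have hQb : ∀ t : ℝ, |t - l| ≤ |l| * η → ∫⁻ h, Q (fun i => ⟪h, v i⟫) t ∂(stdGaussian (Amb k))
      ≤ ENNReal.ofReal (2 * (stdG.real J ^ m * exp b)) := by
    intro t ht
    refine (lintegral_inner_stdGaussian_le hv hF4 (hQm t)).trans ?_
    have e1 : ∀ y, ENNReal.ofReal (exp (quadForm (offGram v) y / 2)) * Q y t
        = {y : Fin m → ℝ | ∀ i, y i ∈ J}.indicator (fun y =>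
          ENNReal.ofReal (exp (quadForm (offGram v) y / 2 + t * ∑ i, y i))) y := by
      intro y
      by_cases hy : y ∈ {y : Fin m → ℝ | ∀ i, y i ∈ J}
      · simp only [hQ]
        rw [Set.indicator_of_mem hy, Set.indicator_of_mem hy, ← ENNReal.ofReal_mul (exp_pos _).le,
          ← exp_add]
      · simp only [hQ]
        rw [Set.indicator_of_notMem hy, Set.indicator_of_notMem hy, mul_zero]
    simp_rw [e1]
    rw [lintegral_indicator hTm, ENNReal.ofReal_mul (by norm_num), ENNReal.ofReal_ofNat]
    refine mul_le_mul_right ((lintegral_trunc_exp_quadForm_le hJ0 hK hM hμ hsub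
      (offGram_isHermitian v) (offGram_diag v) (by linarith) t).trans
      (ENNReal.ofReal_le_ofReal ?_)) 2
    refine mul_le_mul_of_nonneg_left (exp_le_exp.mpr ?_) (by positivity)
    have h1 : t * μ ≤ l * μ + |l| * η * M := by
      have : (t - l) * μ ≤ |l| * η * M :=
        (le_abs_self _).trans (by rw [abs_mul]; gcongr)
      linarith
    have h2 : t ^ 2 ≤ 4 * l ^ 2 := by
      have h3 : |t| ≤ 2 * |l| := by
        have h4 : |t| ≤ |t - l| + |l| := by
          simpa using abs_add_le (t - l) l
        have := mul_le_mul_of_nonneg_left hη1 (abs_nonneg l)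
        linarith
      have := pow_le_pow_left₀ (abs_nonneg t) h3 2
      rw [mul_pow, sq_abs, sq_abs] at this
      linarith
    have h5 : 16 * K ^ 2 * M ^ 2 * m * (frobSq (offGram v) + t ^ 2)
        ≤ 16 * K ^ 2 * M ^ 2 * m * (4 * (frobSq (offGram v) + l ^ 2)) :=
      mul_le_mul_of_nonneg_left (by linarith) (by positivity)
    have h6 := mul_le_mul_of_nonneg_right h1 (Nat.cast_nonneg (α := ℝ) m)
    rw [hb]
    linarith
  have hW := measurableSet_radialWindow k η
  have hmain := lintegral_sphereUniform_mul k
    (f := S.indicator fun x => ENNReal.ofReal (exp (l * ∑ i, √k * ⟪x, v i⟫)))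
    (Measurable.indicator (by fun_prop) hSm) hW
  rw [lintegral_indicator hSm] at hmain
  have hWm : MeasurableSet {h : Amb k | ‖h‖ ∈ radialWindow k η} := hW.preimage measurable_norm
  have hpt : ∫⁻ h in {h | ‖h‖ ∈ radialWindow k η},
      S.indicator (fun x => ENNReal.ofReal (exp (l * ∑ i, √k * ⟪x, v i⟫))) (‖h‖⁻¹ • h)
        ∂(stdGaussian (Amb k))
      ≤ ∫⁻ h, (Q (fun i => ⟪h, v i⟫) (l * (1 + η)) + Q (fun i => ⟪h, v i⟫) (l * (1 - η)))
        ∂(stdGaussian (Amb k)) := by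
    refine (setLIntegral_mono' hWm fun h hh => ?_).trans (setLIntegral_le_lintegral _ _)
    obtain ⟨hpos, hθ⟩ := hh
    set θ := √k / ‖h‖ with hθd
    have hin : ∀ i, √k * ⟪‖h‖⁻¹ • h, v i⟫ = θ * ⟪h, v i⟫ := by
      intro i
      rw [inner_smul_left, hθd]
      simp only [conj_trivial]
      ring
    by_cases hx : ‖h‖⁻¹ • h ∈ S
    · rw [Set.indicator_of_mem hx]
      have hy : (fun i => ⟪h, v i⟫) ∈ {y : Fin m → ℝ | ∀ i, y i ∈ J} := by
        intro i
        have := hx i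
        rw [hin] at this
        exact hIJ θ _ hθ this
      simp only [hQ]
      rw [Set.indicator_of_mem hy, Set.indicator_of_mem hy,
        ← ENNReal.ofReal_add (exp_pos _).le (exp_pos _).le]
      refine ENNReal.ofReal_le_ofReal ?_
      simp_rw [hin, ← Finset.mul_sum]
      set s := ∑ i, ⟪h, v i⟫
      obtain ⟨h1, h2⟩ := abs_le.mp hθ
      rcases le_total 0 (l * s) with hs | hs
      · have : l * (θ * s) ≤ l * (1 + η) * s := by nlinarith
        linarith [exp_le_exp.mpr this, exp_pos (l * (1 - η) * s)]
      · have : l * (θ * s) ≤ l * (1 - η) * s := by nlinarith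
        linarith [exp_le_exp.mpr this, exp_pos (l * (1 + η) * s)]
    · rw [Set.indicator_of_notMem hx]; exact zero_le
  have hQm' : ∀ t, Measurable fun h : Amb k => Q (fun i => ⟪h, v i⟫) t := fun t =>
    (hQm t).comp (by fun_prop)
  rw [lintegral_add_left (hQm' _)] at hpt
  have hη' : |l * η| ≤ |l| * η := by rw [abs_mul, abs_of_nonneg hη]
  have hfin : ∫⁻ h in {h | ‖h‖ ∈ radialWindow k η},
      S.indicator (fun x => ENNReal.ofReal (exp (l * ∑ i, √k * ⟪x, v i⟫))) (‖h‖⁻¹ • h)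
        ∂(stdGaussian (Amb k)) ≤ ENNReal.ofReal (4 * (stdG.real J ^ m * exp b)) := by
    refine hpt.trans ((add_le_add (hQb _ ?_) (hQb _ ?_)).trans (le_of_eq ?_))
    · rwa [show l * (1 + η) - l = l * η by ring]
    · rwa [show l * (1 - η) - l = -(l * η) by ring, abs_neg]
    · rw [← ENNReal.ofReal_add (by positivity) (by positivity)]
      congr 1; ring
  rw [← hmain] at hfin
  have hhalf : ENNReal.ofReal (1 / 2) ≤ stdGaussian (Amb k) {h | ‖h‖ ∈ radialWindow k η} :=
    (ENNReal.ofReal_le_ofReal hN).trans (by simp [measureReal_def])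
  have := (mul_le_mul_right hhalf _).trans hfin
  calc _ = (∫⁻ x in S, ENNReal.ofReal (exp (l * ∑ i, √k * ⟪x, v i⟫)) ∂(sphereUniform k))
        * ENNReal.ofReal (1 / 2) * ENNReal.ofReal 2 := by
        rw [mul_assoc, ← ENNReal.ofReal_mul (by norm_num)]; norm_num
    _ ≤ ENNReal.ofReal (4 * (stdG.real J ^ m * exp b)) * ENNReal.ofReal 2 :=
        mul_le_mul_left this _
    _ = _ := by
        rw [← ENNReal.ofReal_mul (by positivity)]
        congr 1; ring

section Cons

variable {E : Type*} [NormedAddCommGroup E] [InnerProductSpace ℝ E]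

lemma offGram_cons_zero_succ {m : ℕ} (a : E) (x : Fin m → E) (j : Fin m) :
    offGram (Fin.cons a x : Fin (m + 1) → E) 0 j.succ = ⟪a, x j⟫ := by
  simp [offGram, (Fin.succ_ne_zero j).symm]

lemma offGram_cons_succ_zero {m : ℕ} (a : E) (x : Fin m → E) (j : Fin m) :
    offGram (Fin.cons a x : Fin (m + 1) → E) j.succ 0 = ⟪a, x j⟫ := by
  simp [offGram, real_inner_comm]

lemma offGram_cons_succ_succ {m : ℕ} (a : E) (x : Fin m → E) (i j : Fin m) :
    offGram (Fin.cons a x : Fin (m + 1) → E) i.succ j.succ = offGram x i j := by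
  simp [offGram]

lemma sum_offGram_cons {m : ℕ} (a : E) (x : Fin m → E) :
    ∑ i, ∑ j, offGram (Fin.cons a x : Fin (m + 1) → E) i j
      = ∑ i, ∑ j, offGram x i j + 2 * ∑ i, ⟪a, x i⟫ := by
  simp_rw [Fin.sum_univ_succ, offGram_diag, offGram_cons_zero_succ, offGram_cons_succ_zero,
    offGram_cons_succ_succ, Finset.sum_add_distrib]
  ring

lemma frobSq_offGram_cons {m : ℕ} (a : E) (x : Fin m → E) :
    frobSq (offGram (Fin.cons a x : Fin (m + 1) → E))
      = frobSq (offGram x) + 2 * ∑ i, ⟪a, x i⟫ ^ 2 := by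
  unfold frobSq
  simp_rw [Fin.sum_univ_succ, offGram_diag, offGram_cons_zero_succ, offGram_cons_succ_zero,
    offGram_cons_succ_succ, Finset.sum_add_distrib]
  ring

lemma measurable_offGram [MeasurableSpace E] [BorelSpace E] [SecondCountableTopology E] {m : ℕ}
    (i j : Fin m) : Measurable fun x : Fin m → E => offGram x i j := by
  by_cases h : i = j
  · subst h; simp_rw [offGram_diag]; exact measurable_const
  · have : (fun x : Fin m → E => offGram x i j) = fun x => ⟪x i, x j⟫ := by
      ext x; simp [offGram, h]
    rw [this]; fun_prop

lemma measurable_frobSq_offGram [MeasurableSpace E] [BorelSpace E] [SecondCountableTopology E]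
    {m : ℕ} : Measurable fun x : Fin m → E => frobSq (offGram x) :=
  Finset.measurable_sum _ fun i _ => Finset.measurable_sum _ fun j _ =>
    (measurable_offGram i j).pow_const 2

lemma measurable_sum_offGram [MeasurableSpace E] [BorelSpace E] [SecondCountableTopology E]
    {m : ℕ} : Measurable fun x : Fin m → E => ∑ i, ∑ j, offGram x i j :=
  Finset.measurable_sum _ fun i _ => Finset.measurable_sum _ fun j _ => measurable_offGram i j

end Cons

/-- Unit vectors whose scaled pairwise inner products lie in `I` and whose off-diagonal Gram
matrix is small. -/
def goodSet (k m : ℕ) (I : Set ℝ) (d : ℝ) : Set (Fin m → Amb k) :=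
  {x | (∀ i, ‖x i‖ = 1) ∧ (∀ i j, i < j → √k * ⟪x i, x j⟫ ∈ I) ∧ frobSq (offGram x) ≤ d}

lemma measurableSet_goodSet (k m : ℕ) {I : Set ℝ} (hI : MeasurableSet I) (d : ℝ) :
    MeasurableSet (goodSet k m I d) := by
  refine MeasurableSet.inter ?_ (MeasurableSet.inter ?_ ?_)
  · change MeasurableSet {x : Fin m → Amb k | ∀ i, ‖x i‖ = 1}
    rw [Set.ofPred_forall]
    exact MeasurableSet.iInter fun i => measurableSet_eq_fun (by fun_prop) measurable_const
  · change MeasurableSet {x : Fin m → Amb k | ∀ i j, i < j → √k * ⟪x i, x j⟫ ∈ I}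
    simp_rw [Set.ofPred_forall]
    refine MeasurableSet.iInter fun i => MeasurableSet.iInter fun j => MeasurableSet.iInter fun _ => ?_
    have : Measurable fun x : Fin m → Amb k => √k * ⟪x i, x j⟫ := by fun_prop
    exact this hI
  · exact measurable_frobSq_offGram measurableSet_Iic

lemma cons_mem_goodSet {k m : ℕ} {I : Set ℝ} {d : ℝ} {a : Amb k} {x : Fin m → Amb k}
    (h : (Fin.cons a x : Fin (m + 1) → Amb k) ∈ goodSet k (m + 1) I d) :
    x ∈ goodSet k m I d ∧ ∀ i, √k * ⟪a, x i⟫ ∈ I := by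
  obtain ⟨h1, h2, h3⟩ := h
  refine ⟨⟨fun i => by simpa using h1 i.succ, fun i j hij => by
    simpa using h2 i.succ j.succ (Fin.succ_lt_succ_iff.mpr hij), ?_⟩, fun i => by
    simpa using h2 0 i.succ (Fin.succ_pos i)⟩
  rw [frobSq_offGram_cons] at h3
  have : 0 ≤ ∑ i, ⟪a, x i⟫ ^ 2 := Finset.sum_nonneg fun _ _ => sq_nonneg _
  linarith

/-- The exponential moment of the sum of inner products over `goodSet`. -/
def goodMoment (k m : ℕ) (I : Set ℝ) (d a : ℝ) : ℝ≥0∞ :=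
  ∫⁻ x in goodSet k m I d, ENNReal.ofReal (exp (a * ∑ i, ∑ j, offGram x i j))
    ∂(Measure.pi fun _ => sphereUniform k)

lemma goodMoment_succ_le {I J : Set ℝ} (hI : MeasurableSet I) (hJ : MeasurableSet J)
    (hJ0 : stdG J ≠ 0) {η μ K M : ℝ} (hη : 0 ≤ η) (hη1 : η ≤ 1)
    (hIJ : ∀ θ y : ℝ, |θ - 1| ≤ η → θ * y ∈ I → y ∈ J)
    (hK : 1 ≤ K) (hM : 1 ≤ M) (hμ : |μ| ≤ M) (hsub : IsSubG (truncG J) μ K (1 / 8)) {k : ℕ}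
    (hk : 0 < k)
    (hN : 1 / 2 ≤ (stdGaussian (Amb k)).real {h | ‖h‖ ∈ radialWindow k η}) {d : ℝ}
    (hd : 128 * K * d ≤ 1) (m : ℕ) {a l : ℝ} (hl : l * √k = 2 * a) :
    goodMoment k (m + 1) I d a ≤ ENNReal.ofReal (8 * (stdG.real J ^ m *
          exp (l * μ * m + |l| * η * M * m + 64 * K ^ 2 * M ^ 2 * m * (d + l ^ 2))))
        * goodMoment k m I d (a + μ ^ 2 / 2) := by
  have hk' : 0 < √(k : ℝ) := sqrt_pos.mpr (by exact_mod_cast hk)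
  have hSS : Measurable fun x : Fin (m + 1) → Amb k =>
      ENNReal.ofReal (exp (a * ∑ i, ∑ j, offGram x i j)) :=
    (measurable_exp.comp (measurable_sum_offGram.const_mul a)).ennreal_ofReal
  have hSS' : ∀ a, Measurable fun x : Fin m → Amb k =>
      ENNReal.ofReal (exp (a * ∑ i, ∑ j, offGram x i j)) := fun a =>
    (measurable_exp.comp (measurable_sum_offGram.const_mul a)).ennreal_ofReal
  rw [goodMoment, ← lintegral_indicator (measurableSet_goodSet k (m + 1) hI d),
    lintegral_pi_succ _ (hSS.indicator (measurableSet_goodSet k (m + 1) hI d)), goodMoment,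
    ← lintegral_indicator (measurableSet_goodSet k m hI d),
    ← lintegral_const_mul _ ((hSS' _).indicator (measurableSet_goodSet k m hI d))]
  refine lintegral_mono fun x => ?_
  by_cases hx : x ∈ goodSet k m I d
  · rw [Set.indicator_of_mem hx]
    have hS : MeasurableSet {b : Amb k | ∀ i, √k * ⟪b, x i⟫ ∈ I} := by
      rw [Set.ofPred_forall]
      exact MeasurableSet.iInter fun i => hI.preimage (by fun_prop)
    calc _ ≤ ∫⁻ b in {b | ∀ i, √k * ⟪b, x i⟫ ∈ I}, ENNReal.ofReal (exp (a * ∑ i, ∑ j, offGram x i j))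
            * ENNReal.ofReal (exp (l * ∑ i, √k * ⟪b, x i⟫)) ∂(sphereUniform k) := by
          rw [← lintegral_indicator hS]
          refine lintegral_mono fun b => ?_
          by_cases hb : (Fin.cons b x : Fin (m + 1) → Amb k) ∈ goodSet k (m + 1) I d
          · rw [Set.indicator_of_mem hb,
              Set.indicator_of_mem (show b ∈ {b : Amb k | ∀ i, √k * ⟪b, x i⟫ ∈ I} from
                (cons_mem_goodSet hb).2),
              ← ENNReal.ofReal_mul (exp_pos _).le, ← exp_add, sum_offGram_cons,
              ← Finset.mul_sum, ← mul_assoc, hl]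
            refine le_of_eq ?_
            congr 2; ring
          · rw [Set.indicator_of_notMem hb]; exact zero_le
      _ ≤ ENNReal.ofReal (exp (a * ∑ i, ∑ j, offGram x i j)) *
          ENNReal.ofReal (8 * (stdG.real J ^ m *
          exp (μ ^ 2 * (∑ i, ∑ j, offGram x i j) / 2 + l * μ * m + |l| * η * M * m
          + 64 * K ^ 2 * M ^ 2 * m * (frobSq (offGram x) + l ^ 2)))) := by
          rw [lintegral_const_mul _ (by fun_prop)]
          refine mul_le_mul_right (lintegral_sphereUniform_step hI hJ hJ0 hη hη1 hIJ hK hM hμ hsub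
            hN hx.1 (le_trans ?_ hd) l) _
          exact mul_le_mul_of_nonneg_left hx.2.2 (by positivity)
      _ ≤ _ := by
          rw [← ENNReal.ofReal_mul (by positivity), ← ENNReal.ofReal_mul (by positivity)]
          refine ENNReal.ofReal_le_ofReal ?_
          have h1 : 64 * K ^ 2 * M ^ 2 * m * (frobSq (offGram x) + l ^ 2)
              ≤ 64 * K ^ 2 * M ^ 2 * m * (d + l ^ 2) :=
            mul_le_mul_of_nonneg_left (by linarith [hx.2.2]) (by positivity)
          set s := ∑ i, ∑ j, offGram x i j
          calc _ = 8 * stdG.real J ^ m * (exp (a * s) * exp (μ ^ 2 * s / 2 + l * μ * m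
                + |l| * η * M * m + 64 * K ^ 2 * M ^ 2 * m * (frobSq (offGram x) + l ^ 2))) := by ring
            _ ≤ 8 * stdG.real J ^ m * (exp (l * μ * m + |l| * η * M * m
                + 64 * K ^ 2 * M ^ 2 * m * (d + l ^ 2)) * exp ((a + μ ^ 2 / 2) * s)) := by
                rw [← exp_add, ← exp_add]
                refine mul_le_mul_of_nonneg_left (exp_le_exp.mpr ?_) (by positivity)
                linarith
            _ = _ := by ring
  · rw [Set.indicator_of_notMem hx, mul_zero]
    refine le_of_eq ((lintegral_congr fun b => ?_).trans lintegral_zero)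
    exact Set.indicator_of_notMem (fun hb => hx (cons_mem_goodSet hb).1) _

lemma sum_range_sub_mul (c : ℝ) (m : ℕ) :
    ∑ j ∈ Finset.range m, (c - j) * j = c * (m * (m - 1) / 2) - (m - 1) * m * (2 * m - 1) / 6 := by
  induction m with
  | zero => simp
  | succ m ih => rw [Finset.sum_range_succ, ih]; push_cast; ring

lemma goodMoment_le {I J : Set ℝ} (hI : MeasurableSet I) (hJ : MeasurableSet J)
    (hJ0 : stdG J ≠ 0) {η μ K M : ℝ} (hη : 0 ≤ η) (hη1 : η ≤ 1)
    (hIJ : ∀ θ y : ℝ, |θ - 1| ≤ η → θ * y ∈ I → y ∈ J)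
    (hK : 1 ≤ K) (hM : 1 ≤ M) (hμ : |μ| ≤ M) (hsub : IsSubG (truncG J) μ K (1 / 8)) {k : ℕ}
    (hk : 0 < k)
    (hN : 1 / 2 ≤ (stdGaussian (Amb k)).real {h | ‖h‖ ∈ radialWindow k η}) {d : ℝ}
    (hd : 128 * K * d ≤ 1) (r : ℕ) (m : ℕ) (hm : m ≤ r) :
    goodMoment k m I d ((r - m) * μ ^ 2 / 2) ≤ ENNReal.ofReal (8 ^ m * stdG.real J ^ m.choose 2 *
      exp (μ ^ 3 / √k * ∑ j ∈ Finset.range m, ((r - 1 : ℝ) - j) * j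
        + m.choose 2 * (r * M ^ 3 / √k * η + 64 * K ^ 2 * M ^ 2 * (d + r ^ 2 * M ^ 4 / k)))) := by
  have hk' : 0 < √(k : ℝ) := sqrt_pos.mpr (by exact_mod_cast hk)
  have hsq : √(k : ℝ) ^ 2 = k := sq_sqrt (Nat.cast_nonneg k)
  induction m with
  | zero =>
    have : goodMoment k 0 I d ((r - (0 : ℕ)) * μ ^ 2 / 2) ≤ 1 := by
      rw [goodMoment]
      simp only [Finset.univ_eq_empty, Finset.sum_empty, mul_zero, exp_zero, ENNReal.ofReal_one,
        lintegral_one, Measure.restrict_apply_univ]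
      exact prob_le_one
    simpa using this
  | succ m ih =>
    set l := ((r : ℝ) - (m + 1)) * μ ^ 2 / √k with hl
    have hrm : (m : ℝ) + 1 ≤ r := by exact_mod_cast hm
    have hμ2 : μ ^ 2 ≤ M ^ 2 := sq_le_sq' (abs_le.mp hμ).1 (abs_le.mp hμ).2
    have hl0 : 0 ≤ l := by
      have : 0 ≤ (r : ℝ) - (m + 1) := by linarith
      positivity
    have hlb : l ≤ r * M ^ 2 / √k := by
      rw [hl]
      have : ((r : ℝ) - (m + 1)) ≤ r := by linarith [Nat.cast_nonneg (α := ℝ) m]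
      gcongr
    have hlsq : l ^ 2 ≤ r ^ 2 * M ^ 4 / k := by
      refine (pow_le_pow_left₀ hl0 hlb 2).trans (le_of_eq ?_)
      rw [div_pow, hsq]
      ring
    have hstep := goodMoment_succ_le hI hJ hJ0 hη hη1 hIJ hK hM hμ hsub hk hN hd m
      (a := ((r : ℝ) - (m + 1 : ℕ)) * μ ^ 2 / 2) (l := l) (by
        rw [hl]; push_cast; field_simp)
    have ea : ((r : ℝ) - (m + 1 : ℕ)) * μ ^ 2 / 2 + μ ^ 2 / 2 = (r - m) * μ ^ 2 / 2 := by
      push_cast; ring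
    rw [ea] at hstep
    refine hstep.trans ((mul_le_mul_right (ih (by omega)) _).trans ?_)
    rw [← ENNReal.ofReal_mul (by positivity)]
    refine ENNReal.ofReal_le_ofReal ?_
    have hch : (m + 1).choose 2 = m + m.choose 2 := by
      rw [Nat.choose_succ_succ' m 1, Nat.choose_one_right]
    have he : l * μ * m + |l| * η * M * m + 64 * K ^ 2 * M ^ 2 * m * (d + l ^ 2)
        ≤ μ ^ 3 / √k * (((r - 1 : ℝ) - m) * m)
          + m * (r * M ^ 3 / √k * η + 64 * K ^ 2 * M ^ 2 * (d + r ^ 2 * M ^ 4 / k)) := by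
      have h1 : l * μ * m = μ ^ 3 / √k * (((r - 1 : ℝ) - m) * m) := by rw [hl]; ring
      have h2 : |l| * η * M * m ≤ m * (r * M ^ 3 / √k * η) := by
        rw [abs_of_nonneg hl0]
        calc l * η * M * m ≤ (r * M ^ 2 / √k) * η * M * m := by gcongr
          _ = _ := by ring
      have h3 : 64 * K ^ 2 * M ^ 2 * m * (d + l ^ 2)
          ≤ 64 * K ^ 2 * M ^ 2 * m * (d + r ^ 2 * M ^ 4 / k) := by gcongr
      linarith
    rw [Finset.sum_range_succ, hch, pow_succ (8 : ℝ) m, pow_add (stdG.real J)]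
    set e₁ := l * μ * m + |l| * η * M * m + 64 * K ^ 2 * M ^ 2 * m * (d + l ^ 2)
    set X := r * M ^ 3 / √k * η + 64 * K ^ 2 * M ^ 2 * (d + r ^ 2 * M ^ 4 / k)
    set Y := ∑ j ∈ Finset.range m, ((r - 1 : ℝ) - j) * j
    have hexp : exp e₁ * exp (μ ^ 3 / √k * Y + m.choose 2 * X) ≤
        exp (μ ^ 3 / √k * (Y + ((r - 1 : ℝ) - m) * m) + (m + m.choose 2 : ℕ) * X) := by
      rw [← exp_add]
      refine exp_le_exp.mpr ?_
      push_cast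
      linarith
    calc _ = 8 ^ m * 8 * (stdG.real J ^ m * stdG.real J ^ m.choose 2) *
          (exp e₁ * exp (μ ^ 3 / √k * Y + m.choose 2 * X)) := by
          generalize exp e₁ = E1
          generalize exp (μ ^ 3 / √k * Y + m.choose 2 * X) = E2
          ring
      _ ≤ _ := mul_le_mul_of_nonneg_left hexp (by positivity)

lemma goodSet_measure_le {I J : Set ℝ} (hI : MeasurableSet I) (hJ : MeasurableSet J)
    (hJ0 : stdG J ≠ 0) {η μ K M : ℝ} (hη : 0 ≤ η) (hη1 : η ≤ 1)
    (hIJ : ∀ θ y : ℝ, |θ - 1| ≤ η → θ * y ∈ I → y ∈ J)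
    (hK : 1 ≤ K) (hM : 1 ≤ M) (hμ : |μ| ≤ M) (hsub : IsSubG (truncG J) μ K (1 / 8)) {k : ℕ}
    (hk : 0 < k)
    (hN : 1 / 2 ≤ (stdGaussian (Amb k)).real {h | ‖h‖ ∈ radialWindow k η}) {d : ℝ}
    (hd : 128 * K * d ≤ 1) (r : ℕ) :
    (Measure.pi fun _ : Fin r => sphereUniform k) (goodSet k r I d)
      ≤ ENNReal.ofReal (8 ^ r * stdG.real J ^ r.choose 2 *
      exp (r.choose 2 * (μ ^ 3 / √k * (r - 2) / 3
        + (r * M ^ 3 / √k * η + 64 * K ^ 2 * M ^ 2 * (d + r ^ 2 * M ^ 4 / k))))) := by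
  have h := goodMoment_le hI hJ hJ0 hη hη1 hIJ hK hM hμ hsub hk hN hd r r le_rfl
  rw [sub_self, zero_mul, zero_div, goodMoment] at h
  simp only [zero_mul, exp_zero, ENNReal.ofReal_one, lintegral_one, Measure.restrict_apply_univ] at h
  refine h.trans (le_of_eq ?_)
  rw [sum_range_sub_mul, Nat.cast_choose_two]
  congr 3
  ring

/-- A capped exponential moment of the off-diagonal Gram matrix of uniform points. -/
def gramMoment (k m : ℕ) (d : ℝ) : ℝ≥0∞ :=
  ∫⁻ x in {x | ∀ i, ‖x i‖ = 1}, ENNReal.ofReal (exp (k / 64 * min (frobSq (offGram x)) d))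
    ∂(Measure.pi fun _ : Fin m => sphereUniform k)

lemma quadForm_le {m : ℕ} {A : Matrix (Fin m) (Fin m) ℝ} (hA : frobSq A ≤ 1 / 4) (y : Fin m → ℝ) :
    quadForm A y ≤ 1 / 2 * ∑ i, y i ^ 2 := by
  have h := Finset.sum_mul_sq_le_sq_mul_sq (Finset.univ : Finset (Fin m × Fin m))
    (fun p => y p.1 * y p.2) (fun p => A p.1 p.2)
  rw [Fintype.sum_prod_type, Fintype.sum_prod_type, Fintype.sum_prod_type] at h
  simp only [mul_pow, ← Finset.mul_sum, ← Finset.sum_mul] at h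
  change quadForm A y ^ 2 ≤ _ * frobSq A at h
  set s := ∑ i, y i ^ 2
  have hs : 0 ≤ s := Finset.sum_nonneg fun _ _ => sq_nonneg _
  refine abs_le_of_sq_le_sq' ?_ (by positivity) |>.2
  have : s * s * frobSq A ≤ s * s * (1 / 4) := mul_le_mul_of_nonneg_left hA (by positivity)
  linarith

lemma lintegral_sphereUniform_exp_sq_le {η : ℝ} (hη1 : η ≤ 1) {k m : ℕ}
    (hN : 1 / 2 ≤ (stdGaussian (Amb k)).real {h | ‖h‖ ∈ radialWindow k η})
    {v : Fin m → Amb k} (hv : ∀ i, ‖v i‖ = 1) (hF : frobSq (offGram v) ≤ 1 / 4) :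
    ∫⁻ x, ENNReal.ofReal (exp (k / 32 * ∑ i, ⟪x, v i⟫ ^ 2)) ∂(sphereUniform k)
      ≤ ENNReal.ofReal (4 ^ (m + 1)) := by
  have hW := measurableSet_radialWindow k η
  have hmain := lintegral_sphereUniform_mul k
    (f := fun x => ENNReal.ofReal (exp (k / 32 * ∑ i, ⟪x, v i⟫ ^ 2))) (by fun_prop) hW
  have hWm : MeasurableSet {h : Amb k | ‖h‖ ∈ radialWindow k η} := hW.preimage measurable_norm
  have hG : ∫⁻ h, ENNReal.ofReal (exp (1 / 8 * ∑ i, ⟪h, v i⟫ ^ 2)) ∂(stdGaussian (Amb k))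
      ≤ ENNReal.ofReal (2 * 2 ^ m) := by
    refine (lintegral_inner_stdGaussian_le hv hF
      (f := fun y => ENNReal.ofReal (exp (1 / 8 * ∑ i, y i ^ 2))) (by fun_prop)).trans ?_
    rw [ENNReal.ofReal_mul (by norm_num), ENNReal.ofReal_ofNat]
    refine mul_le_mul_right ?_ 2
    calc _ ≤ ∫⁻ y, ∏ i, ENNReal.ofReal (exp (3 / 8 * y i ^ 2)) ∂(stdGPi m) := by
          refine lintegral_mono fun y => ?_
          rw [← ENNReal.ofReal_mul (exp_pos _).le, ← exp_add,
            ← ENNReal.ofReal_prod_of_nonneg fun _ _ => (exp_pos _).le, ← exp_sum,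
            ← Finset.mul_sum]
          refine ENNReal.ofReal_le_ofReal (exp_le_exp.mpr ?_)
          linarith [quadForm_le hF y]
      _ = _ := by
          rw [lintegral_pi_prod stdG (f := fun _ y => ENNReal.ofReal (exp (3 / 8 * y ^ 2)))
            (fun i => by fun_prop), Finset.prod_const, lintegral_exp_mul_sq_stdG (by norm_num),
            ENNReal.ofReal_pow (by norm_num)]
          have : √(1 / (1 - 2 * (3 / 8)) : ℝ) = 2 := by
            rw [show (1 / (1 - 2 * (3 / 8)) : ℝ) = 2 ^ 2 by norm_num]
            exact sqrt_sq (by norm_num)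
          rw [this]
          simp
  have hpt : ∫⁻ h in {h | ‖h‖ ∈ radialWindow k η},
      ENNReal.ofReal (exp (k / 32 * ∑ i, ⟪‖h‖⁻¹ • h, v i⟫ ^ 2)) ∂(stdGaussian (Amb k))
      ≤ ENNReal.ofReal (2 * 2 ^ m) := by
    refine ((setLIntegral_mono' hWm fun h hh => ?_).trans (setLIntegral_le_lintegral _ _)).trans hG
    obtain ⟨hpos, hθ⟩ := hh
    refine ENNReal.ofReal_le_ofReal (exp_le_exp.mpr ?_)
    rw [Finset.mul_sum, Finset.mul_sum]
    refine Finset.sum_le_sum fun i _ => ?_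
    have h1 : k / 32 * ⟪‖h‖⁻¹ • h, v i⟫ ^ 2 = (√k / ‖h‖) ^ 2 / 32 * ⟪h, v i⟫ ^ 2 := by
      rw [inner_smul_left, div_pow, sq_sqrt (Nat.cast_nonneg k)]
      simp only [conj_trivial]
      ring
    rw [h1]
    have h2 : (√k / ‖h‖) ^ 2 ≤ 2 ^ 2 := by
      refine pow_le_pow_left₀ (by positivity) ?_ 2
      linarith [(abs_le.mp hθ).2]
    refine mul_le_mul_of_nonneg_right (by linarith) (sq_nonneg _)
  rw [← hmain] at hpt
  have hhalf : ENNReal.ofReal (1 / 2) ≤ stdGaussian (Amb k) {h | ‖h‖ ∈ radialWindow k η} :=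
    (ENNReal.ofReal_le_ofReal hN).trans (by simp [measureReal_def])
  have := (mul_le_mul_right hhalf _).trans hpt
  calc _ = (∫⁻ x, ENNReal.ofReal (exp (k / 32 * ∑ i, ⟪x, v i⟫ ^ 2)) ∂(sphereUniform k))
        * ENNReal.ofReal (1 / 2) * ENNReal.ofReal 2 := by
        rw [mul_assoc, ← ENNReal.ofReal_mul (by norm_num)]; norm_num
    _ ≤ ENNReal.ofReal (2 * 2 ^ m) * ENNReal.ofReal 2 := mul_le_mul_left this _
    _ ≤ _ := by
        rw [← ENNReal.ofReal_mul (by positivity)]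
        refine ENNReal.ofReal_le_ofReal ?_
        have : (2 : ℝ) ^ m ≤ 4 ^ m := pow_le_pow_left₀ (by norm_num) (by norm_num) m
        rw [pow_succ]
        linarith

lemma measurableSet_forall_norm_eq (k m : ℕ) :
    MeasurableSet {x : Fin m → Amb k | ∀ i, ‖x i‖ = 1} := by
  rw [Set.ofPred_forall]
  exact MeasurableSet.iInter fun i => measurableSet_eq_fun (by fun_prop) measurable_const

lemma gramMoment_succ_le {η : ℝ} (hη1 : η ≤ 1) {k : ℕ}
    (hN : 1 / 2 ≤ (stdGaussian (Amb k)).real {h | ‖h‖ ∈ radialWindow k η}) {d : ℝ}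
    (hd : d ≤ 1 / 4) (m : ℕ) :
    gramMoment k (m + 1) d ≤ ENNReal.ofReal (4 ^ (m + 1)) * gramMoment k m d := by
  unfold gramMoment
  have hS := measurableSet_forall_norm_eq k (m + 1)
  have hS' := measurableSet_forall_norm_eq k m
  have hFm : Measurable fun x : Fin (m + 1) → Amb k =>
      ENNReal.ofReal (exp (k / 64 * min (frobSq (offGram x)) d)) :=
    ((((measurable_frobSq_offGram).min measurable_const).const_mul _).exp).ennreal_ofReal
  have hFm' : Measurable fun x : Fin m → Amb k =>
      ENNReal.ofReal (exp (k / 64 * min (frobSq (offGram x)) d)) :=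
    ((((measurable_frobSq_offGram).min measurable_const).const_mul _).exp).ennreal_ofReal
  rw [← lintegral_indicator hS, ← lintegral_indicator hS',
    lintegral_pi_succ _ (hFm.indicator hS), ← lintegral_const_mul _ (hFm'.indicator hS')]
  refine lintegral_mono fun x => ?_
  by_cases hx : x ∈ {x : Fin m → Amb k | ∀ i, ‖x i‖ = 1}
  swap
  · rw [Set.indicator_of_notMem hx, mul_zero]
    refine le_of_eq ?_
    rw [lintegral_eq_zero_iff' (by
      exact ((hFm.indicator hS).comp (by fun_prop : Measurable fun a : Amb k =>
        (Fin.cons a x : Fin (m + 1) → Amb k))).aemeasurable)]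
    refine Filter.Eventually.of_forall fun a => Set.indicator_of_notMem (fun h => hx fun i => ?_) _
    simpa using h i.succ
  rw [Set.indicator_of_mem hx]
  refine (lintegral_mono fun a => Set.indicator_le_self _ _ _).trans ?_
  by_cases hF : frobSq (offGram x) ≤ d
  · have hle := lintegral_sphereUniform_exp_sq_le hη1 hN hx (hF.trans hd)
    rw [min_eq_left hF, mul_comm]
    refine le_trans ?_ (mul_le_mul_right hle _)
    rw [← lintegral_const_mul _ (by fun_prop)]
    refine lintegral_mono fun a => ?_
    rw [← ENNReal.ofReal_mul (exp_pos _).le, ← exp_add]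
    refine ENNReal.ofReal_le_ofReal (exp_le_exp.mpr ?_)
    have h1 := min_le_left (frobSq (offGram (Fin.cons a x : Fin (m + 1) → Amb k))) d
    rw [frobSq_offGram_cons] at h1
    have := mul_le_mul_of_nonneg_left h1 (by positivity : (0 : ℝ) ≤ k / 64)
    rw [frobSq_offGram_cons]
    linarith
  · have h1 : ∀ a, min (frobSq (offGram (Fin.cons a x : Fin (m + 1) → Amb k))) d = d := fun a => by
      rw [frobSq_offGram_cons]
      refine min_eq_right ?_
      have : 0 ≤ ∑ i, ⟪a, x i⟫ ^ 2 := Finset.sum_nonneg fun _ _ => sq_nonneg _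
      linarith
    simp_rw [h1]
    rw [lintegral_const, measure_univ, mul_one, min_eq_right (not_le.mp hF).le]
    refine le_mul_of_one_le_left' ?_
    rw [ENNReal.one_le_ofReal]
    exact one_le_pow₀ (by norm_num)

lemma gramMoment_le {η : ℝ} (hη1 : η ≤ 1) {k : ℕ}
    (hN : 1 / 2 ≤ (stdGaussian (Amb k)).real {h | ‖h‖ ∈ radialWindow k η}) {d : ℝ}
    (hd0 : 0 ≤ d) (hd : d ≤ 1 / 4) (m : ℕ) :
    gramMoment k m d ≤ ENNReal.ofReal (4 ^ (m ^ 2)) := by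
  induction m with
  | zero =>
    unfold gramMoment
    have : ∀ x : Fin 0 → Amb k, frobSq (offGram x) = 0 := fun x => by simp [frobSq]
    simp only [this, min_eq_left hd0, mul_zero, exp_zero, ENNReal.ofReal_one, lintegral_one,
      Measure.restrict_apply_univ]
    simp
  | succ m ih =>
    refine (gramMoment_succ_le hη1 hN hd m).trans ((mul_le_mul_right ih _).trans ?_)
    rw [← ENNReal.ofReal_mul (by positivity), ← pow_add]
    refine ENNReal.ofReal_le_ofReal (pow_le_pow_right₀ (by norm_num) ?_)
    nlinarith

lemma frobSq_tail_le {η : ℝ} (hη1 : η ≤ 1) {k : ℕ}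
    (hN : 1 / 2 ≤ (stdGaussian (Amb k)).real {h | ‖h‖ ∈ radialWindow k η}) {d : ℝ}
    (hd0 : 0 ≤ d) (hd : d ≤ 1 / 4) (m : ℕ) :
    (Measure.pi fun _ : Fin m => sphereUniform k)
      {x | (∀ i, ‖x i‖ = 1) ∧ d < frobSq (offGram x)}
      ≤ ENNReal.ofReal (exp (-(k / 64 * d)) * 4 ^ (m ^ 2)) := by
  have hS := measurableSet_forall_norm_eq k m
  have hT : MeasurableSet {x : Fin m → Amb k | d < frobSq (offGram x)} :=
    measurableSet_lt measurable_const measurable_frobSq_offGram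
  have hle := gramMoment_le hη1 hN hd0 hd m
  have h1 : ENNReal.ofReal (exp (k / 64 * d)) * (Measure.pi fun _ : Fin m => sphereUniform k)
      {x | (∀ i, ‖x i‖ = 1) ∧ d < frobSq (offGram x)} ≤ gramMoment k m d := by
    unfold gramMoment
    have hsub : {x : Fin m → Amb k | (∀ i, ‖x i‖ = 1) ∧ d < frobSq (offGram x)}
        ⊆ {x | ∀ i, ‖x i‖ = 1} := fun x hx => hx.1
    refine le_trans ?_ (lintegral_mono_set hsub)
    rw [← setLIntegral_const]
    refine setLIntegral_mono' (hS.inter hT) fun x hx => ?_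
    rw [min_eq_right hx.2.le]
  have h2 := mul_le_mul_right (h1.trans hle) (ENNReal.ofReal (exp (-(k / 64 * d))))
  rw [← mul_assoc, ← ENNReal.ofReal_mul (exp_pos _).le, ← exp_add,
    ← ENNReal.ofReal_mul (exp_pos _).le, neg_add_cancel, exp_zero, ENNReal.ofReal_one, one_mul] at h2
  exact h2

lemma measure_clique_le {I J : Set ℝ} (hI : MeasurableSet I) (hJ : MeasurableSet J)
    (hJ0 : stdG J ≠ 0) {η μ K M : ℝ} (hη : 0 ≤ η) (hη1 : η ≤ 1)
    (hIJ : ∀ θ y : ℝ, |θ - 1| ≤ η → θ * y ∈ I → y ∈ J)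
    (hK : 1 ≤ K) (hM : 1 ≤ M) (hμ : |μ| ≤ M) (hsub : IsSubG (truncG J) μ K (1 / 8)) {k : ℕ}
    (hk : 0 < k)
    (hN : 1 / 2 ≤ (stdGaussian (Amb k)).real {h | ‖h‖ ∈ radialWindow k η}) {d : ℝ}
    (hd0 : 0 ≤ d) (hd : 128 * K * d ≤ 1) (r : ℕ) :
    (Measure.pi fun _ : Fin r => sphereUniform k).real {x | ∀ i j, i < j → √k * ⟪x i, x j⟫ ∈ I}
      ≤ 8 ^ r * stdG.real J ^ r.choose 2 *
      exp (r.choose 2 * (μ ^ 3 / √k * (r - 2) / 3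
        + (r * M ^ 3 / √k * η + 64 * K ^ 2 * M ^ 2 * (d + r ^ 2 * M ^ 4 / k))))
      + exp (-(k / 64 * d)) * 4 ^ (r ^ 2) := by
  have hd' : d ≤ 1 / 4 := by nlinarith
  have h1 := goodSet_measure_le hI hJ hJ0 hη hη1 hIJ hK hM hμ hsub hk hN hd r
  have h2 := frobSq_tail_le hη1 hN hd0 hd' r
  have h3 : (Measure.pi fun _ : Fin r => sphereUniform k) {x | ∀ i, ‖x i‖ = 1}ᶜ = 0 := by
    have : ∀ᵐ x ∂(Measure.pi fun _ : Fin r => sphereUniform k), ∀ i, ‖x i‖ = 1 := by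
      rw [ae_all_iff]
      intro i
      exact (measurePreserving_eval (fun _ : Fin r => sphereUniform k) i).quasiMeasurePreserving.ae
        (ae_norm_sphereUniform k)
    exact this
  have hsubset : {x : Fin r → Amb k | ∀ i j, i < j → √k * ⟪x i, x j⟫ ∈ I} ⊆
      (goodSet k r I d ∪ {x | (∀ i, ‖x i‖ = 1) ∧ d < frobSq (offGram x)})
        ∪ {x | ∀ i, ‖x i‖ = 1}ᶜ := by
    intro x hx
    by_cases hn : ∀ i, ‖x i‖ = 1
    · rcases le_or_gt (frobSq (offGram x)) d with h | h
      · exact Or.inl (Or.inl ⟨hn, hx, h⟩)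
      · exact Or.inl (Or.inr ⟨hn, h⟩)
    · exact Or.inr hn
  rw [measureReal_def]
  refine ENNReal.toReal_le_of_le_ofReal (by positivity) ?_
  refine (measure_mono hsubset).trans ((measure_union_le _ _).trans ?_)
  rw [h3, add_zero, ENNReal.ofReal_add (by positivity) (by positivity)]
  exact (measure_union_le _ _).trans (add_le_add h1 h2)

lemma sqrt_cast_sq_mul_sq (D l : ℕ) : √((D ^ 2 * l ^ 2 : ℕ) : ℝ) = D * l := by
  push_cast
  rw [← mul_pow]
  exact sqrt_sq (by positivity)

lemma two_mul_choose_two_bounds {l r : ℕ} (hl : 2 ≤ l) (hr : l ≤ r) :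
    (r : ℝ) * l ≤ 4 * r.choose 2 ∧ (r.choose 2 : ℝ) ≤ r ^ 2 / 2 := by
  have hl' : (2 : ℝ) ≤ l := by exact_mod_cast hl
  have hr' : (l : ℝ) ≤ r := by exact_mod_cast hr
  rw [Nat.cast_choose_two]
  constructor <;> nlinarith

set_option maxHeartbeats 400000 in
/-- The arithmetic behind the clique bound: all error terms are `o(1/D)` per pair. -/
lemma clique_bound_arith {q q₀ R κ K M μ η Λ : ℝ} (hq₀ : 0 < q₀) (hq : q₀ ≤ q) (hR : 1 ≤ R)
    (hM : 1 ≤ M) (hμ : |μ| ≤ M) (hη : 0 ≤ η) (hηκ : 3 * R * M ^ 3 * η ≤ κ)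
    (hΛ : Λ = 64 * R ^ 2 * (2 + |log q₀| + M ^ 3 * R)) {D l r : ℕ} (hD : 1 ≤ D)
    (hDκ : 192 * K ^ 2 * M ^ 2 * (Λ + R ^ 2 * M ^ 4) ≤ κ * D) (hl : 2 ≤ l)
    (hlκ : 3 * D * (16 + M ^ 3) ≤ κ * l) (hlr : l ≤ r) (hrR : r ≤ R * l) :
    8 ^ r * q ^ r.choose 2 *
      exp (r.choose 2 * (μ ^ 3 / (D * l) * (r - 2) / 3
        + (r * M ^ 3 / (D * l) * η + 64 * K ^ 2 * M ^ 2 * (Λ / D ^ 2 + r ^ 2 * M ^ 4 / (D * l) ^ 2))))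
      + exp (-((D * l) ^ 2 / 64 * (Λ / D ^ 2))) * 4 ^ (r ^ 2)
    ≤ exp (r.choose 2 * (log q + μ ^ 3 * (r / (D * l)) / 3 + κ / D)) := by
  obtain ⟨hN1, hN2⟩ := two_mul_choose_two_bounds hl hlr
  have hl' : (2 : ℝ) ≤ l := by exact_mod_cast hl
  have hr' : (l : ℝ) ≤ r := by exact_mod_cast hlr
  have hD' : (1 : ℝ) ≤ D := by exact_mod_cast hD
  have hl0 : (0 : ℝ) < l := by linarith
  have hD0 : (0 : ℝ) < D := by linarith
  have hr0 : (0 : ℝ) < r := by linarith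
  have hq0 : 0 < q := hq₀.trans_le hq
  set N : ℝ := ((r.choose 2 : ℕ) : ℝ)
  have hN0 : 0 ≤ N := Nat.cast_nonneg _
  have hlog2 : log 2 ≤ 1 := by linarith [log_two_lt_d9]
  have hlog2' : 0 ≤ log 2 := log_nonneg (by norm_num)
  have hμ3 : |μ ^ 3| ≤ M ^ 3 := by
    rw [abs_pow]; exact pow_le_pow_left₀ (abs_nonneg _) hμ 3
  obtain ⟨hμa, hμb⟩ := abs_le.mp hμ3
  have hM3 : 1 ≤ M ^ 3 := one_le_pow₀ hM
  have e8 : (8 : ℝ) ^ r = exp (r * (3 * log 2)) := by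
    rw [← log_rpow two_pos, mul_comm, exp_mul, exp_log (by positivity), rpow_natCast]
    norm_num
  have e4 : (4 : ℝ) ^ (r ^ 2) = exp (r ^ 2 * (2 * log 2)) := by
    rw [← log_rpow two_pos, mul_comm, exp_mul, exp_log (by positivity)]
    rw [show ((r : ℝ) ^ 2) = ((r ^ 2 : ℕ) : ℝ) by push_cast; rfl, rpow_natCast]
    norm_num
  have eq : q ^ r.choose 2 = exp (N * log q) := by
    rw [mul_comm, exp_mul, exp_log hq0, rpow_natCast]
  set a := log q + μ ^ 3 * (r / (D * l)) / 3 with ha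
  have hrl : (r : ℝ) / (D * l) ≤ R / D := by
    rw [div_le_div_iff₀ (by positivity) hD0]
    linarith only [mul_le_mul_of_nonneg_right hrR hD0.le]
  have hlrl : (l : ℝ) ≤ r * l := le_mul_of_one_le_left hl0.le (by linarith)
  have hrl0 : 0 ≤ (r : ℝ) / (D * l) := by positivity
  -- the main term
  have hmain : 8 ^ r * q ^ r.choose 2 *
      exp (N * (μ ^ 3 / (D * l) * (r - 2) / 3
        + (r * M ^ 3 / (D * l) * η
          + 64 * K ^ 2 * M ^ 2 * (Λ / D ^ 2 + r ^ 2 * M ^ 4 / (D * l) ^ 2))))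
      ≤ exp (N * (a + κ / D) - 1) := by
    rw [e8, eq, ← exp_add, ← exp_add]
    refine exp_le_exp.mpr ?_
    have t1 : r * (3 * log 2) + 1 ≤ N * (16 / l) := by
      rw [mul_div_assoc', le_div_iff₀ hl0]
      have := mul_le_mul_of_nonneg_left hlog2 (by positivity : (0 : ℝ) ≤ 3 * (r * l))
      linarith only [this, hlrl, hN1]
    have t2 : μ ^ 3 / (D * l) * (r - 2) / 3 ≤ μ ^ 3 * (r / (D * l)) / 3 + M ^ 3 / l := by
      have : -(μ ^ 3) / (D * l) ≤ M ^ 3 / l := by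
        rw [div_le_div_iff₀ (by positivity) hl0]
        have : -μ ^ 3 * l ≤ M ^ 3 * l := mul_le_mul_of_nonneg_right (by linarith) hl0.le
        linarith only [this, mul_le_mul_of_nonneg_left hD' (by positivity : 0 ≤ M ^ 3 * l)]
      have h3 : 0 ≤ M ^ 3 / l := by positivity
      have e : μ ^ 3 / (D * l) * (r - 2) / 3
          = μ ^ 3 * (r / (D * l)) / 3 + 2 / 3 * (-(μ ^ 3) / (D * l)) := by ring
      rw [e]; linarith
    have t3 : r * M ^ 3 / (D * l) * η ≤ κ / D / 3 := by
      calc r * M ^ 3 / (D * l) * η = (r / (D * l)) * (M ^ 3 * η) := by ring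
        _ ≤ R / D * (M ^ 3 * η) := mul_le_mul_of_nonneg_right hrl (by positivity)
        _ = (3 * R * M ^ 3 * η) / D / 3 := by ring
        _ ≤ _ := by gcongr
    have t4 : 64 * K ^ 2 * M ^ 2 * (Λ / D ^ 2 + r ^ 2 * M ^ 4 / (D * l) ^ 2) ≤ κ / D / 3 := by
      calc 64 * K ^ 2 * M ^ 2 * (Λ / D ^ 2 + r ^ 2 * M ^ 4 / (D * l) ^ 2)
          = 64 * K ^ 2 * M ^ 2 * (Λ / D ^ 2 + (r / (D * l)) ^ 2 * M ^ 4) := by rw [div_pow]; ring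
        _ ≤ 64 * K ^ 2 * M ^ 2 * (Λ / D ^ 2 + (R / D) ^ 2 * M ^ 4) := by gcongr
        _ = (192 * K ^ 2 * M ^ 2 * (Λ + R ^ 2 * M ^ 4)) / D ^ 2 / 3 := by rw [div_pow]; ring
        _ ≤ (κ * D) / D ^ 2 / 3 := by gcongr
        _ = _ := by field_simp
    have t5 : 16 / l + M ^ 3 / l ≤ κ / D / 3 := by
      rw [← add_div, div_div, div_le_div_iff₀ hl0 (by positivity)]
      linarith only [hlκ]
    have : N * (μ ^ 3 / (D * l) * (r - 2) / 3
        + (r * M ^ 3 / (D * l) * η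
          + 64 * K ^ 2 * M ^ 2 * (Λ / D ^ 2 + r ^ 2 * M ^ 4 / (D * l) ^ 2)))
        ≤ N * (μ ^ 3 * (r / (D * l)) / 3 + M ^ 3 / l + (κ / D / 3 + κ / D / 3)) :=
      mul_le_mul_of_nonneg_left
        ((add_le_add t2 (add_le_add t3 t4)).trans_eq (by ring)) hN0
    have h6 : N * (16 / l + M ^ 3 / l) ≤ N * (κ / D / 3) := mul_le_mul_of_nonneg_left t5 hN0
    rw [ha]
    linarith only [t1, this, h6]
  have htail : exp (-((D * l) ^ 2 / 64 * (Λ / D ^ 2))) * 4 ^ (r ^ 2)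
      ≤ exp (N * (a + κ / D) - 1) := by
    rw [e4, ← exp_add]
    refine exp_le_exp.mpr ?_
    have s1 : ((D : ℝ) * l) ^ 2 / 64 * (Λ / D ^ 2) = R ^ 2 * l ^ 2 * (2 + |log q₀| + M ^ 3 * R) := by
      rw [hΛ]; field_simp
    have hr2 : (r : ℝ) ^ 2 ≤ R ^ 2 * l ^ 2 := by
      rw [← mul_pow]; exact pow_le_pow_left₀ hr0.le hrR 2
    have hqa : -|log q₀| ≤ log q := (neg_abs_le _).trans (log_le_log hq₀ hq)
    have ha1 : -(|log q₀| + M ^ 3 * R) ≤ a := by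
      have h1 : -(M ^ 3) * (r / (D * l)) ≤ μ ^ 3 * (r / (D * l)) :=
        mul_le_mul_of_nonneg_right hμa hrl0
      have h2 : (r : ℝ) / (D * l) ≤ R := hrl.trans (div_le_self (by linarith) hD')
      have h3 : M ^ 3 * (r / (D * l)) ≤ M ^ 3 * R := mul_le_mul_of_nonneg_left h2 (by positivity)
      have h4 : 0 ≤ M ^ 3 * R := by positivity
      rw [ha]; linarith
    have hκ : 1 ≤ N * (κ / D) := by
      have : 3 * (16 + M ^ 3) / l ≤ κ / D := by
        rw [div_le_div_iff₀ hl0 hD0]; linarith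
      refine le_trans ?_ (mul_le_mul_of_nonneg_left this hN0)
      rw [mul_div_assoc', le_div_iff₀ hl0]
      have := mul_le_mul_of_nonneg_left hM3 hN0
      linarith only [this, hlrl, hN1]
    set B := |log q₀| + M ^ 3 * R
    have hB : 0 ≤ B := by positivity
    have h5 : N * -B ≤ N * a := mul_le_mul_of_nonneg_left ha1 hN0
    have h6 : N * B ≤ R ^ 2 * l ^ 2 * B := mul_le_mul_of_nonneg_right (by linarith) hB
    have h7 : (r : ℝ) ^ 2 * (2 * log 2) ≤ R ^ 2 * l ^ 2 * 2 := by
      refine mul_le_mul hr2 (by linarith) (by positivity) (by positivity)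
    have s2 : R ^ 2 * (l : ℝ) ^ 2 * (2 + |log q₀| + M ^ 3 * R) = R ^ 2 * l ^ 2 * 2 + R ^ 2 * l ^ 2 * B := by
      ring
    rw [s1, s2]
    linarith
  have h2e : 2 * exp (N * (a + κ / D) - 1) ≤ exp (N * (a + κ / D)) := by
    rw [exp_sub, mul_div_assoc', div_le_iff₀ (exp_pos _), mul_comm]
    exact mul_le_mul_of_nonneg_left (by linarith [exp_one_gt_d9]) (exp_pos _).le
  linarith

/-- A clique whose scaled inner products lie in `I` is about as likely as for independent
Gaussian inner products, up to a factor governed by the third power of the conditional mean. -/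
lemma exists_clique_bound {q₀ R κ : ℝ} (hq₀ : 0 < q₀) (hR : 1 ≤ R) (hκ : 0 < κ) :
    ∃ η₀ : ℝ, 0 < η₀ ∧ ∃ D₀ : ℕ, ∀ D : ℕ, D₀ ≤ D → ∀ η : ℝ, 0 < η → η ≤ η₀ →
      ∃ l₀ : ℕ, ∀ l : ℕ, l₀ ≤ l → ∀ r : ℕ, l ≤ r → r ≤ R * l →
        ∀ I J : Set ℝ, MeasurableSet I → MeasurableSet J → q₀ ≤ stdG.real J →
          (∀ θ y : ℝ, |θ - 1| ≤ η → θ * y ∈ I → y ∈ J) →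
          (Measure.pi fun _ : Fin r => sphereUniform (D ^ 2 * l ^ 2)).real
            {x | ∀ i j, i < j → √((D ^ 2 * l ^ 2 : ℕ) : ℝ) * ⟪x i, x j⟫ ∈ I}
          ≤ exp (r.choose 2 * (log (stdG.real J)
            + (∫ y, y ∂(truncG J)) ^ 3 * (r / (D * l)) / 3 + κ / D)) := by
  obtain ⟨K, M, hK, hM, hKM⟩ := exists_isSubG_truncG hq₀
  set Λ := 64 * R ^ 2 * (2 + |log q₀| + M ^ 3 * R) with hΛ
  have hΛ0 : 0 ≤ Λ := by positivity
  obtain ⟨n1, hn1⟩ := exists_nat_ge (192 * K ^ 2 * M ^ 2 * (Λ + R ^ 2 * M ^ 4) / κ)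
  obtain ⟨n2, hn2⟩ := exists_nat_ge (128 * K * Λ)
  refine ⟨min (1 / 2) (κ / (3 * R * M ^ 3)), by positivity, n1 + n2 + 1, fun D hD η hη hη₀ => ?_⟩
  have hη1 : η ≤ 1 / 2 := hη₀.trans (min_le_left _ _)
  have hη2 : η ≤ κ / (3 * R * M ^ 3) := hη₀.trans (min_le_right _ _)
  obtain ⟨k₀, hk₀⟩ := exists_radialWindow_measure_ge (η := η) (β := 1 / 2) hη (by linarith) (by norm_num)
  obtain ⟨n3, hn3⟩ := exists_nat_ge (3 * D * (16 + M ^ 3) / κ)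
  refine ⟨k₀ + n3 + 2, fun l hl r hlr hrR I J hI hJ hqJ hIJ => ?_⟩
  have hDpos : 1 ≤ D := by omega
  have hlpos : 2 ≤ l := by omega
  have hkl : k₀ ≤ D ^ 2 * l ^ 2 := by
    have : l ≤ D ^ 2 * l ^ 2 := by nlinarith [Nat.one_le_pow 2 D hDpos]
    omega
  have hD' : (1 : ℝ) ≤ D := by exact_mod_cast hDpos
  have hDn1 : (n1 : ℝ) ≤ D := by exact_mod_cast (by omega : n1 ≤ D)
  have hDn2 : (n2 : ℝ) ≤ D := by exact_mod_cast (by omega : n2 ≤ D)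
  have hln3 : (n3 : ℝ) ≤ l := by exact_mod_cast (by omega : n3 ≤ l)
  obtain ⟨hμ, hsub⟩ := hKM J hJ hqJ
  have hJ0 : stdG J ≠ 0 := fun h => by
    rw [measureReal_def, h, ENNReal.toReal_zero] at hqJ; linarith
  have hN : 1 / 2 ≤ (stdGaussian (Amb (D ^ 2 * l ^ 2))).real {h | ‖h‖ ∈ radialWindow (D ^ 2 * l ^ 2) η} := by
    have := hk₀ _ hkl; linarith
  have h := measure_clique_le hI hJ hJ0 hη.le (by linarith) hIJ hK hM hμ hsub
    (k := D ^ 2 * l ^ 2) (by positivity) hN (d := Λ / D ^ 2) (by positivity) (by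
      rw [mul_div_assoc', div_le_one (by positivity)]
      nlinarith) r
  refine h.trans ?_
  rw [sqrt_cast_sq_mul_sq]
  have := clique_bound_arith (κ := κ) (K := K) hq₀ hqJ hR hM hμ hη.le (by
    rw [le_div_iff₀ (by positivity)] at hη2; linarith) hΛ hDpos (by
    rw [div_le_iff₀ hκ] at hn1
    nlinarith) hlpos (by
    rw [div_le_iff₀ hκ] at hn3
    nlinarith) hlr hrR
  refine le_trans (le_of_eq ?_) this
  push_cast
  simp only [mul_pow]

/-- The lower tail of the standard Gaussian. -/
def gTail (t : ℝ) : ℝ := stdG.real (Set.Iic (-t))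

/-- The mean of the standard Gaussian above a threshold. -/
def gMean (t : ℝ) : ℝ := ∫ y in Set.Ioi (-t), y ∂stdG

lemma gTail_sub {s t : ℝ} (hst : s ≤ t) : gTail s - gTail t = stdG.real (Set.Ioc (-t) (-s)) := by
  have h : Set.Iic (-s) = Set.Iic (-t) ∪ Set.Ioc (-t) (-s) :=
    (Set.Iic_union_Ioc_eq_Iic (by linarith)).symm
  rw [gTail, gTail, h, measureReal_union (Set.Iic_disjoint_Ioc le_rfl) measurableSet_Ioc]
  ring

lemma gTail_anti {s t : ℝ} (hst : s ≤ t) : gTail t ≤ gTail s := by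
  have := gTail_sub hst
  have h2 : 0 ≤ stdG.real (Set.Ioc (-t) (-s)) := measureReal_nonneg
  linarith

lemma stdG_Ioc_le {a b K : ℝ} (hab : a ≤ b) (hK : 0 ≤ K)
    (h : ∀ y ∈ Set.Ioc a b, exp (-y ^ 2 / 2) ≤ K) : stdG.real (Set.Ioc a b) ≤ K * (b - a) := by
  rw [measureReal_def]
  refine ENNReal.toReal_le_of_le_ofReal (mul_nonneg hK (by linarith)) ?_
  rw [gaussianReal_apply _ (by norm_num), ENNReal.ofReal_mul hK, ← Real.volume_Ioc,
    ← setLIntegral_const]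
  refine setLIntegral_mono' measurableSet_Ioc fun y hy => ?_
  rw [gaussianPDF]
  refine ENNReal.ofReal_le_ofReal ?_
  rw [gaussianPDFReal]
  have h1 : (√(2 * π * ((1 : NNReal) : ℝ)))⁻¹ ≤ 1 := by
    refine inv_le_one_of_one_le₀ ?_
    rw [NNReal.coe_one, one_le_sqrt]
    linarith [pi_gt_three]
  have h2 := h y hy
  calc _ ≤ 1 * exp (-y ^ 2 / 2) := by
        simp only [sub_zero, NNReal.coe_one, mul_one] at h1 ⊢
        gcongr
    _ ≤ K := by linarith

lemma gTail_sub_le {s t : ℝ} (hst : s ≤ t) : gTail s - gTail t ≤ t - s := by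
  rw [gTail_sub hst]
  have := stdG_Ioc_le (a := -t) (b := -s) (K := 1) (by linarith) zero_le_one
    fun y _ => exp_le_one_iff.mpr (by nlinarith [sq_nonneg y])
  linarith

lemma gTail_sub_le_div {s t : ℝ} (hs : 0 < s) (hst : s ≤ t) :
    gTail s - gTail t ≤ (t - s) / s := by
  rw [gTail_sub hst]
  have := stdG_Ioc_le (a := -t) (b := -s) (K := 1 / s) (by linarith) (by positivity)
    fun y hy => by
      have hy' : s ≤ -y := by linarith [hy.2]
      have h1 : s ^ 2 ≤ y ^ 2 := by nlinarith
      have h2 : exp (-y ^ 2 / 2) ≤ exp (-(s ^ 2 / 2)) := exp_le_exp.mpr (by linarith)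
      refine h2.trans ?_
      rw [exp_neg, ← one_div]
      refine one_div_le_one_div_of_le hs ?_
      have := add_one_le_exp (s ^ 2 / 2)
      nlinarith [sq_nonneg (s - 1)]
  refine this.trans (le_of_eq ?_)
  ring

lemma continuous_gTail : Continuous gTail := by
  refine (LipschitzWith.of_le_add fun s t => ?_).continuous (f := gTail)
  rcases le_total s t with h | h
  · have := gTail_sub_le h
    rw [Real.dist_eq]
    linarith [neg_abs_le (s - t)]
  · have := gTail_anti h
    linarith [dist_nonneg (x := s) (y := t)]

lemma exists_gTail_eq {P : ℝ} (h0 : 0 < P) (h1 : P < 1) : ∃ t, gTail t = P := by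
  have hc : ∀ t, gTail t = cdf stdG (-t) := fun t => (cdf_eq_real _ _).symm
  have e0 : ∃ t, gTail t ≤ P := by
    obtain ⟨x, hx⟩ := ((tendsto_cdf_atBot stdG).eventually_lt_const h0).exists
    exact ⟨-x, by rw [hc, neg_neg]; exact hx.le⟩
  have e1 : ∃ t, P ≤ gTail t := by
    obtain ⟨x, hx⟩ := ((tendsto_cdf_atTop stdG).eventually_const_lt h1).exists
    exact ⟨-x, by rw [hc, neg_neg]; exact hx.le⟩
  exact mem_range_of_exists_le_of_exists_ge continuous_gTail e0 e1

lemma integrable_id_stdG : Integrable (fun y : ℝ => y) stdG :=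
  (memLp_id_gaussianReal' (μ := 0) (v := 1) 1 (by simp)).integrable le_rfl

lemma integrable_sq_stdG : Integrable (fun y : ℝ => y ^ 2) stdG :=
  memLp_sq_stdG.integrable (by norm_num)

lemma setIntegral_Iic_stdG (t : ℝ) : ∫ y in Set.Iic (-t), y ∂stdG = -gMean t := by
  have h := integral_add_compl (measurableSet_Iic (a := -t)) integrable_id_stdG
  rw [Set.compl_Iic, integral_id_gaussianReal] at h
  rw [gMean]; linarith

lemma gMean_sub {s t : ℝ} (hst : s ≤ t) :
    gMean t - gMean s = ∫ y in Set.Ioc (-t) (-s), y ∂stdG := by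
  have h := setIntegral_union (μ := stdG) (f := fun y => y) (s := Set.Ioc (-t) (-s))
    (t := Set.Ioi (-s)) Set.Ioc_disjoint_Ioi_same measurableSet_Ioi
    integrable_id_stdG.integrableOn integrable_id_stdG.integrableOn
  rw [Set.Ioc_union_Ioi_eq_Ioi (by linarith)] at h
  rw [gMean, gMean, h]; ring

lemma abs_gMean_sub_le {s t τ : ℝ} (hτ : 0 < τ) (h : |gTail s - gTail t| ≤ τ ^ 2) :
    |gMean s - gMean t| ≤ τ := by
  wlog hst : s ≤ t generalizing s t
  · rw [abs_sub_comm]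
    exact this (by rwa [abs_sub_comm]) (le_of_not_ge hst)
  rw [abs_sub_comm, gMean_sub hst]
  set A := Set.Ioc (-t) (-s)
  have hA : stdG.real A ≤ τ ^ 2 := by rw [← gTail_sub hst]; exact (le_abs_self _).trans h
  have hint : Integrable (fun y : ℝ => τ / 2 * y ^ 2 + 1 / (2 * τ)) (stdG.restrict A) :=
    ((integrable_sq_stdG.const_mul _).add (integrable_const _)).restrict
  calc |∫ y in A, y ∂stdG| ≤ ∫ y in A, |y| ∂stdG := abs_integral_le_integral_abs
    _ ≤ ∫ y in A, (τ / 2 * y ^ 2 + 1 / (2 * τ)) ∂stdG := by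
        refine integral_mono integrable_id_stdG.abs.restrict hint fun y => ?_
        have : τ / 2 * y ^ 2 + 1 / (2 * τ) - |y| = (τ * |y| - 1) ^ 2 / (2 * τ) := by
          rw [← sq_abs y]; field_simp; ring
        have h2 : 0 ≤ (τ * |y| - 1) ^ 2 / (2 * τ) := by positivity
        simp only
        linarith
    _ = τ / 2 * (∫ y in A, y ^ 2 ∂stdG) + stdG.real A * (1 / (2 * τ)) := by
        rw [integral_add (integrable_sq_stdG.const_mul _).restrict (integrable_const _),
          integral_const_mul, integral_const, measureReal_restrict_apply_univ, smul_eq_mul]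
    _ ≤ τ / 2 * 1 + τ ^ 2 * (1 / (2 * τ)) := by
        have : ∫ y in A, y ^ 2 ∂stdG ≤ 1 := by
          rw [← integral_sq_stdG]
          exact setIntegral_le_integral integrable_sq_stdG
            (Filter.Eventually.of_forall fun y => sq_nonneg y)
        gcongr
    _ = τ := by field_simp; norm_num

lemma gMean_pos {t : ℝ} (h0 : 0 < gTail t) (h1 : gTail t < 1) : 0 < gMean t := by
  rcases le_total 0 t with ht | ht
  · have h : 0 < ∫ y in Set.Iic (-t), -y ∂stdG := by
      rw [setIntegral_pos_iff_support_of_nonneg_ae]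
      · have hsub : Set.Iic (-t) \ {0} ⊆ Function.support (fun y : ℝ => -y) ∩ Set.Iic (-t) :=
          fun y hy => ⟨neg_ne_zero.mpr hy.2, hy.1⟩
        refine lt_of_lt_of_le ?_ (measure_mono hsub)
        have := nullSingletonClass_gaussianReal (μ := 0) (v := 1) one_ne_zero
        rw [measure_sdiff_null (measure_singleton _)]
        exact (ENNReal.toReal_pos_iff.mp h0).1
      · refine (ae_restrict_mem measurableSet_Iic).mono fun y hy => ?_
        have : y ≤ -t := hy
        simp only [Pi.zero_apply]; linarith
      · exact integrable_id_stdG.neg.integrableOn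
    rw [integral_neg, setIntegral_Iic_stdG] at h
    linarith
  · rw [gMean, setIntegral_pos_iff_support_of_nonneg_ae]
    · have hsub : Set.Ioi (-t) ⊆ Function.support (fun y : ℝ => y) ∩ Set.Ioi (-t) := fun y hy =>
        ⟨(lt_of_le_of_lt (by linarith) (Set.mem_Ioi.mp hy)).ne', hy⟩
      refine lt_of_lt_of_le ?_ (measure_mono hsub)
      rw [← Set.compl_Iic, pos_iff_ne_zero]
      intro h
      rw [prob_compl_eq_zero_iff measurableSet_Iic] at h
      rw [gTail, measureReal_def, h] at h1
      simp at h1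
    · refine (ae_restrict_mem measurableSet_Ioi).mono fun y hy => ?_
      have : -t < y := hy
      simp only [Pi.zero_apply]; linarith
    · exact integrable_id_stdG.integrableOn

lemma stdG_real_Ioi (t : ℝ) : stdG.real (Set.Ioi (-t)) = 1 - gTail t := by
  rw [← Set.compl_Iic, probReal_compl_eq_one_sub measurableSet_Iic, gTail]

lemma integral_truncG (J : Set ℝ) :
    ∫ y, y ∂(truncG J) = (∫ y in J, y ∂stdG) / stdG.real J := by
  rw [truncG, ProbabilityTheory.cond, integral_smul_measure, smul_eq_mul, ENNReal.toReal_inv, measureReal_def]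
  ring

lemma integral_truncG_Iic (t : ℝ) : ∫ y, y ∂(truncG (Set.Iic (-t))) = -(gMean t / gTail t) := by
  rw [integral_truncG, setIntegral_Iic_stdG, gTail, neg_div]

lemma integral_truncG_Ioi (t : ℝ) : ∫ y, y ∂(truncG (Set.Ioi (-t))) = gMean t / (1 - gTail t) := by
  rw [integral_truncG, stdG_real_Ioi, gMean]

lemma map_inner_stdGaussian_unit {k : ℕ} {e : Amb k} (he : ‖e‖ = 1) :
    (stdGaussian (Amb k)).map (fun h => ⟪h, e⟫) = stdG := by
  apply Measure.ext_of_charFun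
  ext t
  have h1 : charFun ((stdGaussian (Amb k)).map fun h => ⟪h, e⟫) t
      = charFun (stdGaussian (Amb k)) (t • e) := by
    rw [charFun_apply, charFun_apply, integral_map (by fun_prop) (by fun_prop)]
    congr 1; ext h
    congr 3
    simp [inner_smul_right]
  rw [h1, charFun_stdGaussian, charFun_gaussianReal, norm_smul, he, mul_one, norm_eq_abs,
    ← Complex.ofReal_pow, sq_abs]
  congr 1
  simp
  ring

lemma le_of_scaled_le {c η θ y : ℝ} (hc : 0 ≤ c) (hη : η ≤ 1 / 2)
    (hθ : |θ - 1| ≤ η) (h : θ * y ≤ -c) : y ≤ -(c * (1 - η)) := by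
  obtain ⟨ha, hb⟩ := abs_le.mp hθ
  by_contra! hlt
  have h1 := mul_lt_mul_of_pos_left hlt (by linarith : 0 < θ)
  have h2 : θ * (c * (1 - η)) ≤ (1 + η) * (c * (1 - η)) :=
    mul_le_mul_of_nonneg_right (by linarith) (mul_nonneg hc (by linarith))
  nlinarith [mul_nonneg hc (sq_nonneg η)]

lemma scaled_le_of_le {c η θ y : ℝ} (hc : 0 ≤ c) (hη0 : 0 ≤ η) (hη : η ≤ 1 / 2)
    (hθ : |θ - 1| ≤ η) (h : y ≤ -(c * (1 + 2 * η))) : θ * y ≤ -c := by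
  obtain ⟨ha, hb⟩ := abs_le.mp hθ
  have h1 := mul_le_mul_of_nonneg_left h (by linarith : 0 ≤ θ)
  have h2 : (1 - η) * (c * (1 + 2 * η)) ≤ θ * (c * (1 + 2 * η)) :=
    mul_le_mul_of_nonneg_right (by linarith) (by positivity)
  nlinarith [mul_nonneg (mul_nonneg hc hη0) (by linarith : 0 ≤ 1 - 2 * η)]

/-- The threshold of a cap of measure `p` is close to the Gaussian quantile. -/
lemma gTail_of_isCkp {k : ℕ} {p c η β : ℝ} (hk : 0 < k) (hp0 : 0 ≤ p) (hp1 : p ≤ 1)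
    (hc : IsCkp k p c) (hη0 : 0 ≤ η) (hη : η ≤ 1 / 2)
    (hN : 1 - β ≤ (stdGaussian (Amb k)).real {h | ‖h‖ ∈ radialWindow k η}) :
    p - β ≤ gTail (c * (1 - η)) ∧ gTail (c * (1 + 2 * η)) ≤ p + β := by
  obtain ⟨hc0, hcp⟩ := hc
  have hk' : 0 < √(k : ℝ) := sqrt_pos.mpr (by exact_mod_cast hk)
  set e : Amb k := EuclideanSpace.single 0 1
  have he : ‖e‖ = 1 := by simp [e]
  have hcp := hcp e he
  set E : Set (Amb k) := {x | ⟪x, e⟫ ≤ -c / √k}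
  have hE : MeasurableSet E := measurableSet_le (by fun_prop) measurable_const
  set W : Set (Amb k) := {h | ‖h‖ ∈ radialWindow k η}
  have hW : MeasurableSet W := (measurableSet_radialWindow k η).preimage measurable_norm
  have hE' : MeasurableSet {h : Amb k | ‖h‖⁻¹ • h ∈ E} := hE.preimage (by fun_prop)
  have hmul := lintegral_sphereUniform_mul k (f := E.indicator 1)
    (measurable_one.indicator hE) (measurableSet_radialWindow k η)
  have e1 : (fun h : Amb k => E.indicator (1 : Amb k → ℝ≥0∞) (‖h‖⁻¹ • h))
      = {h : Amb k | ‖h‖⁻¹ • h ∈ E}.indicator 1 := by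
    ext h; simp [Set.indicator]
  rw [lintegral_indicator_one hE, hcp, e1, lintegral_indicator_one hE',
    Measure.restrict_apply hE'] at hmul
  have hreal : p * (stdGaussian (Amb k)).real W
      = (stdGaussian (Amb k)).real ({h : Amb k | ‖h‖⁻¹ • h ∈ E} ∩ W) := by
    rw [measureReal_def, measureReal_def, ← hmul, ENNReal.toReal_mul, ENNReal.toReal_ofReal hp0]
  have htail : ∀ t, gTail t = (stdGaussian (Amb k)).real {h | ⟪h, e⟫ ≤ -t} := fun t => by
    rw [gTail, ← map_inner_stdGaussian_unit he, map_measureReal_apply (by fun_prop) measurableSet_Iic]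
    rfl
  have hmem : ∀ h : Amb k, h ∈ W → (‖h‖⁻¹ • h ∈ E ↔ √k / ‖h‖ * ⟪h, e⟫ ≤ -c) := by
    intro h _
    change ⟪‖h‖⁻¹ • h, e⟫ ≤ -c / √k ↔ _
    rw [le_div_iff₀ hk', inner_smul_left, conj_trivial,
      show ‖h‖⁻¹ * ⟪h, e⟫ * √k = √k / ‖h‖ * ⟪h, e⟫ by ring]
  have hw1 : (stdGaussian (Amb k)).real W ≤ 1 := measureReal_le_one
  have hβ : 0 ≤ β := by linarith
  constructor
  · have hsub : {h : Amb k | ‖h‖⁻¹ • h ∈ E} ∩ W ⊆ {h | ⟪h, e⟫ ≤ -(c * (1 - η))} := by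
      rintro h ⟨h1, h2⟩
      have h3 := (hmem h h2).mp h1
      obtain ⟨hpos, hθ⟩ := h2
      exact le_of_scaled_le hc0 hη hθ h3
    have := measureReal_mono (μ := stdGaussian (Amb k)) hsub
    rw [← hreal, ← htail] at this
    nlinarith
  · have hsub : {h : Amb k | ⟪h, e⟫ ≤ -(c * (1 + 2 * η))} ⊆
        ({h : Amb k | ‖h‖⁻¹ • h ∈ E} ∩ W) ∪ Wᶜ := by
      intro h h1
      by_cases h2 : h ∈ W
      · refine Or.inl ⟨(hmem h h2).mpr ?_, h2⟩
        obtain ⟨hpos, hθ⟩ := h2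
        exact scaled_le_of_le hc0 hη0 hη hθ h1
      · exact Or.inr h2
    have := (measureReal_mono (μ := stdGaussian (Amb k)) hsub).trans (measureReal_union_le _ _)
    rw [← hreal, ← htail, probReal_compl_eq_one_sub hW] at this
    nlinarith

lemma gTail_approx_of_isCkp {k : ℕ} {p c η β : ℝ} (hk : 0 < k) (hp0 : 0 ≤ p) (hp1 : p ≤ 1)
    (hc : IsCkp k p c) (hη0 : 0 ≤ η) (hη : η ≤ 1 / 2)
    (hN : 1 - β ≤ (stdGaussian (Amb k)).real {h | ‖h‖ ∈ radialWindow k η}) :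
    |gTail (c * (1 - η)) - p| ≤ β + 6 * η ∧ |gTail (c * (1 + 2 * η)) - p| ≤ β + 6 * η := by
  obtain ⟨h1, h2⟩ := gTail_of_isCkp hk hp0 hp1 hc hη0 hη hN
  have hc0 := hc.1
  have h3 : gTail (c * (1 - η)) - gTail (c * (1 + 2 * η)) ≤ 6 * η := by
    rcases hc0.eq_or_lt with h | h
    · rw [← h]; simpa using hη0
    · have hs : 0 < c * (1 - η) := mul_pos h (by linarith)
      refine (gTail_sub_le_div hs (mul_le_mul_of_nonneg_left (by linarith) hc0)).trans ?_
      rw [div_le_iff₀ hs]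
      nlinarith [mul_nonneg (mul_nonneg hc0 hη0) (by linarith : 0 ≤ 1 - 2 * η)]
  have h4 : gTail (c * (1 + 2 * η)) ≤ gTail (c * (1 - η)) :=
    gTail_anti (mul_le_mul_of_nonneg_left (by linarith) hc0)
  constructor <;> rw [abs_le] <;> constructor <;> linarith

lemma sq_mul_lt_of_isPC {C P : ℝ} (h : IsPC C P) : C * P ^ 2 < (1 - P) ^ 2 := by
  obtain ⟨⟨h0, h1⟩, hC⟩ := h
  have hQ : log (1 - P) < -P := by
    have := log_lt_sub_one_of_pos (by linarith : 0 < 1 - P) (by linarith)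
    linarith
  have hlog : log (1 - P) - log P ≤ (1 - P) / P - 1 := by
    rw [← log_div (by linarith) h0.ne']
    exact log_le_sub_one_of_pos (div_pos (by linarith) h0)
  have h2 : P ^ 2 * (log (1 - P) - log P) ≤ P * (1 - 2 * P) := by
    refine (mul_le_mul_of_nonneg_left hlog (sq_nonneg P)).trans (le_of_eq ?_)
    field_simp
    ring
  have h3 : (1 - 2 * P) * P < (1 - 2 * P) * -log (1 - P) :=
    mul_lt_mul_of_pos_left (by linarith) (by linarith)
  rw [hC, div_mul_eq_mul_div, div_lt_iff_of_neg (by linarith)]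
  linarith

lemma exists_clique_params {C P φ : ℝ} (h0 : 0 < P) (h1 : P < 1 / 2) (hφ : 0 < φ) (hC : 0 < C)
    (hCP : C * P ^ 2 < (1 - P) ^ 2) :
    ∃ δ κ : ℝ, 0 < δ ∧ 0 < κ ∧ κ < φ ∧ κ < P / 2 ∧ κ < 1 / 2 - P ∧
      (δ + κ) / P + (-((φ - κ) / (P + κ)) ^ 3 / 3 + κ) + 2 * κ / P ≤ 0 ∧
      (-δ + κ) / (1 - P) + (((φ + κ) / (1 - P - κ)) ^ 3 * (C + κ) / 3 + κ) + 2 * κ / (1 - P) ≤ 0 := by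
  have hQ : 0 < 1 - P := by linarith
  set a := C * φ ^ 3 / (3 * (1 - P) ^ 2)
  set b := φ ^ 3 / (3 * P ^ 2)
  have hab : a < b := by
    rw [div_lt_div_iff₀ (by positivity) (by positivity)]
    have := mul_lt_mul_of_pos_left hCP (by positivity : 0 < 3 * φ ^ 3)
    linarith
  have ha : 0 < a := by positivity
  obtain ⟨δ, hδa, hδb⟩ := exists_between hab
  have e1 : Filter.Tendsto
      (fun κ : ℝ => (δ + κ) / P + (-((φ - κ) / (P + κ)) ^ 3 / 3 + κ) + 2 * κ / P) (nhds 0)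
      (nhds ((δ + 0) / P + (-((φ - 0) / (P + 0)) ^ 3 / 3 + 0) + 2 * 0 / P)) := by
    refine ContinuousAt.tendsto (f := fun κ : ℝ =>
      (δ + κ) / P + (-((φ - κ) / (P + κ)) ^ 3 / 3 + κ) + 2 * κ / P) ?_
    fun_prop (disch := simp; linarith)
  have e2 : Filter.Tendsto
      (fun κ : ℝ => (-δ + κ) / (1 - P) + (((φ + κ) / (1 - P - κ)) ^ 3 * (C + κ) / 3 + κ)
        + 2 * κ / (1 - P)) (nhds 0)
      (nhds ((-δ + 0) / (1 - P) + (((φ + 0) / (1 - P - 0)) ^ 3 * (C + 0) / 3 + 0)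
        + 2 * 0 / (1 - P))) := by
    refine ContinuousAt.tendsto (f := fun κ : ℝ =>
      (-δ + κ) / (1 - P) + (((φ + κ) / (1 - P - κ)) ^ 3 * (C + κ) / 3 + κ)
        + 2 * κ / (1 - P)) ?_
    fun_prop (disch := simp; linarith)
  have n1 : (δ + 0) / P + (-((φ - 0) / (P + 0)) ^ 3 / 3 + 0) + 2 * 0 / P < 0 := by
    have : (δ + 0) / P + (-((φ - 0) / (P + 0)) ^ 3 / 3 + 0) + 2 * 0 / P = (δ - b) / P := by
      simp only [b]; field_simp; ring
    rw [this]
    exact div_neg_of_neg_of_pos (by linarith) h0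
  have n2 : (-δ + 0) / (1 - P) + (((φ + 0) / (1 - P - 0)) ^ 3 * (C + 0) / 3 + 0)
        + 2 * 0 / (1 - P) < 0 := by
    have : (-δ + 0) / (1 - P) + (((φ + 0) / (1 - P - 0)) ^ 3 * (C + 0) / 3 + 0)
        + 2 * 0 / (1 - P) = (a - δ) / (1 - P) := by
      have hQ0 := hQ.ne'
      simp only [a, add_zero, sub_zero, mul_zero, zero_div]
      clear_value a
      generalize 1 - P = Q at hQ0
      field_simp
      ring
    rw [this]
    exact div_neg_of_neg_of_pos (by linarith) hQ
  have hev := ((e1.eventually_lt_const n1).and (e2.eventually_lt_const n2)).filter_mono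
    (nhdsWithin_le_nhds (s := Set.Ioi 0))
  have hm : 0 < min φ (min (P / 2) (1 / 2 - P)) :=
    lt_min hφ (lt_min (by linarith) (by linarith))
  obtain ⟨κ, ⟨hκ1, hκ2⟩, hκ0, hκm⟩ := (hev.and (Ioo_mem_nhdsGT hm)).exists
  rw [lt_min_iff, lt_min_iff] at hκm
  exact ⟨δ, κ, ha.trans hδa, hκ0, hκm.1, hκm.2.1, hκm.2.2, hκ1.le, hκ2.le⟩

/-- Exponentiating a per-pair bound. -/
lemma exp_mul_log_add_le {q x u v A B D : ℝ} {N : ℕ} (hq : 0 < q) (hx : 0 < x) (hD : 0 < D)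
    (hqx : q ≤ x + u / D) (hv0 : 0 ≤ v) (hv : v / D ≤ x / 2) (hB : B ≤ A / D)
    (hA : u / x + A + 2 * v / x ≤ 0) : exp (N * (log q + B)) ≤ (x - v / D) ^ N := by
  have hvD : 0 ≤ v / D := by positivity
  have hpos : 0 < x - v / D := by linarith
  have h1 : log q ≤ log x + u / x / D := by
    have h := log_le_sub_one_of_pos (div_pos hq hx)
    rw [log_div hq.ne' hx.ne'] at h
    have h2 : q / x - 1 ≤ u / x / D := by
      rw [div_div, mul_comm x D, ← div_div, sub_le_iff_le_add, div_le_iff₀ hx]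
      field_simp at hqx ⊢
      linarith
    linarith
  have h2 : log x - 2 * v / x / D ≤ log (x - v / D) := by
    have h := log_le_sub_one_of_pos (div_pos hx hpos)
    rw [log_div hx.ne' hpos.ne'] at h
    have h3 : x / (x - v / D) - 1 ≤ 2 * v / x / D := by
      have e : x / (x - v / D) - 1 = (v / D) / (x - v / D) := by
        rw [div_sub_one hpos.ne']; ring
      have e' : 2 * v / x / D = (v / D) / (x / 2) := by field_simp
      rw [e, e']
      exact div_le_div_of_nonneg_left hvD (by linarith) (by linarith)
    linarith
  have h3 : log q + B ≤ log (x - v / D) := by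
    have h4 : u / x / D + A / D + 2 * v / x / D ≤ 0 := by
      rw [← add_div, ← add_div]
      exact div_nonpos_of_nonpos_of_nonneg hA hD.le
    linarith
  calc exp (N * (log q + B)) ≤ exp (N * log (x - v / D)) :=
        exp_le_exp.mpr (mul_le_mul_of_nonneg_left h3 (Nat.cast_nonneg _))
    _ = (x - v / D) ^ N := by rw [mul_comm, exp_mul, exp_log hpos, rpow_natCast]

/-!
Statement 1 (Theorem 2 of the paper): for every `C > 1` there are `ε0 > 0` and `D0`
such that for every `D ≥ D0` there is `ℓ0` such that for all `ℓ ≥ ℓ0`, with `k = D²ℓ²`,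
there is `p ∈ (p_C, 1/2)` for which the monochromatic clique probabilities of the
random sphere graph satisfy the stated bounds.
-/

set_option maxHeartbeats 1000000 in
theorem thm2 (C : ℝ) (hC : 1 < C) (pC : ℝ) (hpC : IsPC C pC) :
    ∃ ε0 : ℝ, 0 < ε0 ∧ ∃ D0 : ℕ, ∀ D : ℕ, D0 ≤ D → ∃ ℓ0 : ℕ, ∀ ℓ : ℕ, ℓ0 ≤ ℓ →
      ∀ k : ℕ, k = D ^ 2 * ℓ ^ 2 →
        ∃ p : ℝ, p ∈ Set.Ioo pC (1 / 2) ∧ ∀ c : ℝ, IsCkp k p c →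
          ((Measure.pi fun _ : Fin ℓ => sphereUniform k)
              {x | ∀ i j : Fin ℓ, i < j → ⟪x i, x j⟫ ≤ -c / Real.sqrt k}).toReal
            ≤ (pC - ε0 * ℓ / Real.sqrt k) ^ ℓ.choose 2 ∧
          ((Measure.pi fun _ : Fin ⌈C * (ℓ : ℝ)⌉₊ => sphereUniform k)
              {x | ∀ i j : Fin ⌈C * (ℓ : ℝ)⌉₊, i < j → -c / Real.sqrt k < ⟪x i, x j⟫}).toReal
            ≤ (1 - pC - ε0 * ℓ / Real.sqrt k) ^ (⌈C * (ℓ : ℝ)⌉₊).choose 2 := by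
  have hlt := sq_mul_lt_of_isPC hpC
  obtain ⟨⟨hP0, hP1⟩, -⟩ := hpC
  obtain ⟨t₀, ht₀⟩ := exists_gTail_eq hP0 (by linarith)
  set φ := gMean t₀
  have hφ : 0 < φ := gMean_pos (by linarith) (by linarith)
  obtain ⟨δ, κ, hδ, hκ, hκφ, hκP, hκP', hred, hblue⟩ :=
    exists_clique_params hP0 hP1 hφ (by linarith) hlt
  obtain ⟨η₀, hη₀, D₀, hcl⟩ := exists_clique_bound (q₀ := pC / 2) (R := C + 1) (by linarith)
    (by linarith) hκ
  obtain ⟨n₁, hn₁⟩ := exists_nat_ge ((δ + κ) / κ ^ 2)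
  obtain ⟨n₂, hn₂⟩ := exists_nat_ge ((δ + κ) / κ)
  refine ⟨κ, hκ, D₀ + n₁ + n₂ + 1, fun D hD => ?_⟩
  have hD1 : (1 : ℝ) ≤ D := by exact_mod_cast (by omega : 1 ≤ D)
  have hDn₁ : (n₁ : ℝ) ≤ D := by exact_mod_cast (by omega : n₁ ≤ D)
  have hDn₂ : (n₂ : ℝ) ≤ D := by exact_mod_cast (by omega : n₂ ≤ D)
  have hD0 : (0 : ℝ) < D := by linarith
  have hsmall₁ : (δ + κ) / D ≤ κ ^ 2 := by
    rw [div_le_iff₀ (by positivity)] at hn₁ ⊢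
    nlinarith [sq_nonneg κ]
  have hsmall₂ : (δ + κ) / D ≤ κ := by
    rw [div_le_iff₀ (by positivity)] at hn₂ ⊢
    nlinarith
  have hκD : 0 < κ / D := by positivity
  have hδD : 0 < δ / D := by positivity
  rw [add_div] at hsmall₁ hsmall₂
  set η := min η₀ (min (1 / 2) (κ / (12 * D)))
  have hη : 0 < η := by positivity
  have hη1 : η ≤ 1 / 2 := (min_le_right _ _).trans (min_le_left _ _)
  have hη2 : η ≤ κ / D / 12 :=
    ((min_le_right _ _).trans (min_le_right _ _)).trans (le_of_eq (by ring))
  have hη3 : η ≤ η₀ := min_le_left _ _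
  clear_value η
  obtain ⟨l₀, hl₀⟩ := hcl D (by omega) η hη hη3
  obtain ⟨k₀, hk₀⟩ := exists_radialWindow_measure_ge hη (by linarith : η < 1)
    (by positivity : 0 < κ / D / 2)
  obtain ⟨n₃, hn₃⟩ := exists_nat_ge (1 / κ)
  refine ⟨l₀ + k₀ + n₃ + 1, fun ℓ hℓ k hk => ⟨pC + δ / D, ⟨by linarith, by linarith⟩, ?_⟩⟩
  subst hk
  intro c hc
  have hℓ1 : (1 : ℝ) ≤ ℓ := by exact_mod_cast (by omega : 1 ≤ ℓ)
  have hℓn : (n₃ : ℝ) ≤ ℓ := by exact_mod_cast (by omega : n₃ ≤ ℓ)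
  have hℓκ : 1 ≤ κ * ℓ := by
    rw [div_le_iff₀ hκ] at hn₃
    nlinarith
  have hDnat : 1 ≤ D := by omega
  have hkpos : 0 < D ^ 2 * ℓ ^ 2 := Nat.mul_pos (by positivity) (pow_pos (by omega) 2)
  have hkk : k₀ ≤ D ^ 2 * ℓ ^ 2 := by
    have : ℓ ≤ D ^ 2 * ℓ ^ 2 := by nlinarith [Nat.one_le_pow 2 D hDnat, (by omega : 1 ≤ ℓ)]
    omega
  have hc0 := hc.1
  obtain ⟨hs, ht⟩ := gTail_approx_of_isCkp hkpos (by linarith) (by linarith) hc hη.le hη1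
    (hk₀ _ hkk)
  have hclose : ∀ s, |gTail s - (pC + δ / D)| ≤ κ / D / 2 + 6 * η →
      |gTail s - (pC + δ / D)| ≤ κ / D ∧ |gTail s - pC| ≤ κ ∧ |gMean s - φ| ≤ κ := by
    intro s hs
    have h1 : |gTail s - (pC + δ / D)| ≤ κ / D := by linarith
    have h2 : |gTail s - pC| ≤ δ / D + κ / D := by
      rw [abs_le] at h1 ⊢; constructor <;> linarith
    exact ⟨h1, by linarith, abs_gMean_sub_le hκ (by rw [ht₀]; linarith)⟩
  obtain ⟨hs1, hs2, hs3⟩ := hclose _ hs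
  obtain ⟨ht1, ht2, ht3⟩ := hclose _ ht
  rw [abs_le] at hs1 hs2 hs3 ht1 ht2 ht3
  have hsqrt := sqrt_cast_sq_mul_sq D ℓ
  have hsq0 : 0 < √((D ^ 2 * ℓ ^ 2 : ℕ) : ℝ) := by rw [hsqrt]; positivity
  have hε : κ * ℓ / √((D ^ 2 * ℓ ^ 2 : ℕ) : ℝ) = κ / D := by
    rw [hsqrt]; field_simp
  rw [hε]
  have hκD1 : κ / D ≤ κ := div_le_self hκ.le hD1
  clear_value φ
  clear hclose hsmall₁ hsmall₂ hn₁ hn₂ hn₃ hDn₁ hDn₂ hD hδD hk₀ hkk hkpos hη3 hη2 hη₀ hs ht hlt hε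
    hc hδ hcl
  constructor
  · have h := hl₀ ℓ (by omega) ℓ le_rfl (by nlinarith) (Set.Iic (-c))
      (Set.Iic (-(c * (1 - η)))) measurableSet_Iic measurableSet_Iic
      (by change _ ≤ gTail _; linarith)
      fun θ y hθ hy => le_of_scaled_le hc0 hη1 hθ hy
    rw [integral_truncG_Iic, ← gTail] at h
    have hset : {x : Fin ℓ → Amb (D ^ 2 * ℓ ^ 2) | ∀ i j : Fin ℓ, i < j →
          ⟪x i, x j⟫ ≤ -c / √((D ^ 2 * ℓ ^ 2 : ℕ) : ℝ)}
        = {x | ∀ i j, i < j → √((D ^ 2 * ℓ ^ 2 : ℕ) : ℝ) * ⟪x i, x j⟫ ∈ Set.Iic (-c)} := by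
      ext x
      refine forall_congr' fun i => forall_congr' fun j => imp_congr_right fun _ => ?_
      rw [le_div_iff₀ hsq0, mul_comm, Set.mem_Iic]
    rw [hset]
    refine h.trans ?_
    rw [add_assoc]
    refine exp_mul_log_add_le (u := δ + κ)
      (A := -((φ - κ) / (pC + κ)) ^ 3 / 3 + κ) (by linarith) hP0 hD0 ?_ hκ.le (by linarith) ?_ hred
    · rw [add_div]; linarith
    · have hratio : (φ - κ) / (pC + κ) ≤ gMean (c * (1 - η)) / gTail (c * (1 - η)) :=
        div_le_div₀ (by linarith) (by linarith) (by linarith) (by linarith)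
      have h3 := pow_le_pow_left₀ (div_nonneg (by linarith) (by linarith)) hratio 3
      have e : (ℓ : ℝ) / (D * ℓ) = 1 / D := by field_simp
      rw [e, mul_one_div, div_div, mul_comm (D : ℝ) 3, ← div_div, ← add_div]
      refine div_le_div_of_nonneg_right ?_ hD0.le
      rw [Odd.neg_pow (by decide)]
      linarith
  · set r := ⌈C * (ℓ : ℝ)⌉₊ with hr
    have hr1 : C * ℓ ≤ r := Nat.le_ceil _
    have hr2 : (r : ℝ) < C * ℓ + 1 := Nat.ceil_lt_add_one (by positivity)
    have hℓr : ℓ ≤ r := by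
      have : (ℓ : ℝ) ≤ r := by nlinarith
      exact_mod_cast this
    have h := hl₀ ℓ (by omega) r hℓr (by nlinarith) (Set.Ioi (-c))
      (Set.Ioi (-(c * (1 + 2 * η)))) measurableSet_Ioi measurableSet_Ioi
      (by rw [stdG_real_Ioi]; linarith)
      fun θ y hθ hy => by
        by_contra hcon
        exact absurd (scaled_le_of_le hc0 hη.le hη1 hθ (not_lt.mp hcon)) (not_le.mpr hy)
    rw [integral_truncG_Ioi, stdG_real_Ioi] at h
    have hset : {x : Fin r → Amb (D ^ 2 * ℓ ^ 2) | ∀ i j : Fin r, i < j →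
          -c / √((D ^ 2 * ℓ ^ 2 : ℕ) : ℝ) < ⟪x i, x j⟫}
        = {x | ∀ i j, i < j → √((D ^ 2 * ℓ ^ 2 : ℕ) : ℝ) * ⟪x i, x j⟫ ∈ Set.Ioi (-c)} := by
      ext x
      refine forall_congr' fun i => forall_congr' fun j => imp_congr_right fun _ => ?_
      rw [div_lt_iff₀ hsq0, mul_comm, Set.mem_Ioi]
    rw [hset]
    refine h.trans ?_
    rw [add_assoc]
    refine exp_mul_log_add_le (u := -δ + κ)
      (A := ((φ + κ) / (1 - pC - κ)) ^ 3 * (C + κ) / 3 + κ) (by linarith) (by linarith) hD0 ?_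
      hκ.le (by linarith) ?_ hblue
    · rw [add_div, neg_div]; linarith
    · have hratio : gMean (c * (1 + 2 * η)) / (1 - gTail (c * (1 + 2 * η)))
          ≤ (φ + κ) / (1 - pC - κ) :=
        div_le_div₀ (by linarith) (by linarith) (by linarith) (by linarith)
      have h3 := pow_le_pow_left₀ (div_nonneg (by linarith) (by linarith)) hratio 3
      have e : (r : ℝ) / (D * ℓ) ≤ (C + κ) / D := by
        rw [div_le_div_iff₀ (by positivity) hD0]
        have : (r : ℝ) ≤ (C + κ) * ℓ := by linarith
        nlinarith
      rw [add_div]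
      refine add_le_add ?_ le_rfl
      calc _ ≤ ((φ + κ) / (1 - pC - κ)) ^ 3 * ((C + κ) / D) / 3 := by
            have : 0 ≤ (φ + κ) / (1 - pC - κ) := div_nonneg (by linarith) (by linarith)
            gcongr
        _ = _ := by ring
end
end

section
/- Fix p ∈ (0, 1/2). There exist a constant K > 0 and k0 ∈ ℕ such that for every integer k ≥ k0, the constant c_{k,p} satisfies |c_{k,p} − Φ^{−1}(1 − p)| ≤ K/k. In particular c_{k,p} → Φ^{−1}(1 − p) as k → ∞. -/
open MeasureTheory Real
open scoped ENNReal RealInnerProductSpace BigOperators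

noncomputable section

/-- The standard normal cumulative distribution function `Φ`. -/
def stdGaussianCDF (x : ℝ) : ℝ :=
  (Real.sqrt (2 * Real.pi))⁻¹ * ∫ t in Set.Iic x, Real.exp (-t ^ 2 / 2)

open ProbabilityTheory

/-- A measure with radial density splits on cones as surface measure times a radial factor. -/
lemma withDensity_norm_apply_cone {E : Type*} [NormedAddCommGroup E] [NormedSpace ℝ E]
    [MeasurableSpace E] [BorelSpace E] [FiniteDimensional ℝ E] [Nontrivial E]
    (μ : Measure E) [μ.IsAddHaarMeasure] {g : ℝ → ℝ≥0∞} (hg : Measurable g) {A : Set E}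
    (hA : MeasurableSet A) (hcone : ∀ r : ℝ, 0 < r → ∀ x, r • x ∈ A ↔ x ∈ A) :
    μ.withDensity (fun x ↦ g ‖x‖) A = μ.toSphere (Subtype.val ⁻¹' A) *
      ∫⁻ r : Set.Ioi (0 : ℝ), g r ∂(Measure.volumeIoiPow (Module.finrank ℝ E - 1)) := by
  have hpre : MeasurableSet ((Subtype.val : Metric.sphere (0 : E) 1 → E) ⁻¹' A) :=
    measurable_subtype_coe hA
  have key := (μ.measurePreserving_homeomorphUnitSphereProd).lintegral_comp_emb
    (Homeomorph.measurableEmbedding _)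
    (fun z ↦ ((Subtype.val : Metric.sphere (0 : E) 1 → E) ⁻¹' A).indicator 1 z.1 * g z.2.1)
  rw [lintegral_prod_mul (f := (Subtype.val ⁻¹' A).indicator 1)
    (g := fun r : Set.Ioi (0 : ℝ) ↦ g r) (measurable_one.indicator hpre).aemeasurable
    (hg.comp measurable_subtype_coe).aemeasurable, lintegral_indicator_one hpre] at key
  rw [← key, withDensity_apply _ hA, ← lintegral_indicator hA]
  nth_rewrite 1 [← restrict_compl_singleton (μ := μ) 0]
  rw [← lintegral_subtype_comap (measurableSet_singleton _).compl]
  refine lintegral_congr fun x ↦ ?_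
  have hx : 0 < ‖(x : E)‖⁻¹ := inv_pos.2 (norm_pos_iff.2 x.2)
  by_cases h : (x : E) ∈ A
  · have h' := (hcone _ hx x).2 h
    simp [Set.indicator, h, h']
  · have h' := (hcone _ hx x).not.2 h
    simp [Set.indicator, h, h']

lemma pi_gaussianReal_eq_withDensity (ι : Type*) [Fintype ι] :
    Measure.pi (fun _ : ι ↦ gaussianReal 0 1) =
      volume.withDensity (fun x ↦ ENNReal.ofReal (∏ i, gaussianPDFReal 0 1 (x i))) := by
  refine Measure.pi_eq fun s hs ↦ ?_
  rw [withDensity_apply _ (MeasurableSet.univ_pi hs), volume_pi, Measure.restrict_pi_pi,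
    ← ofReal_integral_eq_lintegral_ofReal, integral_fintype_prod_eq_prod,
    ENNReal.ofReal_prod_of_nonneg]
  · exact Finset.prod_congr rfl fun i _ ↦ (gaussianReal_apply_eq_integral 0 one_ne_zero _).symm
  · exact fun i _ ↦ integral_nonneg fun x ↦ gaussianPDFReal_nonneg _ _ _
  · exact Integrable.fintype_prod fun i ↦ (integrable_gaussianPDFReal 0 1).integrableOn
  · exact .of_forall fun x ↦ Finset.prod_nonneg fun i _ ↦ gaussianPDFReal_nonneg _ _ _

lemma stdGaussian_eq_withDensity_norm (ι : Type*) [Fintype ι] :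
    stdGaussian (EuclideanSpace ℝ ι) = volume.withDensity (fun x ↦
      ENNReal.ofReal ((√(2 * π))⁻¹ ^ Fintype.card ι * rexp (-‖x‖ ^ 2 / 2))) := by
  rw [← map_pi_eq_stdGaussian, pi_gaussianReal_eq_withDensity]
  have hmp := PiLp.volume_preserving_toLp ι
  ext s hs
  rw [Measure.map_apply hmp.measurable hs, withDensity_apply _ (hmp.measurable hs),
    withDensity_apply _ hs, ← hmp.setLIntegral_comp_preimage hs (by fun_prop)]
  refine lintegral_congr fun x ↦ ?_
  congr 1
  simp only [gaussianPDFReal, Finset.prod_mul_distrib, ← Real.exp_sum,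
    EuclideanSpace.real_norm_sq_eq]
  simp [Finset.sum_div, neg_div]

/-- The uniform measure of a cap is the standard Gaussian measure of the cone over it. -/
lemma sphereUniform_cap_eq_stdGaussian (k : ℕ) (e : Amb k) (s : ℝ) :
    sphereUniform k {x | ⟪x, e⟫ ≤ s} = stdGaussian (Amb k) {x | ⟪x, e⟫ ≤ s * ‖x‖} := by
  set g : ℝ → ℝ≥0∞ := fun r ↦
    ENNReal.ofReal ((√(2 * π))⁻¹ ^ Fintype.card (Fin (k + 1)) * rexp (-r ^ 2 / 2)) with hg
  have hgm : Measurable g := by fun_prop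
  have hA : MeasurableSet {x : Amb k | ⟪x, e⟫ ≤ s * ‖x‖} :=
    measurableSet_le (by fun_prop) (by fun_prop)
  have hd : stdGaussian (Amb k) = volume.withDensity (fun x ↦ g ‖x‖) :=
    stdGaussian_eq_withDensity_norm _
  have h1 := withDensity_norm_apply_cone (volume : Measure (Amb k)) hgm MeasurableSet.univ
    (by simp)
  have h2 := withDensity_norm_apply_cone (volume : Measure (Amb k)) hgm hA (by
    intro r hr x
    simp only [Set.mem_ofPred_eq, inner_smul_left, norm_smul, Real.norm_eq_abs, abs_of_pos hr]
    rw [mul_left_comm]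
    exact mul_le_mul_iff_right₀ hr)
  rw [← hd] at h1 h2
  rw [measure_univ, Set.preimage_univ] at h1
  have h0 : (volume : Measure (Amb k)).toSphere Set.univ ≠ 0 := by
    intro h
    simp [h] at h1
  rw [h2, ENNReal.eq_inv_of_mul_eq_one_left ((mul_comm _ _).trans h1.symm)]
  have hpre : (Subtype.val : Metric.sphere (0 : Amb k) 1 → Amb k) ⁻¹' {x | ⟪x, e⟫ ≤ s * ‖x‖} =
      Subtype.val ⁻¹' {x | ⟪x, e⟫ ≤ s} := by
    ext x
    simp
  have hB : MeasurableSet {x : Amb k | ⟪x, e⟫ ≤ s} :=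
    measurableSet_le (by fun_prop) (by fun_prop)
  rw [hpre, sphereUniform, sphereSurface, Measure.smul_apply,
    Measure.map_apply measurable_subtype_coe hB,
    Measure.map_apply measurable_subtype_coe MeasurableSet.univ, Set.preimage_univ,
    smul_eq_mul, mul_comm]
lemma gaussianPDFReal_zero_one (x : ℝ) :
    gaussianPDFReal 0 1 x = (√(2 * π))⁻¹ * rexp (-x ^ 2 / 2) := by
  simp [gaussianPDFReal]

lemma gaussianPDFReal_zero_one_le (x : ℝ) : gaussianPDFReal 0 1 x ≤ rexp (-x ^ 2 / 2) := by
  rw [gaussianPDFReal_zero_one]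
  refine mul_le_of_le_one_left (Real.exp_pos _).le (inv_le_one_of_one_le₀ ?_)
  rw [Real.one_le_sqrt]
  linarith [Real.pi_gt_three]

lemma hasDerivAt_gaussianPDFReal_zero_one (x : ℝ) :
    HasDerivAt (gaussianPDFReal 0 1) (-x * gaussianPDFReal 0 1 x) x := by
  have h : gaussianPDFReal 0 1 = fun x ↦ (√(2 * π))⁻¹ * rexp (-x ^ 2 / 2) :=
    funext gaussianPDFReal_zero_one
  rw [h]
  have h1 : HasDerivAt (fun x : ℝ ↦ -x ^ 2 / 2) (-x) x := by
    refine ((hasDerivAt_pow 2 x).neg.div_const 2).congr_deriv ?_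
    norm_num
    ring
  refine (h1.exp.const_mul ((√(2 * π))⁻¹)).congr_deriv ?_
  ring

lemma mul_gaussianPDFReal_le_one (x : ℝ) : x * gaussianPDFReal 0 1 x ≤ 1 := by
  rcases le_total x 0 with hx | hx
  · nlinarith [gaussianPDFReal_nonneg 0 1 x]
  have h1 := Real.add_one_le_exp (x ^ 2 / 2)
  calc x * gaussianPDFReal 0 1 x ≤ rexp (x ^ 2 / 2) * rexp (-x ^ 2 / 2) := by
        refine mul_le_mul ?_ (gaussianPDFReal_zero_one_le x) (gaussianPDFReal_nonneg _ _ _)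
          (Real.exp_pos _).le
        nlinarith [sq_nonneg (x - 1)]
    _ = 1 := by rw [← Real.exp_add, neg_div, add_neg_cancel, Real.exp_zero]

lemma pow_three_mul_gaussianPDFReal_le (x : ℝ) : x ^ 3 * gaussianPDFReal 0 1 x ≤ 8 := by
  have h1 : (1 + x ^ 2 / 4) ^ 2 ≤ rexp (x ^ 2 / 2) := by
    have h2 : rexp (x ^ 2 / 2) = rexp (x ^ 2 / 4) ^ 2 := by
      rw [← Real.exp_nat_mul]; ring_nf
    rw [h2]
    gcongr
    linarith [Real.add_one_le_exp (x ^ 2 / 4)]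
  calc x ^ 3 * gaussianPDFReal 0 1 x ≤ (8 * rexp (x ^ 2 / 2)) * gaussianPDFReal 0 1 x := by
        refine mul_le_mul_of_nonneg_right ?_ (gaussianPDFReal_nonneg _ _ _)
        nlinarith [sq_nonneg (x * (x - 1)), sq_nonneg x]
    _ ≤ (8 * rexp (x ^ 2 / 2)) * rexp (-x ^ 2 / 2) := by
        gcongr
        exact gaussianPDFReal_zero_one_le x
    _ = 8 := by rw [mul_assoc, ← Real.exp_add, neg_div, add_neg_cancel, Real.exp_zero, mul_one]

lemma gaussianReal_real_Iic_eq_integral (x : ℝ) :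
    (gaussianReal 0 1).real (Set.Iic x) = ∫ t in Set.Iic x, gaussianPDFReal 0 1 t := by
  rw [measureReal_def, gaussianReal_apply_eq_integral _ one_ne_zero, ENNReal.toReal_ofReal]
  exact integral_nonneg fun t ↦ gaussianPDFReal_nonneg _ _ _

lemma stdGaussianCDF_eq (x : ℝ) : stdGaussianCDF x = (gaussianReal 0 1).real (Set.Iic x) := by
  rw [gaussianReal_real_Iic_eq_integral, stdGaussianCDF, ← integral_const_mul]
  simp only [gaussianPDFReal_zero_one]

lemma hasDerivAt_gaussianReal_real_Iic (x : ℝ) :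
    HasDerivAt (fun x ↦ (gaussianReal 0 1).real (Set.Iic x)) (gaussianPDFReal 0 1 x) x := by
  have hi := integrable_gaussianPDFReal 0 1
  have hc : Continuous (gaussianPDFReal 0 1) :=
    continuous_iff_continuousAt.2 fun x ↦ (hasDerivAt_gaussianPDFReal_zero_one x).continuousAt
  have h : (fun x ↦ (gaussianReal 0 1).real (Set.Iic x)) = fun x ↦
      (∫ t in (0 : ℝ)..x, gaussianPDFReal 0 1 t) + ∫ t in Set.Iic 0, gaussianPDFReal 0 1 t := by
    ext x
    rw [gaussianReal_real_Iic_eq_integral,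
      ← intervalIntegral.integral_Iic_sub_Iic hi.integrableOn hi.integrableOn]
    ring
  rw [h]
  exact (hc.integral_hasStrictDerivAt 0 x).hasDerivAt.add_const _

lemma gaussianReal_real_Iic_neg (x : ℝ) :
    (gaussianReal 0 1).real (Set.Iic (-x)) = 1 - (gaussianReal 0 1).real (Set.Iic x) := by
  have : NullSingletonClass (gaussianReal 0 1) := nullSingletonClass_gaussianReal one_ne_zero
  rw [← probReal_compl_eq_one_sub measurableSet_Iic, Set.compl_Iic,
    measureReal_congr (Ioi_ae_eq_Ici (a := x)), measureReal_def, measureReal_def]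
  have h : gaussianReal 0 1 = (gaussianReal 0 1).map (fun x ↦ -x) := by
    rw [gaussianReal_map_neg, neg_zero]
  nth_rewrite 1 [h]
  rw [Measure.map_apply measurable_neg measurableSet_Iic]
  congr 2
  ext y
  simp

/-- A quadratic Taylor estimate in `r ^ 2` at `r = 1` for the Gaussian tail at `a * r`,
uniform in `a`. -/
lemma abs_gaussianReal_real_Iic_taylor_le {a r : ℝ} (ha : 0 ≤ a) (hr : 0 ≤ r) :
    |(gaussianReal 0 1).real (Set.Iic (-(a * r))) - (gaussianReal 0 1).real (Set.Iic (-a)) +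
      a * gaussianPDFReal 0 1 a / 2 * (r ^ 2 - 1)| ≤ 33 * (r ^ 2 - 1) ^ 2 := by
  set φ := gaussianPDFReal 0 1 with hφ
  set H : ℝ → ℝ := fun x ↦ (gaussianReal 0 1).real (Set.Iic x) with hH
  change |H (-(a * r)) - H (-a) + a * φ a / 2 * (r ^ 2 - 1)| ≤ _
  have hb0 : 0 ≤ a * φ a := mul_nonneg ha (gaussianPDFReal_nonneg _ _ _)
  have hb1 : a * φ a ≤ 1 := mul_gaussianPDFReal_le_one a
  rcases lt_or_ge r (1 / 2) with hr2 | hr2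
  · have h1 : ∀ x, 0 ≤ H x := fun x ↦ measureReal_nonneg
    have h2 : ∀ x, H x ≤ 1 := fun x ↦ measureReal_le_one
    have h3 : r ^ 2 ≤ 1 / 4 := by nlinarith
    have h4 : (9 : ℝ) / 16 ≤ (r ^ 2 - 1) ^ 2 := by nlinarith
    have h5 : |a * φ a / 2 * (r ^ 2 - 1)| ≤ 1 := by
      rw [abs_mul, abs_of_nonneg (by positivity : 0 ≤ a * φ a / 2)]
      have : |r ^ 2 - 1| ≤ 1 := abs_le.2 ⟨by nlinarith, by nlinarith⟩
      nlinarith [abs_nonneg (r ^ 2 - 1)]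
    rw [abs_le] at h5 ⊢
    constructor <;> linarith [h1 (-(a * r)), h1 (-a), h2 (-(a * r)), h2 (-a)]
  set G : ℝ → ℝ := fun x ↦ -a * φ (a * x) with hG
  have hmul : ∀ x, HasDerivAt (fun x ↦ a * x) a x := fun x ↦ by
    simpa using (hasDerivAt_id x).const_mul a
  have hsym : ∀ x, φ (-x) = φ x := fun x ↦ by simp [hφ, gaussianPDFReal_zero_one]
  have hgd : ∀ x, HasDerivAt (fun x ↦ H (-(a * x))) (G x) x := fun x ↦ by
    refine ((hasDerivAt_gaussianReal_real_Iic (-(a * x))).comp x (hmul x).neg).congr_deriv ?_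
    rw [← hφ, hsym]
    simp only [hG]
    ring
  have hGd : ∀ x, HasDerivAt G (a * (a * (a * x) * φ (a * x))) x := fun x ↦ by
    refine (((hasDerivAt_gaussianPDFReal_zero_one (a * x)).comp x (hmul x)).const_mul
      (-a)).congr_deriv ?_
    ring
  have hbd : ∀ x, 1 / 2 ≤ x → ‖a * (a * (a * x) * φ (a * x))‖ ≤ 32 := fun x hx ↦ by
    have hφ0 : 0 ≤ φ (a * x) := gaussianPDFReal_nonneg _ _ _
    have hx0 : 0 ≤ x := by linarith
    rw [Real.norm_of_nonneg (by positivity)]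
    have h1 : (a * x) ^ 3 * φ (a * x) ≤ 8 := pow_three_mul_gaussianPDFReal_le _
    have h2 : 0 ≤ a * (a * (a * x) * φ (a * x)) := by positivity
    have h3 : (1 : ℝ) / 4 ≤ x ^ 2 := by nlinarith
    nlinarith [mul_le_mul_of_nonneg_left h3 h2]
  have hGL : ∀ x, 1 / 2 ≤ x → |G x - G 1| ≤ 32 * |x - 1| := fun x hx ↦
    (convex_Ici (1 / 2 : ℝ)).norm_image_sub_le_of_norm_hasDerivWithin_le
      (fun y _ ↦ (hGd y).hasDerivWithinAt) (fun y hy ↦ hbd y hy)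
      (by norm_num : (1 : ℝ) ∈ Set.Ici (1 / 2 : ℝ)) hx
  have hw := (convex_uIcc 1 r).norm_image_sub_le_of_norm_hasDerivWithin_le
    (f := fun x ↦ H (-(a * x)) - G 1 * x) (f' := fun x ↦ G x - G 1) (C := 32 * |r - 1|)
    (fun y _ ↦
      (((hgd y).sub ((hasDerivAt_id y).const_mul (G 1))).congr_deriv
        (by rw [mul_one])).hasDerivWithinAt)
    (fun y hy ↦ by
      have hy2 : 1 / 2 ≤ y := le_trans (le_inf (by norm_num) hr2) hy.1
      refine (hGL y hy2).trans ?_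
      gcongr 32 * ?_
      exact Set.abs_sub_left_of_mem_uIcc hy)
    Set.left_mem_uIcc Set.right_mem_uIcc
  have h6 : |H (-(a * r)) - H (-a) + a * φ a * (r - 1)| ≤ 32 * ((r - 1) * (r - 1)) := by
    rw [← abs_mul_abs_self (r - 1), ← mul_assoc]
    refine le_trans (le_of_eq ?_) hw
    rw [Real.norm_eq_abs]
    simp only [hG, mul_one]
    congr 1
    ring
  have h7 : (r - 1) * (r - 1) ≤ (r ^ 2 - 1) ^ 2 := by
    have : (r ^ 2 - 1) ^ 2 = (r - 1) * (r - 1) * (r + 1) ^ 2 := by ring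
    rw [this]
    exact le_mul_of_one_le_right (mul_self_nonneg _) (by nlinarith)
  have h8 : a * φ a * ((r - 1) * (r - 1)) ≤ (r - 1) * (r - 1) :=
    mul_le_of_le_one_left (mul_self_nonneg _) hb1
  have h9 : 0 ≤ a * φ a * ((r - 1) * (r - 1)) := mul_nonneg hb0 (mul_self_nonneg _)
  rw [abs_le] at h6 ⊢
  constructor <;> nlinarith [h6.1, h6.2]

lemma memLp_sq_gaussianReal : MemLp (fun x : ℝ ↦ x ^ 2) 2 (gaussianReal 0 1) := by
  rw [memLp_two_iff_integrable_sq (by fun_prop)]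
  have h : MemLp (fun x : ℝ ↦ x) (4 : ℕ) (gaussianReal 0 1) :=
    memLp_id_gaussianReal' _ (by finiteness)
  refine (h.integrable_norm_pow (by norm_num)).congr (.of_forall fun x ↦ ?_)
  beta_reduce
  rw [Real.norm_eq_abs, ← pow_mul, Even.pow_abs (by decide)]

lemma integral_sq_gaussianReal : ∫ x, x ^ 2 ∂(gaussianReal 0 1) = 1 := by
  have h := variance_of_integral_eq_zero (X := fun x : ℝ ↦ x) (μ := gaussianReal 0 1)
    (by fun_prop) integral_id_gaussianReal
  rw [variance_fun_id_gaussianReal] at h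
  simpa using h.symm

/-- The chi-squared law with `k` degrees of freedom has mean `k` and variance linear in `k`. -/
lemma chiSq_moments (k : ℕ) :
    MemLp (fun y : Fin k → ℝ ↦ ∑ i, y i ^ 2) 2 (Measure.pi fun _ ↦ gaussianReal 0 1) ∧
    ∫ y : Fin k → ℝ, ∑ i, y i ^ 2 ∂(Measure.pi fun _ ↦ gaussianReal 0 1) = k ∧
    ∫ y : Fin k → ℝ, (∑ i, y i ^ 2 - k) ^ 2 ∂(Measure.pi fun _ ↦ gaussianReal 0 1) =
      k * Var[fun x ↦ x ^ 2; gaussianReal 0 1] := by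
  have hmem : MemLp (fun y : Fin k → ℝ ↦ ∑ i, y i ^ 2) 2
      (Measure.pi fun _ ↦ gaussianReal 0 1) :=
    memLp_finsetSum _ fun i _ ↦
      memLp_sq_gaussianReal.comp_measurePreserving (measurePreserving_eval _ i)
  have hmean : ∫ y : Fin k → ℝ, ∑ i, y i ^ 2 ∂(Measure.pi fun _ ↦ gaussianReal 0 1) = k := by
    rw [integral_finsetSum (f := fun i (y : Fin k → ℝ) ↦ y i ^ 2) _ fun i _ ↦
      (memLp_sq_gaussianReal.comp_measurePreserving
        (measurePreserving_eval _ i)).integrable one_le_two]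
    have : ∀ i : Fin k, ∫ y : Fin k → ℝ, y i ^ 2 ∂(Measure.pi fun _ ↦ gaussianReal 0 1) = 1 :=
      fun i ↦ by
        rw [integral_comp_eval (μ := fun _ : Fin k ↦ gaussianReal 0 1)
          (f := fun x : ℝ ↦ x ^ 2) (by fun_prop), integral_sq_gaussianReal]
    simp [this]
  refine ⟨hmem, hmean, ?_⟩
  have hvar := variance_sum_pi (ι := Fin k) (μ := fun _ ↦ gaussianReal 0 1)
    (X := fun _ x ↦ x ^ 2) fun _ ↦ memLp_sq_gaussianReal
  have hfun : (∑ i, fun y : Fin k → ℝ ↦ y i ^ 2) = fun y ↦ ∑ i, y i ^ 2 := by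
    ext y; simp
  rw [hfun, variance_eq_integral hmem.aestronglyMeasurable.aemeasurable, hmean] at hvar
  simpa using hvar

/-- Probability that a standard Gaussian variable is at most `-a` times the square root of an
independent chi-squared variable divided by its number `k` of degrees of freedom. -/
def studentTail (k : ℕ) (a : ℝ) : ℝ :=
  ((gaussianReal 0 1).prod (Measure.pi fun _ : Fin k ↦ gaussianReal 0 1)).real
    {z | z.1 ≤ -(a * √((∑ i, z.2 i ^ 2) / k))}

lemma measurableSet_studentTail (k : ℕ) (a : ℝ) :
    MeasurableSet {z : ℝ × (Fin k → ℝ) | z.1 ≤ -(a * √((∑ i, z.2 i ^ 2) / k))} :=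
  measurableSet_le (by fun_prop) (by fun_prop)

lemma studentTail_eq_integral (k : ℕ) (a : ℝ) :
    studentTail k a = ∫ y : Fin k → ℝ,
      (gaussianReal 0 1).real (Set.Iic (-(a * √((∑ i, y i ^ 2) / k))))
        ∂(Measure.pi fun _ ↦ gaussianReal 0 1) := by
  have hm := measurableSet_studentTail k a
  rw [studentTail, measureReal_def, Measure.prod_apply_symm hm, ← integral_toReal]
  · rfl
  · exact (measurable_measure_prodMk_right hm).aemeasurable
  · exact .of_forall fun y ↦ measure_lt_top _ _

lemma abs_studentTail_sub_le {k : ℕ} (hk : 0 < k) {a : ℝ} (ha : 0 ≤ a) :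
    |studentTail k a - (gaussianReal 0 1).real (Set.Iic (-a))| ≤
      33 * Var[fun x ↦ x ^ 2; gaussianReal 0 1] / k := by
  obtain ⟨hmem, hmean, hvar⟩ := chiSq_moments k
  have hk' : (0 : ℝ) < k := by exact_mod_cast hk
  set P := Measure.pi fun _ : Fin k ↦ gaussianReal 0 1 with hP
  set H : ℝ → ℝ := fun x ↦ (gaussianReal 0 1).real (Set.Iic x) with hH
  set β := a * gaussianPDFReal 0 1 a / 2 with hβ
  set D : (Fin k → ℝ) → ℝ := fun y ↦ (∑ i, y i ^ 2) / k - 1 with hD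
  have hDint : Integrable D P :=
    ((hmem.integrable one_le_two).div_const _).sub (integrable_const _)
  have hD0 : ∫ y, D y ∂P = 0 := by
    rw [hD, integral_sub ((hmem.integrable one_le_two).div_const _) (integrable_const _),
      integral_div, hmean]
    simp [hk'.ne']
  have hDsq : ∀ y, D y ^ 2 = (∑ i, y i ^ 2 - k) ^ 2 / k ^ 2 := fun y ↦ by
    simp only [hD]
    field_simp
  have hD2int : Integrable (fun y ↦ D y ^ 2) P := by
    simp only [hDsq]
    exact ((hmem.sub (memLp_const (k : ℝ))).integrable_sq).div_const _
  have hD2 : ∫ y, D y ^ 2 ∂P = Var[fun x ↦ x ^ 2; gaussianReal 0 1] / k := by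
    simp only [hDsq]
    rw [integral_div, hvar]
    field_simp
  have hHm : Measurable fun y : Fin k → ℝ ↦ H (-(a * √((∑ i, y i ^ 2) / k))) :=
    (measurable_measure_prodMk_right (measurableSet_studentTail k a)).ennreal_toReal
  have hHint : Integrable (fun y : Fin k → ℝ ↦ H (-(a * √((∑ i, y i ^ 2) / k)))) P :=
    Integrable.of_bound hHm.aestronglyMeasurable 1 (.of_forall fun y ↦ by
      rw [Real.norm_of_nonneg measureReal_nonneg]
      exact measureReal_le_one)
  have heq : studentTail k a - H (-a) =
      ∫ y, (H (-(a * √((∑ i, y i ^ 2) / k))) - H (-a) + β * D y) ∂P := by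
    have hsub : Integrable (fun y : Fin k → ℝ ↦ H (-(a * √((∑ i, y i ^ 2) / k))) - H (-a)) P :=
      hHint.sub (integrable_const _)
    rw [integral_add hsub (hDint.const_mul β), integral_const_mul, hD0,
      integral_sub hHint (integrable_const _), studentTail_eq_integral]
    simp [hH, hP]
  have hb := norm_integral_le_of_norm_le (hD2int.const_mul 33)
    (f := fun y ↦ H (-(a * √((∑ i, y i ^ 2) / k))) - H (-a) + β * D y)
    (.of_forall fun y ↦ by
      have hnn : 0 ≤ (∑ i, y i ^ 2) / (k : ℝ) := by positivity
      have := abs_gaussianReal_real_Iic_taylor_le ha (Real.sqrt_nonneg ((∑ i, y i ^ 2) / (k : ℝ)))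
      rw [Real.sq_sqrt hnn] at this
      exact this)
  rw [← heq, integral_const_mul, hD2, ← mul_div_assoc] at hb
  exact hb

lemma le_neg_mul_sqrt_iff {t σ M : ℝ} (hσ : 0 ≤ σ) :
    t ≤ -(σ * √M) ↔ t ≤ 0 ∧ σ ^ 2 * M ≤ t ^ 2 := by
  have h : σ * √M = √(σ ^ 2 * M) := by rw [Real.sqrt_mul (sq_nonneg σ), Real.sqrt_sq hσ]
  rw [le_neg, h, Real.sqrt_le_iff, neg_nonneg, neg_sq]

lemma exists_unit_stdGaussian_cone_eq (k : ℕ) (s : ℝ) :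
    ∃ e : Amb k, ‖e‖ = 1 ∧ stdGaussian (Amb k) {x | ⟪x, e⟫ ≤ s * ‖x‖} =
      ((gaussianReal 0 1).prod (Measure.pi fun _ : Fin k ↦ gaussianReal 0 1))
        {z | z.1 ≤ s * √(z.1 ^ 2 + ∑ i, z.2 i ^ 2)} := by
  refine ⟨EuclideanSpace.single 0 1, by simp, ?_⟩
  have hA : MeasurableSet {x : Amb k | ⟪x, EuclideanSpace.single 0 1⟫ ≤ s * ‖x‖} :=
    measurableSet_le (by fun_prop) (by fun_prop)
  have hB : MeasurableSet {z : ℝ × (Fin k → ℝ) | z.1 ≤ s * √(z.1 ^ 2 + ∑ i, z.2 i ^ 2)} :=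
    measurableSet_le (by fun_prop) (by fun_prop)
  rw [← map_pi_eq_stdGaussian, Measure.map_apply (by fun_prop) hA,
    ← (measurePreserving_piFinSuccAbove (fun _ : Fin (k + 1) ↦ gaussianReal 0 1) 0).measure_preimage
      hB.nullMeasurableSet]
  congr 1
  ext x
  simp [EuclideanSpace.norm_eq, Fin.sum_univ_succ, EuclideanSpace.inner_single_right,
    MeasurableEquiv.piFinSuccAbove, Fin.tail]

/-- `p` is a Student tail at `a = c / √(1 - c² / k)` when `c² < k`, and otherwise is at most every
Student tail. -/
lemma IsCkp.studentTail_eq_or_le {k : ℕ} (hk : 0 < k) {p c : ℝ} (hp : 0 ≤ p) (h : IsCkp k p c) :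
    (∃ a, 0 ≤ a ∧ c ^ 2 * (1 + a ^ 2 / k) = a ^ 2 ∧ studentTail k a = p) ∨
      ∀ a, 0 ≤ a → p ≤ studentTail k a := by
  obtain ⟨hc, hall⟩ := h
  have hk' : (0 : ℝ) < k := by exact_mod_cast hk
  obtain ⟨e, he, hcone⟩ := exists_unit_stdGaussian_cone_eq k (-c / √k)
  have hpe := hall e he
  rw [sphereUniform_cap_eq_stdGaussian, hcone] at hpe
  have hpr : ((gaussianReal 0 1).prod (Measure.pi fun _ : Fin k ↦ gaussianReal 0 1)).real
      {z | z.1 ≤ -c / √k * √(z.1 ^ 2 + ∑ i, z.2 i ^ 2)} = p := by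
    rw [measureReal_def, hpe, ENNReal.toReal_ofReal hp]
  have hσ : 0 ≤ c / √k := by positivity
  have hσ2 : (c / √k) ^ 2 = c ^ 2 / k := by rw [div_pow, Real.sq_sqrt hk'.le]
  rcases lt_or_ge (c ^ 2) k with hck | hck
  · left
    have hd : 0 < 1 - c ^ 2 / k := by rw [sub_pos, div_lt_one hk']; exact hck
    have ha2 : (c / √(1 - c ^ 2 / k)) ^ 2 = c ^ 2 / (1 - c ^ 2 / k) := by
      rw [div_pow, Real.sq_sqrt hd.le]
    refine ⟨c / √(1 - c ^ 2 / k), by positivity, ?_, ?_⟩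
    · rw [ha2]
      have : (k : ℝ) - c ^ 2 ≠ 0 := by linarith
      field_simp
      ring
    · rw [← hpr, studentTail]
      congr 1
      ext ⟨t, y⟩
      simp only [Set.mem_ofPred_eq]
      rw [le_neg_mul_sqrt_iff (by positivity), neg_div, neg_mul, le_neg_mul_sqrt_iff hσ, hσ2, ha2]
      refine and_congr_right fun _ ↦ ?_
      have : (k : ℝ) - c ^ 2 > 0 := by linarith
      have h1 : c ^ 2 / (1 - c ^ 2 / k) * ((∑ i, y i ^ 2) / k) =
          c ^ 2 * (∑ i, y i ^ 2) / (k - c ^ 2) := by field_simp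
      have h2 : c ^ 2 / k * (t ^ 2 + ∑ i, y i ^ 2) =
          c ^ 2 * (t ^ 2 + ∑ i, y i ^ 2) / k := by ring
      rw [h1, h2, div_le_iff₀ this, div_le_iff₀ hk']
      constructor <;> intro h <;> linarith
  · right
    intro a ha
    rw [← hpr, studentTail]
    refine measureReal_mono fun ⟨t, y⟩ hz ↦ ?_
    simp only [Set.mem_ofPred_eq] at hz ⊢
    rw [neg_div, neg_mul, le_neg_mul_sqrt_iff hσ, hσ2] at hz
    rw [le_neg_mul_sqrt_iff ha]
    refine ⟨hz.1, ?_⟩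
    have h1 : 1 ≤ c ^ 2 / k := by rwa [one_le_div hk']
    have hS : 0 ≤ ∑ i, y i ^ 2 := by positivity
    have h3 := mul_le_mul_of_nonneg_right h1 (by positivity : 0 ≤ t ^ 2 + ∑ i, y i ^ 2)
    have h2 : ∑ i, y i ^ 2 = 0 := by linarith [hz.2]
    rw [h2]
    simpa using sq_nonneg t

lemma mul_sub_le_gaussianReal_real_Iic_sub {b x y : ℝ} (hx : 0 ≤ x) (hxy : x ≤ y) (hy : y ≤ b) :
    gaussianPDFReal 0 1 b * (y - x) ≤
      (gaussianReal 0 1).real (Set.Iic (-x)) - (gaussianReal 0 1).real (Set.Iic (-y)) := by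
  have h := (convex_Icc (-b) 0).mul_sub_le_image_sub_of_le_deriv
    (f := fun x ↦ (gaussianReal 0 1).real (Set.Iic x)) (C := gaussianPDFReal 0 1 b)
    (fun z _ ↦ (hasDerivAt_gaussianReal_real_Iic z).continuousAt.continuousWithinAt)
    (fun z _ ↦ (hasDerivAt_gaussianReal_real_Iic z).differentiableAt.differentiableWithinAt)
    (fun z hz ↦ by
      have hz' := interior_subset hz
      rw [(hasDerivAt_gaussianReal_real_Iic z).deriv, gaussianPDFReal_zero_one,
        gaussianPDFReal_zero_one]
      have : z ^ 2 ≤ b ^ 2 := by nlinarith [hz'.1, hz'.2]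
      gcongr)
    (-y) ⟨by linarith, by linarith⟩ (-x) ⟨by linarith, by linarith⟩ (by linarith)
  linarith

lemma sub_le_of_sq_mul_one_add_eq {a c n : ℝ} (ha : 0 ≤ a) (hc : 0 ≤ c) (hn : 0 < n)
    (h : c ^ 2 * (1 + a ^ 2 / n) = a ^ 2) : c ≤ a ∧ a - c ≤ a ^ 3 / n := by
  have h0 : 0 ≤ c ^ 2 * (a ^ 2 / n) := by positivity
  have hca : c ≤ a := abs_le_of_sq_le_sq' (by linarith) ha |>.2
  refine ⟨hca, ?_⟩
  rcases ha.eq_or_lt with rfl | ha'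
  · simpa using hc
  refine le_of_mul_le_mul_right ?_ (by linarith : 0 < a + c)
  calc (a - c) * (a + c) = c ^ 2 * (a ^ 2 / n) := by linarith
    _ ≤ (a * (a + c)) * (a ^ 2 / n) := by gcongr; nlinarith
    _ = a ^ 3 / n * (a + c) := by ring

/-!
Statement 2 (Lemma on convergence of `c_{k,p}`): for fixed `p ∈ (0,1/2)`, with
`q = Φ⁻¹(1-p)` (i.e. `Φ q = 1 - p`), there are `K > 0` and `k0` such that
`|c_{k,p} − q| ≤ K/k` for all `k ≥ k0`; in particular `c_{k,p} → Φ⁻¹(1-p)`.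
-/

theorem cpk_convergence (p : ℝ) (hp : p ∈ Set.Ioo (0 : ℝ) (1 / 2))
    (q : ℝ) (hq : stdGaussianCDF q = 1 - p) :
    ∃ K : ℝ, 0 < K ∧ ∃ k0 : ℕ, ∀ k : ℕ, k0 ≤ k →
      ∀ c : ℝ, IsCkp k p c → |c - q| ≤ K / k := by
  obtain ⟨hp0, hp1⟩ := hp
  set H : ℝ → ℝ := fun x ↦ (gaussianReal 0 1).real (Set.Iic x) with hH
  have hHmono : Monotone H := fun x y hxy ↦ measureReal_mono (Set.Iic_subset_Iic.2 hxy)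
  have hHq : H q = 1 - p := by rw [← hq, stdGaussianCDF_eq]
  have hneg : ∀ x, H (-x) = 1 - H x := gaussianReal_real_Iic_neg
  have hHnq : H (-q) = p := by rw [hneg, hHq]; ring
  have hq0 : 0 ≤ q := by
    by_contra! h
    have h1 := hHmono h.le
    have h2 := hneg 0
    rw [neg_zero] at h2
    linarith
  set m := gaussianPDFReal 0 1 (q + 1) with hm
  have hm0 : 0 < m := gaussianPDFReal_pos _ _ _ one_ne_zero
  have hmvt : ∀ x y, 0 ≤ x → x ≤ y → y ≤ q + 1 → m * (y - x) ≤ H (-x) - H (-y) :=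
    fun x y ↦ mul_sub_le_gaussianReal_real_Iic_sub
  have hgap : H (-(q + 1)) + m ≤ p := by
    have := hmvt q (q + 1) hq0 (by linarith) le_rfl
    linarith
  set C := 33 * Var[fun x ↦ x ^ 2; gaussianReal 0 1] with hC
  have hC0 : 0 ≤ C := mul_nonneg (by norm_num) (variance_nonneg _ _)
  obtain ⟨k0, hk0⟩ := exists_nat_gt (C / m)
  refine ⟨C / m + (q + 1) ^ 3, by positivity, k0, fun k hk c hc ↦ ?_⟩
  have hkr : C / m < k := hk0.trans_le (by exact_mod_cast hk)
  have hk' : (0 : ℝ) < k := lt_of_le_of_lt (by positivity) hkr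
  have hkpos : 0 < k := by exact_mod_cast hk'
  have hCk : C / k < m := by
    rw [div_lt_iff₀ hm0] at hkr
    rw [div_lt_iff₀ hk']
    linarith
  rcases hc.studentTail_eq_or_le hkpos hp0.le with ⟨a, ha0, hac, hap⟩ | hall
  · have hbound : |p - H (-a)| ≤ C / k := hap ▸ abs_studentTail_sub_le hkpos ha0
    rw [abs_le] at hbound
    have haq : a ≤ q + 1 := by
      by_contra! h
      have := hHmono (neg_le_neg h.le)
      linarith
    have haq' : |a - q| ≤ C / m / k := by
      rw [div_right_comm, le_div_iff₀ hm0]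
      rcases le_total a q with h | h
      · have := hmvt a q ha0 h (by linarith)
        rw [abs_of_nonpos (by linarith)]
        linarith
      · have := hmvt q a hq0 h haq
        rw [abs_of_nonneg (by linarith)]
        linarith
    obtain ⟨hca, hca'⟩ := sub_le_of_sq_mul_one_add_eq ha0 hc.1 hk' hac
    have ha3 : a ^ 3 / k ≤ (q + 1) ^ 3 / k := by gcongr
    rw [add_div]
    rw [abs_le] at haq' ⊢
    have : 0 ≤ (q + 1) ^ 3 / (k : ℝ) := by positivity
    constructor <;> linarith
  · exfalso
    have h1 := hall (q + 1) (by linarith)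
    have h2 := (abs_le.1 (abs_studentTail_sub_le hkpos (by linarith : 0 ≤ q + 1))).2
    change studentTail k (q + 1) - H (-(q + 1)) ≤ C / k at h2
    linarith
end
end
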